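/- arXiv:1405.2781 — 5 statements merged into one kernel-verified Lean document; each statement's English description precedes it below -/
import Mathlib

section
/- Let p ≥ 1, d ≥ 1, and let X be an ℝ^d-valued random vector with E[|X|^{p+δ}] < ∞ for some δ > 0. Let P_X = f·λ_d + ν be the Lebesgue decomposition of the law of X, where λ_d is Lebesgue measure on ℝ^d and ν ⊥ λ_d. Then lim_{N→∞} N^{p/d} · inf{ E[dist(X,γ)^p] : γ ⊂ ℝ^d, card(γ) ≤ N } = J_{p,d} · ( ∫_{ℝ^d} f(u)^{d/(p+d)} du )^{(p+d)/d}, where J_{p,d} = inf_{N≥1} N^{p/d} · inf{ ∫_{[0,1]^d} dist(u,γ)^p du : γ ⊂ ℝ^d, card(γ) ≤ N } is the Zador constant obtained from the uniform distribution on [0,1]^d. -/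
open MeasureTheory ProbabilityTheory Filter

/-- The `p`-th power `L_p`-quantization error of a measure `μ` on `ℝ^d` for a grid `γ`:
`∫ dist(z,γ)^p dμ(z)`. -/
noncomputable def qErr {d : ℕ} (μ : Measure (EuclideanSpace ℝ (Fin d))) (p : ℝ)
    (γ : Set (EuclideanSpace ℝ (Fin d))) : ℝ :=
  ∫ z, Metric.infDist z γ ^ p ∂μ

/-- The optimal `p`-th power `L_p`-quantization error of `μ` at level `N`:
the infimum of `∫ dist(z,γ)^p dμ(z)` over all nonempty grids `γ ⊂ ℝ^d` with at most `N`
points. -/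
noncomputable def optQErr {d : ℕ} (μ : Measure (EuclideanSpace ℝ (Fin d))) (p : ℝ)
    (N : ℕ) : ℝ :=
  sInf {e | ∃ γ : Finset (EuclideanSpace ℝ (Fin d)), γ.Nonempty ∧ γ.card ≤ N ∧ e = qErr μ p ↑γ}

/-- The uniform distribution on the unit cube `[0,1]^d`. -/
noncomputable def unifCube (d : ℕ) : Measure (EuclideanSpace ℝ (Fin d)) :=
  volume.restrict {u | ∀ i, u i ∈ Set.Icc (0:ℝ) 1}

/-- The Zador constant `J_{p,d}`, obtained from the uniform distribution on `[0,1]^d`. -/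
noncomputable def zadorConst (p : ℝ) (d : ℕ) : ℝ :=
  sInf {r | ∃ N : ℕ, 1 ≤ N ∧ r = (N : ℝ) ^ (p / (d : ℝ)) * optQErr (unifCube d) p N}

noncomputable section
open scoped ENNReal NNReal Topology

/-- the error in `[0,∞]` -/
def zV {d : ℕ} (p : ℝ) (μ : Measure (EuclideanSpace ℝ (Fin d)))
    (γ : Finset (EuclideanSpace ℝ (Fin d))) : ℝ≥0∞ :=
  ∫⁻ z, Metric.infEDist z (γ : Set (EuclideanSpace ℝ (Fin d))) ^ p ∂μ

def zUat {d : ℕ} (p b : ℝ) (μ : Measure (EuclideanSpace ℝ (Fin d))) (a : ℝ) : Prop :=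
  ∀ᶠ ε in 𝓝[>] (0:ℝ), ∃ γ : Finset (EuclideanSpace ℝ (Fin d)),
    (γ.card : ℝ) ≤ a / ε ∧ zV p μ γ ≤ ENNReal.ofReal (a * ε ^ b)

def zU {d : ℕ} (p b : ℝ) (μ : Measure (EuclideanSpace ℝ (Fin d))) (a : ℝ) : Prop :=
  ∀ a' > a, zUat p b μ a'

def zL {d : ℕ} (p b : ℝ) (μ : Measure (EuclideanSpace ℝ (Fin d))) (a : ℝ) : Prop :=
  ∀ a' < a, ∀ᶠ ε in 𝓝[>] (0:ℝ), ∀ γ : Finset (EuclideanSpace ℝ (Fin d)),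
    ENNReal.ofReal ((1 + b) * a' * ε ^ b) ≤
      zV p μ γ + ENNReal.ofReal (b * ε ^ (1 + b) * γ.card)

section basics
variable {d : ℕ} {p b : ℝ} {μ μ₁ μ₂ : Measure (EuclideanSpace ℝ (Fin d))}
  {γ γ' : Finset (EuclideanSpace ℝ (Fin d))} {a c : ℝ}

lemma zV_meas (p : ℝ) (γ : Finset (EuclideanSpace ℝ (Fin d))) : Measurable
    (fun z => Metric.infEDist z (γ : Set (EuclideanSpace ℝ (Fin d))) ^ p) := by
  exact measurable_infEDist.pow_const p

lemma zV_add : zV p (μ₁ + μ₂) γ = zV p μ₁ γ + zV p μ₂ γ := lintegral_add_measure _ _ _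

lemma zV_mono (h : μ₁ ≤ μ₂) : zV p μ₁ γ ≤ zV p μ₂ γ := lintegral_mono' h le_rfl

lemma zV_anti (hp : 0 ≤ p) (h : γ ⊆ γ') : zV p μ γ' ≤ zV p μ γ := by
  apply lintegral_mono
  intro z
  have := Metric.infEDist_anti (x := z) (Finset.coe_subset.2 h)
  dsimp only
  gcongr

lemma zUat_add (h1 : zUat p b μ₁ a) (h2 : zUat p b μ₂ c) (ha : 0 ≤ a) (hc : 0 ≤ c)
    (hp : 0 ≤ p) : zUat p b (μ₁ + μ₂) (a + c) := by
  classical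
  filter_upwards [h1, h2, self_mem_nhdsWithin] with ε ⟨γ₁, h11, h12⟩ ⟨γ₂, h21, h22⟩ hε
  have hε : 0 < ε := hε
  refine ⟨γ₁ ∪ γ₂, ?_, ?_⟩
  · have := Finset.card_union_le γ₁ γ₂
    have : ((γ₁ ∪ γ₂).card : ℝ) ≤ γ₁.card + γ₂.card := by exact_mod_cast this
    rw [add_div]; linarith
  · rw [zV_add, add_mul, ENNReal.ofReal_add (by positivity) (by positivity)]
    exact add_le_add ((zV_anti hp Finset.subset_union_left).trans h12)
      ((zV_anti hp Finset.subset_union_right).trans h22)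

lemma zU_add (h1 : zU p b μ₁ a) (h2 : zU p b μ₂ c) (ha : 0 ≤ a) (hc : 0 ≤ c)
    (hp : 0 ≤ p) : zU p b (μ₁ + μ₂) (a + c) := by
  intro a' ha'
  have := zUat_add (h1 (a + (a' - (a + c)) / 2) (by linarith))
    (h2 (c + (a' - (a + c)) / 2) (by linarith)) (by linarith) (by linarith) hp
  convert this using 1
  ring

lemma zU_zero : zU p b (0 : Measure (EuclideanSpace ℝ (Fin d))) 0 := by
  intro a' ha'
  filter_upwards [self_mem_nhdsWithin] with ε hε
  have hε : 0 < ε := hε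
  have ha' : 0 < a' := ha'
  refine ⟨∅, by simp; positivity, by simp [zV]⟩

lemma zU_sum {ι : Type*} (s : Finset ι) (m : ι → Measure (EuclideanSpace ℝ (Fin d))) (x : ι → ℝ)
    (hx : ∀ i ∈ s, 0 ≤ x i) (hp : 0 ≤ p) (h : ∀ i ∈ s, zU p b (m i) (x i)) :
    zU p b (∑ i ∈ s, m i) (∑ i ∈ s, x i) := by
  classical
  induction s using Finset.induction_on with
  | empty => simpa using zU_zero
  | insert i s hi ih =>
    rw [Finset.sum_insert hi, Finset.sum_insert hi]
    exact zU_add (h i (by simp)) (ih (fun j hj => hx j (by simp [hj]))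
      (fun j hj => h j (by simp [hj]))) (hx i (by simp))
      (Finset.sum_nonneg (fun j hj => hx j (by simp [hj]))) hp

lemma zL_mono (h : μ₁ ≤ μ₂) (hL : zL p b μ₁ a) : zL p b μ₂ a := by
  intro a' ha'
  filter_upwards [hL a' ha'] with ε hε γ
  exact (hε γ).trans (by gcongr; exact zV_mono h)

lemma zL_of_nonneg (hb : 0 ≤ b) (h : ∀ a' < a, 0 ≤ a' →
    ∀ᶠ ε in 𝓝[>] (0:ℝ), ∀ γ : Finset (EuclideanSpace ℝ (Fin d)),
    ENNReal.ofReal ((1 + b) * a' * ε ^ b) ≤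
      zV p μ γ + ENNReal.ofReal (b * ε ^ (1 + b) * γ.card)) : zL p b μ a := by
  intro a' ha'
  by_cases ha0 : a' < 0
  · filter_upwards [self_mem_nhdsWithin] with ε hε γ
    have hε : 0 < ε := hε
    rw [ENNReal.ofReal_of_nonpos]
    · simp
    · have : 0 < ε ^ b := by positivity
      have : (1 + b) * a' ≤ 0 := by nlinarith
      nlinarith
  exact h a' ha' (not_lt.1 ha0)

lemma zL_sub (hp : 0 ≤ p) (hb : 0 ≤ b) (hL : zL p b (μ₁ + μ₂) a) (hU : zU p b μ₂ c)
    (hc : 0 ≤ c) : zL p b μ₁ (a - c) := by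
  classical
  refine zL_of_nonneg hb ?_
  intro a' ha' ha0
  set c' := c + (a - c - a') / 2 with hc'
  filter_upwards [hL (a' + c') (by rw [hc']; linarith), hU c' (by simp only [gt_iff_lt]; linarith), self_mem_nhdsWithin]
    with ε h1 ⟨γ₂, h2, h3⟩ hε γ
  have hε : 0 < ε := hε
  have hc'0 : 0 ≤ c' := by linarith
  have h4 := h1 (γ ∪ γ₂)
  have h5 : ((γ ∪ γ₂).card : ℝ) ≤ γ.card + c' / ε := by
    have : ((γ ∪ γ₂).card : ℝ) ≤ γ.card + γ₂.card := by exact_mod_cast Finset.card_union_le γ γ₂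
    linarith
  have h6 : zV p (μ₁ + μ₂) (γ ∪ γ₂) ≤ zV p μ₁ γ + ENNReal.ofReal (c' * ε ^ b) := by
    rw [zV_add]
    exact add_le_add (zV_anti hp Finset.subset_union_left)
      ((zV_anti hp Finset.subset_union_right).trans h3)
  have h7 : ENNReal.ofReal (b * ε ^ (1 + b) * (γ ∪ γ₂).card) ≤
      ENNReal.ofReal (b * ε ^ (1 + b) * γ.card) + ENNReal.ofReal (b * c' * ε ^ b) := by
    rw [← ENNReal.ofReal_add (by positivity) (by positivity)]
    apply ENNReal.ofReal_le_ofReal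
    calc b * ε ^ (1 + b) * (γ ∪ γ₂).card ≤ b * ε ^ (1 + b) * (γ.card + c' / ε) := by gcongr
      _ = _ := by
        rw [Real.rpow_add hε, Real.rpow_one]; field_simp
  have h8 : ENNReal.ofReal ((1 + b) * (a' + c') * ε ^ b) =
      ENNReal.ofReal ((1 + b) * a' * ε ^ b) + (ENNReal.ofReal (c' * ε ^ b)
        + ENNReal.ofReal (b * c' * ε ^ b)) := by
    rw [← ENNReal.ofReal_add (by positivity) (by positivity),
      ← ENNReal.ofReal_add (by positivity) (by positivity)]
    congr 1; ring
  rw [h8] at h4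
  have h9 := h4.trans (add_le_add h6 h7)
  have h10 : ENNReal.ofReal (c' * ε ^ b) + ENNReal.ofReal (b * c' * ε ^ b) ≠ ⊤ := by simp
  rw [← ENNReal.add_le_add_iff_right h10]
  refine h9.trans (le_of_eq ?_)
  ring

lemma zL_add (hp : 0 ≤ p) (hb : 0 ≤ b) (h1 : zL p b μ₁ a) (h2 : zL p b μ₂ c)
    {K₁ K₂ : Set (EuclideanSpace ℝ (Fin d))} (hK₁ : IsCompact K₁) (hK₂ : IsCompact K₂)
    (hm₁ : μ₁ K₁ᶜ = 0) (hm₂ : μ₂ K₂ᶜ = 0) (hd : Disjoint K₁ K₂) :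
    zL p b (μ₁ + μ₂) (a + c) := by
  classical
  obtain ⟨r, hr, hdis⟩ := hd.exists_thickenings hK₁ hK₂.isClosed
  obtain ⟨F, hF, hFf, hFc⟩ := (hK₁.union hK₂).finite_cover_balls hr
  set F' := hFf.toFinset with hF'
  have key : ∀ (K : Set (EuclideanSpace ℝ (Fin d))) (m : Measure (EuclideanSpace ℝ (Fin d))),
      m Kᶜ = 0 → K ⊆ K₁ ∪ K₂ → ∀ γ : Finset (EuclideanSpace ℝ (Fin d)), F' ⊆ γ →
      zV p m (γ.filter (fun y => y ∈ Metric.thickening r K)) ≤ zV p m γ := by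
    intro K m hm hK γ hγ
    apply lintegral_mono_ae
    have : ∀ᵐ z ∂m, z ∈ K := by rw [ae_iff]; exact hm
    filter_upwards [this] with z hz
    refine ENNReal.rpow_le_rpow ?_ hp
    obtain ⟨y0, hy0, hzy0⟩ : ∃ y0 ∈ F, dist z y0 < r := by
      have := hFc (hK hz)
      simpa using this
    have hy0γ : y0 ∈ γ := hγ (by simpa [hF'] using hy0)
    have hmem : ∀ y ∈ γ, dist z y < r → y ∈ γ.filter (fun y => y ∈ Metric.thickening r K) := by
      intro y hy hzy
      simp only [Finset.mem_filter, hy, true_and]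
      rw [Metric.mem_thickening_iff]
      exact ⟨z, hz, by rwa [dist_comm]⟩
    rw [Metric.le_infEDist]
    intro y hy
    by_cases h : dist z y < r
    · exact Metric.infEDist_le_edist_of_mem (hmem y hy h)
    · refine (Metric.infEDist_le_edist_of_mem (hmem y0 hy0γ hzy0)).trans ?_
      rw [edist_dist, edist_dist]
      apply ENNReal.ofReal_le_ofReal
      push Not at h
      linarith
  refine zL_of_nonneg hb ?_
  intro a' ha' ha0
  set η := (a + c - a') / 3 with hη
  have hη0 : 0 < η := by rw [hη]; linarith
  have hsmall : ∀ᶠ ε in 𝓝[>] (0:ℝ), ε * (b * F'.card) ≤ (1 + b) * η := by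
    have : Tendsto (fun ε : ℝ => ε * (b * F'.card)) (𝓝[>] 0) (𝓝 (0 * (b * F'.card))) :=
      (tendsto_nhdsWithin_of_tendsto_nhds tendsto_id).mul_const _
    rw [zero_mul] at this
    exact this.eventually_le_const (by positivity)
  filter_upwards [h1 (a - η) (by linarith), h2 (c - η) (by linarith), hsmall, self_mem_nhdsWithin]
    with ε e1 e2 e3 hε γ
  have hε : 0 < ε := hε
  set γ' := γ ∪ F'
  set γ₁ := γ'.filter (fun y => y ∈ Metric.thickening r K₁)
  set γ₂ := γ'.filter (fun y => y ∈ Metric.thickening r K₂)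
  have f1 := key K₁ μ₁ hm₁ Set.subset_union_left γ' Finset.subset_union_right
  have f2 := key K₂ μ₂ hm₂ Set.subset_union_right γ' Finset.subset_union_right
  have hcard : (γ₁.card : ℝ) + γ₂.card ≤ γ.card + F'.card := by
    have h1 : γ₁.card + γ₂.card ≤ γ'.card := by
      rw [← Finset.card_union_of_disjoint]
      · exact Finset.card_le_card (Finset.union_subset (Finset.filter_subset _ _)
          (Finset.filter_subset _ _))
      · rw [Finset.disjoint_filter]
        intro x _ hx1 hx2
        exact Set.disjoint_left.1 hdis hx1 hx2
    have h2 : γ'.card ≤ γ.card + F'.card := Finset.card_union_le _ _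
    exact_mod_cast h1.trans h2
  have hfin : ENNReal.ofReal ((1 + b) * η * ε ^ b) ≠ ⊤ := by simp
  rw [← ENNReal.add_le_add_iff_right hfin]
  have hpos : 0 < ε ^ b := by positivity
  calc ENNReal.ofReal ((1 + b) * a' * ε ^ b) + ENNReal.ofReal ((1 + b) * η * ε ^ b)
      ≤ ENNReal.ofReal ((1 + b) * (a - η) * ε ^ b) + ENNReal.ofReal ((1 + b) * (c - η) * ε ^ b) := by
        rw [← ENNReal.ofReal_add (by positivity) (by positivity)]
        refine le_trans (ENNReal.ofReal_le_ofReal (le_of_eq ?_)) ENNReal.ofReal_add_le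
        rw [hη]; ring
    _ ≤ (zV p μ₁ γ₁ + ENNReal.ofReal (b * ε ^ (1 + b) * γ₁.card)) +
        (zV p μ₂ γ₂ + ENNReal.ofReal (b * ε ^ (1 + b) * γ₂.card)) := add_le_add (e1 _) (e2 _)
    _ ≤ zV p (μ₁ + μ₂) γ' + ENNReal.ofReal (b * ε ^ (1 + b) * (γ₁.card + γ₂.card)) := by
        rw [zV_add, mul_add, ENNReal.ofReal_add (by positivity) (by positivity)]
        calc _ = (zV p μ₁ γ₁ + zV p μ₂ γ₂) + (ENNReal.ofReal (b * ε ^ (1 + b) * γ₁.card) + ENNReal.ofReal (b * ε ^ (1 + b) * γ₂.card)) := by ring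
          _ ≤ _ := by gcongr
    _ ≤ zV p (μ₁ + μ₂) γ + ENNReal.ofReal (b * ε ^ (1 + b) * γ.card + (1 + b) * η * ε ^ b) := by
        gcongr
        · exact zV_anti hp Finset.subset_union_left
        · have : b * ε ^ (1 + b) * (γ₁.card + γ₂.card) ≤ b * ε ^ (1 + b) * (γ.card + F'.card) := by
            gcongr
          refine this.trans ?_
          rw [mul_add, Real.rpow_add hε, Real.rpow_one]
          nlinarith
    _ = _ := by
        rw [ENNReal.ofReal_add (by positivity) (by positivity), add_assoc]

end basics
end

noncomputable section
open scoped ENNReal NNReal Topology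
section partTwo
variable {d : ℕ} {p b : ℝ} {μ μ₁ μ₂ : Measure (EuclideanSpace ℝ (Fin d))}
  {γ γ' : Finset (EuclideanSpace ℝ (Fin d))} {a c : ℝ}

lemma zL_sum {ι : Type*} (s : Finset ι) (m : ι → Measure (EuclideanSpace ℝ (Fin d))) (x : ι → ℝ)
    (K : ι → Set (EuclideanSpace ℝ (Fin d))) (hK : ∀ i ∈ s, IsCompact (K i))
    (hm : ∀ i ∈ s, m i (K i)ᶜ = 0) (hdis : (s : Set ι).PairwiseDisjoint K)
    (hp : 0 ≤ p) (hb : 0 ≤ b) (h : ∀ i ∈ s, zL p b (m i) (x i)) :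
    zL p b (∑ i ∈ s, m i) (∑ i ∈ s, x i) := by
  classical
  induction s using Finset.induction_on with
  | empty =>
    refine zL_of_nonneg hb ?_
    intro a' h1 h2
    simp only [Finset.sum_empty] at h1
    linarith
  | insert i s hi ih =>
    rw [Finset.sum_insert hi, Finset.sum_insert hi]
    refine zL_add (K₁ := K i) (K₂ := ⋃ j ∈ s, K j) hp hb (h i (by simp)) (ih (fun j hj => hK j (by simp [hj]))
      (fun j hj => hm j (by simp [hj])) (hdis.subset (by simp)) (fun j hj => h j (by simp [hj])))
      (hK i (by simp)) (s.isCompact_biUnion (fun j hj => hK j (by simp [hj])))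
      (hm i (by simp)) ?_ ?_
    · rw [Measure.finsetSum_apply]
      apply Finset.sum_eq_zero
      intro j hj
      refine measure_mono_null ?_ (hm j (by simp [hj]))
      exact Set.compl_subset_compl.2 (Set.subset_biUnion_of_mem (u := K) hj)
    · rw [Set.disjoint_iUnion₂_right]
      intro j hj
      exact hdis (by simp) (by simp [hj]) (by rintro rfl; exact hi hj)

lemma zTangent (hb : 0 ≤ b) {T ε n : ℝ} (hT : 0 ≤ T) (hε : 0 < ε) (hn : 0 < n) :
    (1 + b) * T * ε ^ b ≤ T ^ (1 + b) * n ^ (-b) + b * ε ^ (1 + b) * n := by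
  have h1b : 0 < 1 + b := by linarith
  have := Real.geom_mean_le_arith_mean2_weighted (w₁ := 1 / (1 + b)) (w₂ := b / (1 + b))
    (p₁ := T ^ (1 + b) * n ^ (-b)) (p₂ := ε ^ (1 + b) * n) (by positivity) (by positivity)
    (by positivity) (by positivity) (by field_simp)
  rw [Real.mul_rpow (by positivity) (by positivity), Real.mul_rpow (by positivity) (by positivity),
    ← Real.rpow_mul hT, ← Real.rpow_mul hn.le, ← Real.rpow_mul hε.le] at this
  have e1 : (1 + b) * (1 / (1 + b)) = 1 := by field_simp
  have e2 : (1 + b) * (b / (1 + b)) = b := by field_simp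
  have e3 : -b * (1 / (1 + b)) = -(b / (1 + b)) := by ring
  rw [e1, e2, e3, Real.rpow_one, Real.rpow_neg hn.le] at this
  have h5 : 0 < n ^ (b / (1 + b)) := by positivity
  have h6 : T * (n ^ (b / (1 + b)))⁻¹ * (ε ^ b * n ^ (b / (1 + b))) = T * ε ^ b := by
    field_simp
  rw [h6] at this
  have h7 := mul_le_mul_of_nonneg_left this h1b.le
  calc (1 + b) * T * ε ^ b = (1 + b) * (T * ε ^ b) := by ring
    _ ≤ _ := h7
    _ = _ := by field_simp

lemma zL_of_bound (hb : 0 ≤ b) {T : ℝ} (hT : 0 ≤ T) (h0 : zV p μ ∅ = ⊤)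
    (h : ∀ γ : Finset (EuclideanSpace ℝ (Fin d)), γ.Nonempty →
      ENNReal.ofReal (T ^ (1 + b) * (γ.card : ℝ) ^ (-b)) ≤ zV p μ γ) : zL p b μ T := by
  refine zL_of_nonneg hb ?_
  intro a' h1 h2
  filter_upwards [self_mem_nhdsWithin] with ε hε γ
  have hε : 0 < ε := hε
  rcases γ.eq_empty_or_nonempty with rfl | hγ
  · rw [h0]; simp
  · have hn : (0:ℝ) < γ.card := by exact_mod_cast hγ.card_pos
    calc ENNReal.ofReal ((1 + b) * a' * ε ^ b) ≤ ENNReal.ofReal ((1 + b) * T * ε ^ b) := by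
          apply ENNReal.ofReal_le_ofReal; gcongr
      _ ≤ ENNReal.ofReal (T ^ (1 + b) * (γ.card : ℝ) ^ (-b) + b * ε ^ (1 + b) * γ.card) :=
          ENNReal.ofReal_le_ofReal (zTangent hb hT hε hn)
      _ ≤ _ := by
          rw [ENNReal.ofReal_add (by positivity) (by positivity)]
          gcongr
          exact h γ hγ

lemma zUat_of_mesh (hd : 1 ≤ d) (hp : 0 < p) {A B : ℝ} (hA : 0 ≤ A) (hB : 0 < B)
    (h : ∀ᶠ s in 𝓝[>] (0:ℝ), ∃ γ : Finset (EuclideanSpace ℝ (Fin d)),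
      (γ.card : ℝ) * s ^ d ≤ B ∧ zV p μ γ ≤ ENNReal.ofReal (A * s ^ p))
    (ha : 0 < a) (hAB : B ^ (p / d) * A ≤ a ^ (1 + p / d)) : zUat p (p / d) μ a := by
  have hd0 : (0:ℝ) < d := by exact_mod_cast hd
  have ht : Tendsto (fun ε : ℝ => (B * ε / a) ^ (1 / (d:ℝ))) (𝓝[>] 0) (𝓝[>] 0) := by
    apply tendsto_nhdsWithin_iff.2
    constructor
    · have h1 : Tendsto (fun ε : ℝ => (B * ε / a) ^ (1 / (d:ℝ))) (𝓝 0)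
          (𝓝 ((B * 0 / a) ^ (1 / (d:ℝ)))) := by
        refine ((tendsto_id.const_mul B).div_const a).rpow_const ?_
        right; positivity
      rw [mul_zero, zero_div, Real.zero_rpow (by positivity)] at h1
      exact tendsto_nhdsWithin_of_tendsto_nhds h1
    · filter_upwards [self_mem_nhdsWithin] with ε hε
      have hε : 0 < ε := hε
      rw [Set.mem_Ioi]
      positivity
  filter_upwards [ht.eventually h, self_mem_nhdsWithin] with ε ⟨γ, h1, h2⟩ hε
  have hε : 0 < ε := hε
  refine ⟨γ, ?_, h2.trans (ENNReal.ofReal_le_ofReal ?_)⟩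
  · have : ((B * ε / a) ^ (1 / (d:ℝ))) ^ d = B * ε / a := by
      rw [← Real.rpow_natCast, ← Real.rpow_mul (by positivity)]
      rw [one_div_mul_cancel hd0.ne', Real.rpow_one]
    rw [this] at h1
    rw [le_div_iff₀ hε]
    have h3 : (γ.card : ℝ) * (B * ε / a) = (γ.card * ε) * B / a := by ring
    rw [h3, div_le_iff₀ ha] at h1
    exact le_of_mul_le_mul_right (by linarith) hB
  · have : ((B * ε / a) ^ (1 / (d:ℝ))) ^ p = B ^ (p / d) * ε ^ (p / d) / a ^ (p / d) := by
      rw [← Real.rpow_mul (by positivity), Real.div_rpow (by positivity) ha.le,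
        Real.mul_rpow hB.le hε.le]
      congr 1 <;> [congr 2; congr 1] <;> field_simp
    rw [this]
    rw [Real.rpow_add ha, Real.rpow_one] at hAB
    have h5 : 0 < a ^ (p / d) := by positivity
    calc A * (B ^ (p / d) * ε ^ (p / d) / a ^ (p / d))
        = (B ^ (p / d) * A) * ε ^ (p / d) / a ^ (p / d) := by ring
      _ ≤ (a * a ^ (p / d)) * ε ^ (p / d) / a ^ (p / d) := by gcongr
      _ = a * ε ^ (p / d) := by field_simp

lemma zqErr_eq (hp : 0 ≤ p) (hγ : γ.Nonempty) : qErr μ p ↑γ = (zV p μ γ).toReal := by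
  unfold qErr zV
  rw [integral_eq_lintegral_of_nonneg_ae]
  · congr 1
    apply lintegral_congr
    intro z
    rw [Metric.infDist, ENNReal.toReal_rpow, ENNReal.ofReal_toReal]
    exact ENNReal.rpow_ne_top_of_nonneg hp (Metric.infEDist_ne_top (by simpa using hγ))
  · exact ae_of_all _ (fun z => by have := Metric.infDist_nonneg (x := z) (s := (γ : Set (EuclideanSpace ℝ (Fin d)))); positivity)
  · have : Measurable (fun z => Metric.infDist z (γ : Set (EuclideanSpace ℝ (Fin d)))) :=
      measurable_infDist
    exact (this.pow_const p).aestronglyMeasurable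

lemma zoptQErr_le (hp : 0 ≤ p) (hγ : γ.Nonempty) {N : ℕ} (hN : γ.card ≤ N) :
    optQErr μ p N ≤ (zV p μ γ).toReal := by
  rw [← zqErr_eq hp hγ]
  apply csInf_le
  · refine ⟨0, ?_⟩
    rintro e ⟨γ, h1, h2, rfl⟩
    rw [zqErr_eq hp h1]
    exact ENNReal.toReal_nonneg
  · exact ⟨γ, hγ, hN, rfl⟩

lemma zle_optQErr (hp : 0 ≤ p) {N : ℕ} (hN : 1 ≤ N) {r : ℝ}
    (h : ∀ γ : Finset (EuclideanSpace ℝ (Fin d)), γ.Nonempty → γ.card ≤ N →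
      r ≤ (zV p μ γ).toReal) : r ≤ optQErr μ p N := by
  apply le_csInf
  · exact ⟨_, {0}, by simp, by simpa using hN, rfl⟩
  · rintro e ⟨γ, h1, h2, rfl⟩
    rw [zqErr_eq hp h1]
    exact h γ h1 h2

lemma zV_empty (hp : 0 < p) (hμ : μ ≠ 0) : zV p μ ∅ = ⊤ := by
  unfold zV
  simp [Metric.infEDist_empty, ENNReal.top_rpow_of_pos hp, ENNReal.top_mul, hμ]

lemma z_final (hp : 0 < p) (hb : 0 < b) (ha : 0 ≤ a) (hμ : μ ≠ 0)
    (hfin : ∀ γ : Finset (EuclideanSpace ℝ (Fin d)), γ.Nonempty → zV p μ γ ≠ ⊤)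
    (hU : zU p b μ a) (hL : zL p b μ a) :
    Tendsto (fun N : ℕ => (N : ℝ) ^ b * optQErr μ p N) atTop (𝓝 (a ^ (1 + b))) := by
  have hto : ∀ x : ℝ, 0 < x → Tendsto (fun N : ℕ => x / (N:ℝ)) atTop (𝓝[>] 0) := by
    intro x hx
    apply tendsto_nhdsWithin_iff.2
    refine ⟨tendsto_const_div_atTop_nhds_zero_nat x, ?_⟩
    filter_upwards [eventually_ge_atTop 1] with N hN
    have : (0:ℝ) < N := by exact_mod_cast hN
    rw [Set.mem_Ioi]
    positivity
  rw [tendsto_order]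
  constructor
  · intro c hc
    rcases ha.eq_or_lt with rfl | ha
    · rw [Real.zero_rpow (by positivity)] at hc
      filter_upwards [eventually_ge_atTop 1] with N hN
      refine hc.trans_le ?_
      have : 0 ≤ optQErr μ p N := zle_optQErr hp.le hN (fun _ _ _ => ENNReal.toReal_nonneg)
      positivity
    · set η := (a ^ (1 + b) - c) / (2 * (1 + b) * a ^ b) with hη
      have hab : 0 < a ^ b := by positivity
      have hη0 : 0 < η := by
        rw [hη]; apply div_pos (by linarith) (by positivity)
      filter_upwards [(hto a ha).eventually (hL (a - η) (by linarith)), eventually_ge_atTop 1]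
        with N h1 hN
      have hN0 : (0:ℝ) < N := by exact_mod_cast hN
      have key : (a ^ (1 + b) + c) / 2 / (N:ℝ) ^ b ≤ optQErr μ p N := by
        apply zle_optQErr hp.le hN
        intro γ hγ hcard
        have h2 := h1 γ
        rw [← ENNReal.ofReal_toReal (hfin γ hγ), ← ENNReal.ofReal_add ENNReal.toReal_nonneg (by positivity)] at h2
        rw [ENNReal.ofReal_le_ofReal_iff (add_nonneg ENNReal.toReal_nonneg (by positivity))] at h2
        have hc' : (γ.card : ℝ) ≤ N := by exact_mod_cast hcard
        have h3 : b * (a / N) ^ (1 + b) * γ.card ≤ b * a * (a / N) ^ b := by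
          calc b * (a / N) ^ (1 + b) * γ.card ≤ b * (a / N) ^ (1 + b) * N := by gcongr
            _ = _ := by rw [Real.rpow_add (by positivity), Real.rpow_one]; field_simp
        have h4 : ((1 + b) * (a - η) - b * a) * (a / N) ^ b ≤ (zV p μ γ).toReal := by
          linarith
        refine le_trans (le_of_eq ?_) h4
        rw [Real.div_rpow ha.le hN0.le]
        have : ((1 + b) * (a - η) - b * a) * a ^ b = (a ^ (1 + b) + c) / 2 := by
          rw [hη, Real.rpow_add ha, Real.rpow_one]; field_simp; ring
        rw [← this]; ring
      have hNb : 0 < (N:ℝ) ^ b := by positivity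
      rw [div_le_iff₀ hNb] at key
      linarith
  · intro c hc
    obtain ⟨a', ha', hac⟩ : ∃ a' > a, a' ^ (1 + b) < c := by
      have h1 : Tendsto (fun x : ℝ => x ^ (1 + b)) (𝓝[>] a) (𝓝 (a ^ (1 + b))) := by
        refine tendsto_nhdsWithin_of_tendsto_nhds ?_
        exact (tendsto_id).rpow_const (Or.inr (by positivity))
      obtain ⟨x, hx1, hx2⟩ := ((h1.eventually_lt_const hc).and self_mem_nhdsWithin).exists
      exact ⟨x, hx2, hx1⟩
    have ha'0 : 0 < a' := lt_of_le_of_lt ha ha'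
    filter_upwards [(hto a' ha'0).eventually (hU a' ha'), eventually_ge_atTop 1]
        with N ⟨γ, h1, h2⟩ hN
    have hN0 : (0:ℝ) < N := by exact_mod_cast hN
    have hγ : γ.Nonempty := by
      by_contra h
      rw [Finset.not_nonempty_iff_eq_empty] at h
      rw [h, zV_empty hp hμ] at h2
      simp at h2
    rw [div_div_cancel₀ ha'0.ne'] at h1
    have h3 := zoptQErr_le (μ := μ) hp.le hγ (N := N) (by exact_mod_cast h1)
    have h4 : (zV p μ γ).toReal ≤ a' * (a' / N) ^ b :=
      ENNReal.toReal_le_of_le_ofReal (by positivity) h2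
    refine lt_of_le_of_lt ?_ hac
    have hNb : 0 < (N:ℝ) ^ b := by positivity
    calc (N : ℝ) ^ b * optQErr μ p N ≤ (N:ℝ) ^ b * (a' * (a' / N) ^ b) := by
          gcongr; exact h3.trans h4
      _ = a' ^ (1 + b) := by
        rw [Real.div_rpow ha'0.le hN0.le, Real.rpow_add ha'0, Real.rpow_one]; field_simp

end partTwo
end

noncomputable section
open scoped ENNReal NNReal Topology
section partThree
variable {d : ℕ} {p b : ℝ} {μ μ₁ μ₂ : Measure (EuclideanSpace ℝ (Fin d))}
  {γ γ' : Finset (EuclideanSpace ℝ (Fin d))} {a c : ℝ}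

def zfl (s : ℝ) (x : EuclideanSpace ℝ (Fin d)) : Fin d → ℤ := fun i => ⌊x i / s⌋

def zcor (s : ℝ) (k : Fin d → ℤ) : EuclideanSpace ℝ (Fin d) := WithLp.toLp 2 (fun i => s * k i)

def zQ (d : ℕ) : Set (EuclideanSpace ℝ (Fin d)) := {u | ∀ i, u i ∈ Set.Icc (0:ℝ) 1}

lemma zfl_cor {s : ℝ} (hs : 0 < s) (k : Fin d → ℤ) : zfl s (zcor s k) = k := by
  ext i
  simp [zfl, zcor, mul_div_cancel_left₀ _ hs.ne']

lemma zfl_iff {s : ℝ} (hs : 0 < s) (k : Fin d → ℤ) (x : EuclideanSpace ℝ (Fin d)) :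
    zfl s x = k ↔ ∀ i, x i ∈ Set.Ico (s * k i) (s * k i + s) := by
  rw [funext_iff]
  refine forall_congr' fun i => ?_
  simp only [zfl, Int.floor_eq_iff, Set.mem_Ico, le_div_iff₀ hs, div_lt_iff₀ hs]
  constructor <;> rintro ⟨h1, h2⟩ <;> constructor <;> linarith

lemma zfl_dist {s : ℝ} (hs : 0 < s) {x y : EuclideanSpace ℝ (Fin d)} (h : zfl s x = zfl s y) :
    dist x y ≤ d * s := by
  rw [EuclideanSpace.dist_eq]
  apply Real.sqrt_le_iff.2
  refine ⟨by positivity, ?_⟩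
  have h1 := (zfl_iff hs _ x).1 h
  have h2 := (zfl_iff hs _ y).1 rfl
  calc ∑ i, dist (x i) (y i) ^ 2 ≤ ∑ i : Fin d, s ^ 2 := by
        apply Finset.sum_le_sum
        intro i _
        rw [Real.dist_eq, sq_abs]
        obtain ⟨a1, a2⟩ := h1 i
        obtain ⟨b1, b2⟩ := h2 i
        apply sq_le_sq'  <;> linarith
    _ = d * s ^ 2 := by simp
    _ ≤ (d * s) ^ 2 := by
        rw [mul_pow]
        gcongr
        rcases Nat.eq_zero_or_pos d with h0 | h0
        · simp [h0]
        · have : (1:ℝ) ≤ d := by exact_mod_cast h0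
          nlinarith

lemma zvol_box (l u : Fin d → ℝ) :
    volume {x : EuclideanSpace ℝ (Fin d) | ∀ i, x i ∈ Set.Ico (l i) (u i)} =
      ∏ i, ENNReal.ofReal (u i - l i) := by
  have h := (PiLp.volume_preserving_ofLp (Fin d)).measure_preimage
    (s := Set.univ.pi fun i => Set.Ico (l i) (u i)) (MeasurableSet.univ_pi (fun i => measurableSet_Ico)).nullMeasurableSet
  rw [Real.volume_pi_Ico] at h
  rw [← h]
  congr 1
  ext x
  simp

lemma zmeas_box (l u : Fin d → ℝ) :
    MeasurableSet {x : EuclideanSpace ℝ (Fin d) | ∀ i, x i ∈ Set.Ico (l i) (u i)} := by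
  rw [Set.ofPred_forall]
  exact MeasurableSet.iInter fun i => (by fun_prop : Measurable fun x : EuclideanSpace ℝ (Fin d) => x i) measurableSet_Ico

lemma zQ_closed : IsClosed (zQ d) := by
  unfold zQ
  rw [Set.ofPred_forall]
  exact isClosed_iInter fun i => isClosed_Icc.preimage (by fun_prop)

lemma zQ_vol : volume (zQ d) = 1 := by
  have h := (PiLp.volume_preserving_ofLp (Fin d)).measure_preimage
    (s := Set.univ.pi fun i => Set.Icc (0:ℝ) 1) (MeasurableSet.univ_pi (fun i => measurableSet_Icc)).nullMeasurableSet
  rw [volume_pi_pi] at h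
  simp only [Real.volume_Icc, sub_zero, ENNReal.ofReal_one, Finset.prod_const_one] at h
  rw [← h]
  congr 1
  ext x
  simp [zQ, -Set.pi_univ_Icc]

lemma zcell_vol {s : ℝ} (hs : 0 < s) (k : Fin d → ℤ) :
    volume {x : EuclideanSpace ℝ (Fin d) | zfl s x = k} = ENNReal.ofReal (s ^ d) := by
  simp only [zfl_iff hs]
  rw [zvol_box]
  simp [ENNReal.ofReal_pow hs.le]

lemma zcell_meas {s : ℝ} (hs : 0 < s) (k : Fin d → ℤ) :
    MeasurableSet {x : EuclideanSpace ℝ (Fin d) | zfl s x = k} := by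
  simp only [zfl_iff hs]
  exact zmeas_box _ _

lemma zcover {K : Set (EuclideanSpace ℝ (Fin d))} (hK : IsCompact K) {w : ℝ}
    (hw : volume K < ENNReal.ofReal w) :
    ∀ᶠ s in 𝓝[>] (0:ℝ), ∃ T : Finset (Fin d → ℤ), (T.card : ℝ) * s ^ d ≤ w ∧
      ∀ x ∈ K, zfl s x ∈ T := by
  have hw0 : 0 < w := by
    by_contra h
    rw [ENNReal.ofReal_of_nonpos (by linarith)] at hw
    simp at hw
  have h1 : Tendsto (fun s : ℝ => volume (Metric.cthickening (d * s) K)) (𝓝[>] 0) (𝓝 (volume K)) := by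
    refine (tendsto_measure_cthickening_of_isCompact hK).comp ?_
    have : Tendsto (fun s : ℝ => d * s) (𝓝 0) (𝓝 (d * 0)) := tendsto_id.const_mul _
    rw [mul_zero] at this
    exact tendsto_nhdsWithin_of_tendsto_nhds this
  filter_upwards [h1.eventually_lt_const hw, self_mem_nhdsWithin] with s hs1 hs
  have hs : 0 < s := hs
  have hbound : ∀ T : Finset (Fin d → ℤ), (T : Set (Fin d → ℤ)) ⊆ zfl s '' K → (T.card : ℝ) * s ^ d ≤ w := by
    intro T hT
    have h2 : ∑ k ∈ T, volume {x : EuclideanSpace ℝ (Fin d) | zfl s x = k} =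
        volume (⋃ k ∈ T, {x : EuclideanSpace ℝ (Fin d) | zfl s x = k}) := by
      rw [measure_biUnion_finset]
      · intro k _ l _ hkl
        refine Set.disjoint_left.2 ?_
        intro x hx hx'
        exact hkl (hx.symm.trans hx')
      · intro k _
        exact zcell_meas hs k
    have h3 : (⋃ k ∈ T, {x : EuclideanSpace ℝ (Fin d) | zfl s x = k}) ⊆ Metric.cthickening (d * s) K := by
      intro x hx
      simp only [Set.mem_iUnion, Set.mem_ofPred_eq, exists_prop] at hx
      obtain ⟨k, hk, rfl⟩ := hx
      obtain ⟨y, hy, hyx⟩ := hT hk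
      exact Metric.mem_cthickening_of_dist_le x y _ K hy (zfl_dist hs hyx.symm)
    have h4 := (h2.le.trans (measure_mono h3)).trans hs1.le
    simp only [zcell_vol hs, Finset.sum_const, nsmul_eq_mul] at h4
    rw [← ENNReal.ofReal_natCast, ← ENNReal.ofReal_mul (by positivity)] at h4
    exact (ENNReal.ofReal_le_ofReal_iff hw0.le).1 h4
  have hfin : (zfl s '' K).Finite := by
    by_contra h
    have h : (zfl s '' K).Infinite := h
    obtain ⟨T, hT, hTc⟩ := h.exists_subset_card_eq (⌊w / s ^ d⌋₊ + 1)
    have h5 := hbound T hT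
    rw [hTc, ← le_div_iff₀ (by positivity)] at h5
    have := Nat.lt_floor_add_one (w / s ^ d)
    push_cast at h5
    linarith
  refine ⟨hfin.toFinset, hbound _ (by simp), ?_⟩
  intro x hx
  simp only [Set.Finite.mem_toFinset]
  exact ⟨x, hx, rfl⟩

def zA (t : EuclideanSpace ℝ (Fin d)) (s : ℝ) : Set (EuclideanSpace ℝ (Fin d)) :=
  {x | ∀ i, x i ∈ Set.Icc (t i) (t i + s)}

lemma zA_pre (t : EuclideanSpace ℝ (Fin d)) {s : ℝ} (hs : 0 < s) :
    (fun u => t + s • u) ⁻¹' (zA t s) = zQ d := by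
  ext u
  simp only [zA, zQ, Set.mem_preimage, Set.mem_ofPred_eq]
  refine forall_congr' fun i => ?_
  simp only [PiLp.add_apply, PiLp.smul_apply, smul_eq_mul, Set.mem_Icc]
  constructor
  · rintro ⟨h1, h2⟩
    constructor <;> nlinarith
  · rintro ⟨h1, h2⟩
    constructor <;> nlinarith

lemma zA_closed (t : EuclideanSpace ℝ (Fin d)) (s : ℝ) : IsClosed (zA t s) := by
  unfold zA
  rw [Set.ofPred_forall]
  exact isClosed_iInter fun i => isClosed_Icc.preimage (by fun_prop)

lemma zaff (t : EuclideanSpace ℝ (Fin d)) {s : ℝ} (hs : 0 < s)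
    {h : EuclideanSpace ℝ (Fin d) → ℝ≥0∞} (hh : Measurable h) :
    ∫⁻ x in zA t s, h x = ENNReal.ofReal (s ^ d) * ∫⁻ u in zQ d, h (t + s • u) := by
  have hφ : Measurable (fun u : EuclideanSpace ℝ (Fin d) => t + s • u) := by fun_prop
  have h1 : Measure.map (fun u : EuclideanSpace ℝ (Fin d) => t + s • u) volume =
      ENNReal.ofReal (s ^ d)⁻¹ • volume := by
    have : (fun u : EuclideanSpace ℝ (Fin d) => t + s • u) = (fun u => t + u) ∘ (fun u => s • u) := rfl
    rw [this, ← Measure.map_map (by fun_prop) (by fun_prop), Measure.map_addHaar_smul _ hs.ne',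
      Measure.map_smul, map_add_left_eq_self]
    simp [abs_of_pos hs]
  rw [← zA_pre t hs, ← setLIntegral_map (zA_closed t s).measurableSet hh hφ, h1,
    Measure.restrict_smul, lintegral_smul_measure, smul_eq_mul, ← mul_assoc,
    ← ENNReal.ofReal_mul (by positivity), mul_inv_cancel₀ (by positivity)]
  simp

lemma zA_vol (t : EuclideanSpace ℝ (Fin d)) {s : ℝ} (hs : 0 < s) :
    volume (zA t s) = ENNReal.ofReal (s ^ d) := by
  have := zaff t hs (h := fun _ => 1) measurable_const
  simpa [zQ_vol] using this

lemma zinf_aff [DecidableEq (EuclideanSpace ℝ (Fin d))] (t u : EuclideanSpace ℝ (Fin d)) {s : ℝ} (hs : 0 < s)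
    (γ : Finset (EuclideanSpace ℝ (Fin d))) :
    Metric.infEDist (t + s • u) (γ.image (fun y => t + s • y) : Finset _) =
      ENNReal.ofReal s * Metric.infEDist u γ := by
  have he : ∀ y, edist (t + s • u) (t + s • y) = ENNReal.ofReal s * edist u y := by
    intro y
    rw [edist_add_left, edist_smul₀, ENNReal.smul_def, smul_eq_mul]
    congr 1
    rw [ENNReal.ofReal, Real.nnnorm_of_nonneg hs.le, Real.toNNReal_of_nonneg hs.le]
  apply le_antisymm
  · have h0 : ENNReal.ofReal s ≠ 0 := by simpa using hs
    rw [mul_comm, ← ENNReal.div_le_iff_le_mul (Or.inl h0) (Or.inl (by simp)), Metric.le_infEDist]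
    intro y hy
    rw [ENNReal.div_le_iff_le_mul (Or.inl h0) (Or.inl (by simp)), mul_comm, ← he]
    exact Metric.infEDist_le_edist_of_mem (by simpa using ⟨y, hy, rfl⟩)
  · rw [Metric.le_infEDist]
    intro z hz
    simp only [Finset.coe_image, Set.mem_image] at hz
    obtain ⟨y, hy, rfl⟩ := hz
    rw [he]
    gcongr
    exact Metric.infEDist_le_edist_of_mem hy

lemma zV_aff [DecidableEq (EuclideanSpace ℝ (Fin d))] (hp : 0 ≤ p) (t : EuclideanSpace ℝ (Fin d)) {s : ℝ} (hs : 0 < s)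
    (γ : Finset (EuclideanSpace ℝ (Fin d))) :
    zV p (volume.restrict (zA t s)) (γ.image (fun y => t + s • y)) =
      ENNReal.ofReal (s ^ d) * ENNReal.ofReal (s ^ p) * zV p (unifCube d) γ := by
  unfold zV
  rw [zaff t hs (zV_meas p _)]
  simp only [zinf_aff t _ hs, ENNReal.mul_rpow_of_nonneg _ _ hp]
  rw [lintegral_const_mul _ (zV_meas p _), ENNReal.ofReal_rpow_of_pos hs, mul_assoc]
  rfl

end partThree
end

noncomputable section
open scoped ENNReal NNReal Topology
section partFour
variable {d : ℕ} {p b : ℝ} {μ μ₁ μ₂ : Measure (EuclideanSpace ℝ (Fin d))}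
  {γ γ' : Finset (EuclideanSpace ℝ (Fin d))} {a c : ℝ}

lemma zfl_mem {s : ℝ} (hs : 0 < s) (x : EuclideanSpace ℝ (Fin d)) : x ∈ zA (zcor s (zfl s x)) s := by
  intro i
  have := (zfl_iff hs _ x).1 rfl i
  exact ⟨this.1, this.2.le⟩

lemma zpattern (hp : 0 ≤ p) {K : Set (EuclideanSpace ℝ (Fin d))} (hK : IsCompact K) {w : ℝ}
    (hw : volume K < ENNReal.ofReal w) (v : ℝ≥0) (γ₀ : Finset (EuclideanSpace ℝ (Fin d))) :
    ∀ᶠ s in 𝓝[>] (0:ℝ), ∃ γ : Finset (EuclideanSpace ℝ (Fin d)),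
      (γ.card : ℝ) * s ^ d ≤ γ₀.card * w ∧
      zV p ((v : ℝ≥0∞) • volume.restrict K) γ ≤
        v * (ENNReal.ofReal w * ENNReal.ofReal (s ^ p) * zV p (unifCube d) γ₀) := by
  classical
  filter_upwards [zcover hK hw, self_mem_nhdsWithin] with s ⟨T, hT1, hT2⟩ hs
  have hs : 0 < s := hs
  refine ⟨T.biUnion (fun k => γ₀.image (fun y => zcor s k + s • y)), ?_, ?_⟩
  · have h1 : (T.biUnion (fun k => γ₀.image (fun y => zcor s k + s • y))).card ≤ T.card * γ₀.card :=
      Finset.card_biUnion_le_card_mul _ _ _ (fun k _ => Finset.card_image_le)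
    have h2 : ((T.biUnion (fun k => γ₀.image (fun y => zcor s k + s • y))).card : ℝ) ≤ T.card * γ₀.card := by
      exact_mod_cast h1
    calc _ ≤ (T.card * γ₀.card : ℝ) * s ^ d := by gcongr
      _ = γ₀.card * (T.card * s ^ d) := by ring
      _ ≤ _ := by gcongr
  · set γ := T.biUnion (fun k => γ₀.image (fun y => zcor s k + s • y)) with hγ
    have hsub : K ⊆ ⋃ k : T, zA (zcor s (k : Fin d → ℤ)) s := by
      intro x hx
      rw [Set.mem_iUnion]
      exact ⟨⟨_, hT2 x hx⟩, zfl_mem hs x⟩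
    have h1 : zV p (volume.restrict K) γ ≤ ∑ k ∈ T, zV p (volume.restrict (zA (zcor s k) s)) γ := by
      calc zV p (volume.restrict K) γ ≤ zV p (volume.restrict (⋃ k : T, zA (zcor s (k : Fin d → ℤ)) s)) γ :=
            zV_mono (Measure.restrict_mono hsub le_rfl)
        _ ≤ ∑' k : T, zV p (volume.restrict (zA (zcor s (k : Fin d → ℤ)) s)) γ := lintegral_iUnion_le _ _
        _ = _ := by
          rw [tsum_fintype]
          exact Finset.sum_coe_sort T (fun k => zV p (volume.restrict (zA (zcor s k) s)) γ)
    have h2 : ∀ k ∈ T, zV p (volume.restrict (zA (zcor s k) s)) γ ≤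
        ENNReal.ofReal (s ^ d) * ENNReal.ofReal (s ^ p) * zV p (unifCube d) γ₀ := by
      intro k hk
      rw [← zV_aff hp (zcor s k) hs]
      exact zV_anti hp (Finset.subset_biUnion_of_mem (fun k => γ₀.image (fun y => zcor s k + s • y)) hk)
    have h3 : zV p ((v : ℝ≥0∞) • volume.restrict K) γ = v * zV p (volume.restrict K) γ :=
      lintegral_smul_measure _ _
    rw [h3]
    gcongr
    refine (h1.trans (Finset.sum_le_sum h2)).trans ?_
    rw [Finset.sum_const, nsmul_eq_mul, ← mul_assoc, ← mul_assoc]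
    gcongr
    rw [← ENNReal.ofReal_natCast, ← ENNReal.ofReal_mul (by positivity)]
    exact ENNReal.ofReal_le_ofReal hT1

lemma zcrude (hp : 0 ≤ p) {K : Set (EuclideanSpace ℝ (Fin d))} (hK : IsCompact K) {w : ℝ}
    (hw : volume K < ENNReal.ofReal w) :
    ∀ᶠ s in 𝓝[>] (0:ℝ), ∃ γ : Finset (EuclideanSpace ℝ (Fin d)),
      (γ.card : ℝ) * s ^ d ≤ w ∧ ∀ x ∈ K, Metric.infEDist x γ ≤ ENNReal.ofReal (d * s) := by
  classical
  filter_upwards [zcover hK hw, self_mem_nhdsWithin] with s ⟨T, hT1, hT2⟩ hs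
  have hs : 0 < s := hs
  refine ⟨T.image (zcor s), ?_, ?_⟩
  · refine le_trans ?_ hT1
    gcongr
    exact Finset.card_image_le
  · intro x hx
    refine (Metric.infEDist_le_edist_of_mem (y := zcor s (zfl s x)) ?_).trans ?_
    · simp only [Finset.coe_image]
      exact ⟨_, hT2 x hx, rfl⟩
    · rw [edist_dist]
      exact ENNReal.ofReal_le_ofReal (zfl_dist hs (zfl_cor hs _).symm)

/-- singular part on a null compact set -/
lemma zU_null (hd : 1 ≤ d) (hp : 0 < p) [IsFiniteMeasure μ] {K : Set (EuclideanSpace ℝ (Fin d))}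
    (hK : IsCompact K) (h0 : volume K = 0) (hμ : μ Kᶜ = 0) : zU p (p / d) μ 0 := by
  intro a' ha'
  have ha' : 0 < a' := ha'
  have hd0 : (0:ℝ) < d := by exact_mod_cast hd
  have hb : 0 < p / d := by positivity
  set A : ℝ := (d:ℝ) ^ p * (μ Set.univ).toReal with hA
  have hA0 : 0 ≤ A := by positivity
  obtain ⟨w, hw0, hw⟩ : ∃ w : ℝ, 0 < w ∧ w ^ (p / d) * A ≤ a' ^ (1 + p / d) := by
    have h1 : Tendsto (fun x : ℝ => x ^ (p / d) * A) (𝓝[>] 0) (𝓝 ((0:ℝ) ^ (p / d) * A)) := by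
      refine tendsto_nhdsWithin_of_tendsto_nhds ?_
      exact ((tendsto_id).rpow_const (Or.inr (by positivity))).mul_const _
    rw [Real.zero_rpow hb.ne', zero_mul] at h1
    obtain ⟨x, hx1, hx2⟩ := ((h1.eventually_le_const (u := a' ^ (1 + p / d)) (by positivity)).and self_mem_nhdsWithin).exists
    exact ⟨x, hx2, hx1⟩
  refine zUat_of_mesh hd hp hA0 hw0 ?_ ha' hw
  filter_upwards [zcrude hp.le hK (w := w) (by rw [h0]; simpa using hw0), self_mem_nhdsWithin]
    with s ⟨γ, h1, h2⟩ hs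
  have hs : 0 < s := hs
  refine ⟨γ, h1, ?_⟩
  have : ∀ᵐ z ∂μ, z ∈ K := by rw [ae_iff]; exact hμ
  calc zV p μ γ ≤ ∫⁻ z, ENNReal.ofReal ((d * s) ^ p) ∂μ := by
        apply lintegral_mono_ae
        filter_upwards [this] with z hz
        rw [← ENNReal.ofReal_rpow_of_pos (by positivity)]
        exact ENNReal.rpow_le_rpow (h2 z hz) hp.le
    _ = ENNReal.ofReal (A * s ^ p) := by
        rw [lintegral_const, ← ENNReal.ofReal_toReal (measure_ne_top μ Set.univ),
          ← ENNReal.ofReal_mul (by positivity), Real.mul_rpow hd0.le hs.le, hA]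
        congr 1; ring

/-- uniform covering of a ball -/
lemma zball (hd : 1 ≤ d) : ∃ C : ℝ, 0 < C ∧ ∀ s : ℝ, 0 < s → s ≤ 1 →
    ∃ γ : Finset (EuclideanSpace ℝ (Fin d)), (γ.card : ℝ) * s ^ d ≤ C ∧
      ∀ x : EuclideanSpace ℝ (Fin d), ‖x‖ ≤ 2 → Metric.infEDist x γ ≤ ENNReal.ofReal s := by
  have hd0 : (0:ℝ) < d := by exact_mod_cast hd
  have hK : IsCompact (Metric.closedBall (0 : EuclideanSpace ℝ (Fin d)) 2) := isCompact_closedBall _ _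
  set w := (volume (Metric.closedBall (0 : EuclideanSpace ℝ (Fin d)) 2)).toReal + 1 with hw
  have hw0 : 0 < w := by positivity
  have h1 : volume (Metric.closedBall (0 : EuclideanSpace ℝ (Fin d)) 2) < ENNReal.ofReal w := by
    rw [ENNReal.lt_ofReal_iff_toReal_lt hK.measure_lt_top.ne]
    linarith
  have h2 := zcrude (p := 1) zero_le_one hK h1
  rw [eventually_nhdsWithin_iff, Metric.eventually_nhds_iff] at h2
  obtain ⟨r, hr, h2⟩ := h2
  have h3 : ∀ s : ℝ, 0 < s → s < r → _ := fun s hs hsr => h2 (y := s) (by simpa [abs_of_pos hs] using hsr) hs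
  set s1 := min (r / 2) 1 with hs1
  have hs10 : 0 < s1 := by positivity
  have hs1r : s1 < r := lt_of_le_of_lt (min_le_left _ _) (by linarith)
  refine ⟨w * (d ^ d) / s1 ^ d, by positivity, ?_⟩
  intro s hs hs'
  -- use mesh `min s s1 / d`... simply `s * s1 / d`
  have hm0 : 0 < s * s1 / d := by positivity
  have hd1 : (1:ℝ) ≤ d := by exact_mod_cast hd
  have hms : s * s1 / d ≤ s1 := by
    rw [div_le_iff₀ hd0]
    nlinarith
  obtain ⟨γ, h4, h5⟩ := h3 (s * s1 / d) hm0 (by linarith)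
  refine ⟨γ, ?_, ?_⟩
  · rw [le_div_iff₀ (by positivity)]
    have : (s * s1 / d) ^ d = s ^ d * s1 ^ d / d ^ d := by rw [div_pow, mul_pow]
    rw [this] at h4
    rw [← mul_div_assoc, div_le_iff₀ (by positivity)] at h4
    linarith
  · intro x hx
    refine (h5 x (by simpa using hx)).trans (ENNReal.ofReal_le_ofReal ?_)
    have : (d:ℝ) * (s * s1 / d) = s * s1 := by field_simp
    rw [this]
    have : s1 ≤ 1 := min_le_right _ _
    nlinarith

/-- Pierce-type covering -/
lemma zpierce (hd : 1 ≤ d) {κ : ℝ} (hκ : 1 < κ) : ∃ C : ℝ, 0 < C ∧ ∀ s : ℝ, 0 < s → s ≤ 1 →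
    ∃ γ : Finset (EuclideanSpace ℝ (Fin d)), (γ.card : ℝ) * s ^ d ≤ C ∧
      ∀ x : EuclideanSpace ℝ (Fin d), Metric.infEDist x γ ≤ ENNReal.ofReal (s * (max 1 ‖x‖) ^ κ) := by
  classical
  obtain ⟨C₀, hC₀, hball⟩ := zball hd
  set q : ℝ := 2 ^ (κ - 1) with hq
  have hq1 : 1 < q := by
    rw [hq]; apply Real.one_lt_rpow (by norm_num) (by linarith)
  have hqd : 1 < q ^ d := one_lt_pow₀ hq1 (by omega)
  set C : ℝ := max (q ^ d) (C₀ / (1 - (q ^ d)⁻¹)) with hC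
  have hinv : (q ^ d)⁻¹ < 1 := inv_lt_one_of_one_lt₀ hqd
  have hCC : C₀ + C * (q ^ d)⁻¹ ≤ C := by
    have : C₀ / (1 - (q ^ d)⁻¹) ≤ C := le_max_right _ _
    rw [div_le_iff₀ (by linarith)] at this
    linarith
  have hCpos : 0 < C := lt_of_lt_of_le (by positivity) (le_max_left _ _)
  have main : ∀ n : ℕ, ∀ s : ℝ, 0 < s → s ≤ q → 1 ≤ s * q ^ n →
    ∃ γ : Finset (EuclideanSpace ℝ (Fin d)), (γ.card : ℝ) * s ^ d ≤ C ∧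
      ∀ x : EuclideanSpace ℝ (Fin d), Metric.infEDist x γ ≤ ENNReal.ofReal (s * (max 1 ‖x‖) ^ κ) := by
    have base : ∀ s : ℝ, 1 ≤ s → s ≤ q → 
        ∃ γ : Finset (EuclideanSpace ℝ (Fin d)), (γ.card : ℝ) * s ^ d ≤ C ∧
      ∀ x : EuclideanSpace ℝ (Fin d), Metric.infEDist x γ ≤ ENNReal.ofReal (s * (max 1 ‖x‖) ^ κ) := by
      intro s hs hsq
      refine ⟨{0}, ?_, ?_⟩
      · simp only [Finset.card_singleton, Nat.cast_one, one_mul]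
        refine le_trans ?_ (le_max_left _ _)
        gcongr
      · intro x
        refine (Metric.infEDist_le_edist_of_mem (y := 0) (by simp)).trans ?_
        rw [edist_dist, dist_zero_right]
        apply ENNReal.ofReal_le_ofReal
        have h1 : max 1 ‖x‖ ≤ (max 1 ‖x‖) ^ κ := Real.self_le_rpow_of_one_le (le_max_left _ _) hκ.le
        have h2 : ‖x‖ ≤ max 1 ‖x‖ := le_max_right _ _
        have h3 : 0 ≤ (max 1 ‖x‖) ^ κ := by positivity
        nlinarith
    intro n
    induction n with
    | zero =>
      intro s h1 h2 h3
      exact base s (by simpa using h3) h2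
    | succ n ih =>
      intro s h1 h2 h3
      by_cases hs1 : 1 ≤ s
      · exact base s hs1 h2
      push Not at hs1
      obtain ⟨γ₁, h4, h5⟩ := ih (s * q) (by positivity) (by nlinarith) (by rw [pow_succ] at h3; linarith)
      obtain ⟨γ₂, h6, h7⟩ := hball s h1 hs1.le
      refine ⟨γ₂ ∪ γ₁.image (fun y => (0 : EuclideanSpace ℝ (Fin d)) + (2:ℝ) • y), ?_, ?_⟩
      · have h8 : ((γ₂ ∪ γ₁.image (fun y => (0 : EuclideanSpace ℝ (Fin d)) + (2:ℝ) • y)).card : ℝ) ≤ γ₂.card + γ₁.card := by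
          exact_mod_cast (Finset.card_union_le _ _).trans (add_le_add le_rfl Finset.card_image_le)
        refine le_trans ?_ hCC
        calc _ ≤ ((γ₂.card : ℝ) + γ₁.card) * s ^ d := by gcongr
          _ = γ₂.card * s ^ d + (γ₁.card * (s * q) ^ d) * (q ^ d)⁻¹ := by
            rw [mul_pow]; field_simp
          _ ≤ _ := by gcongr
      · intro x
        by_cases hx : ‖x‖ ≤ 2
        · refine (Metric.infEDist_anti (by simp)).trans ((h7 x hx).trans (ENNReal.ofReal_le_ofReal ?_))
          have : 1 ≤ (max 1 ‖x‖) ^ κ := Real.one_le_rpow (le_max_left _ _) (by linarith)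
          nlinarith
        · push Not at hx
          have hx2 : x = 0 + (2:ℝ) • ((2:ℝ)⁻¹ • x) := by rw [smul_smul]; simp
          have h9 := h5 ((2:ℝ)⁻¹ • x)
          refine (Metric.infEDist_anti (s := ((γ₁.image (fun y => (0 : EuclideanSpace ℝ (Fin d)) + (2:ℝ) • y) : Finset _) : Set (EuclideanSpace ℝ (Fin d)))) (by simp)).trans ?_
          nth_rewrite 1 [hx2]
          rw [zinf_aff 0 _ two_pos]
          refine (mul_le_mul_right h9 _).trans ?_
          rw [← ENNReal.ofReal_mul (by norm_num)]
          apply ENNReal.ofReal_le_ofReal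
          have hn : ‖(2:ℝ)⁻¹ • x‖ = 2⁻¹ * ‖x‖ := by rw [norm_smul]; norm_num
          rw [hn, max_eq_right (by linarith), max_eq_right (by linarith),
            Real.mul_rpow (by norm_num) (by positivity), Real.inv_rpow (by norm_num)]
          apply le_of_eq
          have : (2:ℝ) ^ κ = 2 * q := by
            rw [hq, Real.rpow_sub (by norm_num), Real.rpow_one]; ring
          rw [this]
          field_simp
  refine ⟨C, hCpos, ?_⟩
  intro s hs hs1
  obtain ⟨n, hn⟩ := pow_unbounded_of_one_lt s⁻¹ hq1
  refine main n s hs (by linarith) ?_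
  rw [inv_lt_iff_one_lt_mul₀ hs] at hn
  rw [mul_comm]; exact hn.le

end partFour
end

noncomputable section
open scoped ENNReal NNReal Topology
section partFive
variable {d : ℕ} {p b δ : ℝ} {μ μ₁ μ₂ : Measure (EuclideanSpace ℝ (Fin d))}
  {γ γ' : Finset (EuclideanSpace ℝ (Fin d))} {a c : ℝ}

def zW (q : ℝ) (x : EuclideanSpace ℝ (Fin d)) : ℝ≥0∞ := ENNReal.ofReal ((1 + ‖x‖) ^ q)

lemma zW_eq (q : ℝ) (x : EuclideanSpace ℝ (Fin d)) : zW q x = ENNReal.ofReal ((1 + ‖x‖) ^ q) := rfl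

lemma zW_meas (q : ℝ) : Measurable (zW (d := d) q) := by
  unfold zW
  fun_prop

lemma ztail (hd : 1 ≤ d) (hp : 0 < p) (hδ : 0 < δ) : ∃ C : ℝ, 0 < C ∧
    ∀ (ρ : Measure (EuclideanSpace ℝ (Fin d))) (η : ℝ), 0 ≤ η →
      ∫⁻ x, zW (p + δ) x ∂ρ ≤ ENNReal.ofReal η → ∀ a' : ℝ, 0 < a' →
      C * η ≤ a' ^ (1 + p / d) → zUat p (p / d) ρ a' := by
  obtain ⟨C, hC, h⟩ := zpierce (κ := 1 + δ / p) hd (by have := div_pos hδ hp; linarith)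
  refine ⟨C ^ (p / d), by positivity, ?_⟩
  intro ρ η hη hW a' ha' hle
  refine zUat_of_mesh hd hp hη hC ?_ ha' hle
  have h1 : ∀ᶠ s : ℝ in 𝓝[>] 0, s < 1 := (Iio_mem_nhds one_pos : _) |> mem_nhdsWithin_of_mem_nhds
  filter_upwards [h1, self_mem_nhdsWithin] with s hs1 hs0
  rw [Set.mem_Ioi] at hs0
  obtain ⟨γ, hc, hγ⟩ := h s hs0 hs1.le
  refine ⟨γ, hc, ?_⟩
  calc zV p ρ γ ≤ ∫⁻ x, ENNReal.ofReal (s ^ p) * zW (p + δ) x ∂ρ := by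
        apply lintegral_mono
        intro x
        refine (ENNReal.rpow_le_rpow (hγ x) hp.le).trans ?_
        rw [ENNReal.ofReal_rpow_of_nonneg (by positivity) hp.le]; beta_reduce; rw [zW_eq, ← ENNReal.ofReal_mul (by positivity)]
        apply ENNReal.ofReal_le_ofReal
        rw [Real.mul_rpow hs0.le (by positivity), ← Real.rpow_mul (by positivity)]
        have : (1 + δ / p) * p = p + δ := by field_simp
        rw [this]
        have : max 1 ‖x‖ ≤ 1 + ‖x‖ := max_le (by linarith [norm_nonneg x]) (by linarith)
        gcongr
    _ = ENNReal.ofReal (s ^ p) * ∫⁻ x, zW (p + δ) x ∂ρ := lintegral_const_mul _ (zW_meas _)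
    _ ≤ ENNReal.ofReal (s ^ p) * ENNReal.ofReal η := by gcongr
    _ = _ := by rw [← ENNReal.ofReal_mul (by positivity), mul_comm]

lemma zV_fin (hp : 0 < p) (hδ : 0 ≤ δ) (hW : ∫⁻ x, zW (p + δ) x ∂μ ≠ ⊤) (hγ : γ.Nonempty) :
    zV p μ γ ≠ ⊤ := by
  obtain ⟨y, hy⟩ := hγ
  have : zV p μ γ ≤ ∫⁻ x, ENNReal.ofReal ((1 + ‖y‖) ^ p) * zW (p + δ) x ∂μ := by
    apply lintegral_mono
    intro x
    refine (ENNReal.rpow_le_rpow (Metric.infEDist_le_edist_of_mem (Finset.mem_coe.2 hy)) hp.le).trans ?_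
    rw [edist_dist, ENNReal.ofReal_rpow_of_nonneg (by positivity) hp.le]; beta_reduce; rw [zW_eq, ← ENNReal.ofReal_mul (by positivity)]
    apply ENNReal.ofReal_le_ofReal
    have h1 : dist x y ≤ (1 + ‖y‖) * (1 + ‖x‖) := by
      rw [dist_eq_norm]
      have := norm_sub_le x y
      nlinarith [norm_nonneg x, norm_nonneg y]
    calc dist x y ^ p ≤ ((1 + ‖y‖) * (1 + ‖x‖)) ^ p := by gcongr
      _ = (1 + ‖y‖) ^ p * (1 + ‖x‖) ^ p := Real.mul_rpow (by positivity) (by positivity)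
      _ ≤ _ := by
        gcongr
        · linarith [norm_nonneg x]
        · linarith
  refine ne_top_of_le_ne_top ?_ this
  rw [lintegral_const_mul _ (zW_meas _)]
  exact ENNReal.mul_ne_top ENNReal.ofReal_ne_top hW

lemma zW_bdd {K : Set (EuclideanSpace ℝ (Fin d))} (hK : IsCompact K) (q : ℝ) :
    ∃ M : ℝ≥0, ∀ x ∈ K, zW q x ≤ M := by
  have hc : ContinuousOn (fun x : EuclideanSpace ℝ (Fin d) => (1 + ‖x‖) ^ q) K := by
    apply ContinuousOn.rpow_const (by fun_prop)
    intro x _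
    left; positivity
  obtain ⟨M, hM⟩ := (hK.image_of_continuousOn hc).bddAbove
  refine ⟨M.toNNReal, fun x hx => ?_⟩
  exact ENNReal.ofReal_le_ofReal (hM ⟨x, hx, rfl⟩)

lemma zW_fin_cpt {K : Set (EuclideanSpace ℝ (Fin d))} (hK : IsCompact K) (q : ℝ) (hμ : μ K ≠ ⊤) :
    ∫⁻ x, zW q x ∂(μ.restrict K) ≠ ⊤ := by
  obtain ⟨M, hM⟩ := zW_bdd hK q
  have : ∫⁻ x, zW q x ∂(μ.restrict K) ≤ ∫⁻ x, M ∂(μ.restrict K) :=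
    setLIntegral_mono' hK.isClosed.measurableSet hM
  refine ne_top_of_le_ne_top ?_ this
  rw [lintegral_const, Measure.restrict_apply_univ]
  exact ENNReal.mul_ne_top ENNReal.coe_ne_top hμ

lemma zA_compact (t : EuclideanSpace ℝ (Fin d)) (s : ℝ) : IsCompact (zA t s) := by
  refine Metric.isCompact_of_isClosed_isBounded (zA_closed t s) ?_
  refine (Metric.isBounded_closedBall (x := t) (r := √(d * s ^ 2))).subset ?_
  intro x hx
  rw [mem_closedBall_iff_norm, EuclideanSpace.norm_eq]
  apply Real.sqrt_le_sqrt
  calc ∑ i, ‖(x - t) i‖ ^ 2 ≤ ∑ i : Fin d, s ^ 2 := by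
        apply Finset.sum_le_sum
        intro i _
        have := hx i
        simp only [Set.mem_Icc] at this
        rw [PiLp.sub_apply, Real.norm_eq_abs, sq_abs]
        nlinarith
    _ = _ := by simp

lemma zQ_compact : IsCompact (zQ d) := by
  have : zQ d = zA 0 1 := by ext x; simp [zQ, zA]
  rw [this]; exact zA_compact _ _

lemma zJ_nonneg : 0 ≤ zadorConst p d := by
  apply Real.sInf_nonneg
  rintro r ⟨N, hN, rfl⟩
  apply mul_nonneg (by positivity)
  apply Real.sInf_nonneg
  rintro e ⟨γ, _, _, rfl⟩
  apply integral_nonneg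
  intro z
  exact Real.rpow_nonneg Metric.infDist_nonneg _

lemma zcube_fin (hp : 0 < p) (hγ : γ.Nonempty) : zV p (unifCube d) γ ≠ ⊤ := by
  refine zV_fin (δ := 1) hp zero_le_one ?_ hγ
  exact zW_fin_cpt zQ_compact _ (by rw [zQ_vol]; simp)

lemma zJ_le (hp : 0 < p) (hγ : γ.Nonempty) :
    ENNReal.ofReal (zadorConst p d * (γ.card : ℝ) ^ (-(p / d))) ≤ zV p (unifCube d) γ := by
  rw [ENNReal.ofReal_le_iff_le_toReal (zcube_fin hp hγ)]
  have hc : 1 ≤ γ.card := hγ.card_pos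
  have hc' : (0:ℝ) < γ.card := by exact_mod_cast hc
  have h1 : zadorConst p d ≤ (γ.card : ℝ) ^ (p / (d : ℝ)) * optQErr (unifCube d) p γ.card := by
    apply csInf_le
    · refine ⟨0, ?_⟩
      rintro r ⟨N, hN, rfl⟩
      apply mul_nonneg (by positivity)
      apply Real.sInf_nonneg
      rintro e ⟨γ, _, _, rfl⟩
      apply integral_nonneg
      intro z
      exact Real.rpow_nonneg Metric.infDist_nonneg _
    · exact ⟨_, hc, rfl⟩
  have h2 := zoptQErr_le (μ := unifCube d) hp.le hγ le_rfl
  calc _ ≤ (γ.card : ℝ) ^ (p / (d : ℝ)) * optQErr (unifCube d) p γ.card * (γ.card : ℝ) ^ (-(p / d)) := by gcongr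
    _ = optQErr (unifCube d) p γ.card := by
      rw [Real.rpow_neg hc'.le]; field_simp
    _ ≤ _ := h2

lemma zJ_ex (hp : 0 < p) {η : ℝ} (hη : 0 < η) : ∃ γ : Finset (EuclideanSpace ℝ (Fin d)), γ.Nonempty ∧
    (γ.card : ℝ) ^ (p / (d:ℝ)) * (zV p (unifCube d) γ).toReal ≤ zadorConst p d + η := by
  have h1 : zadorConst p d < zadorConst p d + η := by linarith
  obtain ⟨r, ⟨N, hN, rfl⟩, hr⟩ := exists_lt_of_csInf_lt (s := {r | ∃ N : ℕ, 1 ≤ N ∧ r = (N : ℝ) ^ (p / (d : ℝ)) * optQErr (unifCube d) p N}) ⟨_, 1, le_rfl, rfl⟩ h1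
  have hN' : (0:ℝ) < (N:ℝ) ^ (p / (d:ℝ)) := by
    have : (0:ℝ) < N := by exact_mod_cast hN
    positivity
  have h2 : optQErr (unifCube d) p N < (zadorConst p d + η) / (N:ℝ) ^ (p / (d:ℝ)) := by
    rw [lt_div_iff₀ hN']; linarith
  obtain ⟨e, ⟨γ, hγ, hc, rfl⟩, he⟩ := exists_lt_of_csInf_lt (s := {e | ∃ γ : Finset (EuclideanSpace ℝ (Fin d)), γ.Nonempty ∧ γ.card ≤ N ∧ e = qErr (unifCube d) p ↑γ}) ⟨_, {0}, by simp, by simpa using hN, rfl⟩ h2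
  refine ⟨γ, hγ, ?_⟩
  rw [zqErr_eq hp.le hγ, lt_div_iff₀ hN'] at he
  refine le_trans ?_ he.le
  rw [mul_comm]
  gcongr

end partFive
end

noncomputable section
open scoped ENNReal NNReal Topology
section partSix
variable {d : ℕ} {p b δ : ℝ} {μ μ₁ μ₂ : Measure (EuclideanSpace ℝ (Fin d))}
  {γ γ' : Finset (EuclideanSpace ℝ (Fin d))} {a c : ℝ}

def zth (p : ℝ) (d : ℕ) : ℝ := 1 / (1 + p / d)
def zJ (p : ℝ) (d : ℕ) : ℝ := zadorConst p d ^ zth p d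

lemma zth_pos (hp : 0 < p) : 0 < zth p d := by
  unfold zth; positivity

lemma zth_mul (hp : 0 < p) : zth p d * (1 + p / d) = 1 := by
  have : (0:ℝ) < 1 + p / d := by positivity
  unfold zth; field_simp

lemma zJ_nn : 0 ≤ zJ p d := Real.rpow_nonneg zJ_nonneg _

lemma zth_pow (hp : 0 < p) {x : ℝ} (hx : 0 ≤ x) : (x ^ zth p d) ^ (1 + p / d) = x := by
  rw [← Real.rpow_mul hx, zth_mul hp, Real.rpow_one]

lemma zU_piece (hd : 1 ≤ d) (hp : 0 < p) {K : Set (EuclideanSpace ℝ (Fin d))} (hK : IsCompact K)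
    (v : ℝ≥0) : zU p (p / d) ((v : ℝ≥0∞) • volume.restrict K)
      (zJ p d * (v : ℝ) ^ zth p d * (volume K).toReal) := by
  intro a' ha'
  have hb : 0 < p / d := by
    have : (0:ℝ) < d := by exact_mod_cast hd
    positivity
  set k := (volume K).toReal with hk
  have hk0 : 0 ≤ k := ENNReal.toReal_nonneg
  have hJ := zJ_nonneg (p := p) (d := d)
  have ha0 : 0 < a' := lt_of_le_of_lt (by have := zJ_nn (p := p) (d := d); positivity) ha'
  have h1 : (v:ℝ) * k ^ (1 + p / d) * zadorConst p d < a' ^ (1 + p / d) := by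
    calc _ = (zJ p d * (v : ℝ) ^ zth p d * k) ^ (1 + p / d) := by
          rw [Real.mul_rpow (by have := zJ_nn (p := p) (d := d); positivity) hk0,
            Real.mul_rpow zJ_nn (by positivity), zth_pow hp (by positivity), zJ, zth_pow hp hJ]
          ring
      _ < _ := Real.rpow_lt_rpow (by have := zJ_nn (p := p) (d := d); positivity) ha' (by positivity)
  have h2 : ∀ᶠ t in 𝓝[>] (0:ℝ), (v:ℝ) * (k + t) ^ (1 + p / d) * (zadorConst p d + t) < a' ^ (1 + p / d) := by
    apply mem_nhdsWithin_of_mem_nhds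
    have hc : ContinuousAt (fun t : ℝ => (v:ℝ) * (k + t) ^ (1 + p / d) * (zadorConst p d + t)) 0 := by
      have : ContinuousAt (fun t : ℝ => (k + t) ^ (1 + p / d)) 0 :=
        ContinuousAt.rpow_const (by fun_prop) (Or.inr (by positivity))
      fun_prop
    exact hc.eventually (Iio_mem_nhds (by simpa using h1))
  obtain ⟨t, ht, ht0⟩ := (h2.and self_mem_nhdsWithin).exists
  have ht0 : 0 < t := ht0
  obtain ⟨γ₀, hγ₀, h3⟩ := zJ_ex (p := p) (d := d) hp ht0
  have hV := zcube_fin (d := d) hp hγ₀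
  have hw : volume K < ENNReal.ofReal (k + t) := by
    rw [ENNReal.lt_ofReal_iff_toReal_lt hK.measure_lt_top.ne]; linarith
  have hc0 : (0:ℝ) < γ₀.card := by exact_mod_cast hγ₀.card_pos
  refine zUat_of_mesh (A := v * (k + t) * (zV p (unifCube d) γ₀).toReal) (B := γ₀.card * (k + t)) hd hp
    (by positivity) (by positivity) ?_ ha0 ?_
  · filter_upwards [zpattern hp.le hK hw v γ₀, self_mem_nhdsWithin] with s ⟨γ, hs1, hs2⟩ hs
    rw [Set.mem_Ioi] at hs
    refine ⟨γ, hs1, hs2.trans (le_of_eq ?_)⟩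
    rw [show (v:ℝ) * (k + t) * (zV p (unifCube d) γ₀).toReal * s ^ p =
      v * ((k + t) * s ^ p * (zV p (unifCube d) γ₀).toReal) by ring,
      ENNReal.ofReal_mul (by positivity), ENNReal.ofReal_mul (by positivity),
      ENNReal.ofReal_mul (by positivity), ENNReal.ofReal_toReal hV, ENNReal.ofReal_coe_nnreal]
  · refine le_trans (le_of_eq_of_le (b := (v:ℝ) * (k + t) ^ (1 + p / d) * ((γ₀.card : ℝ) ^ (p / (d:ℝ)) * (zV p (unifCube d) γ₀).toReal)) ?_ ?_) ht.le
    · rw [Real.mul_rpow hc0.le (by positivity), Real.rpow_add (by positivity), Real.rpow_one]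
      ring
    · gcongr

lemma zL_cube (hd : 1 ≤ d) (hp : 0 < p) (t : EuclideanSpace ℝ (Fin d)) {s : ℝ} (hs : 0 < s)
    {v : ℝ≥0} (hv : v ≠ 0) : zL p (p / d) ((v : ℝ≥0∞) • volume.restrict (zA t s))
      (zJ p d * (v : ℝ) ^ zth p d * s ^ d) := by
  classical
  have hd0 : (0:ℝ) < d := by exact_mod_cast hd
  have hb : 0 < p / d := by positivity
  have hJ := zJ_nonneg (p := p) (d := d)
  have hJ' := zJ_nn (p := p) (d := d)
  refine zL_of_bound hb.le (by positivity) (zV_empty hp ?_) ?_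
  · intro h
    have := congrArg (fun m => m (zA t s)) h
    simp [zA_vol t hs, hv, hs] at this
    linarith [pow_pos hs d]
  · intro γ hγ
    set g : EuclideanSpace ℝ (Fin d) → EuclideanSpace ℝ (Fin d) := fun y => t + s • y with hg
    set γ₁ := γ.image (fun y => s⁻¹ • (y - t)) with hγ₁
    have him : γ₁.image g = γ := by
      rw [hγ₁, Finset.image_image]
      have : g ∘ (fun y => s⁻¹ • (y - t)) = id := by
        ext1 y
        simp [hg, smul_smul, hs.ne']
      rw [this, Finset.image_id]
    have hcard : γ₁.card = γ.card := by
      apply Finset.card_image_of_injective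
      intro x y hxy
      have := smul_right_injective _ (inv_ne_zero hs.ne') hxy
      simpa using this
    have h1 := zV_aff (p := p) hp.le t hs γ₁
    rw [him] at h1
    have h2 := zJ_le (p := p) hp (γ := γ₁) (hγ.image _)
    have h3 : zV p ((v : ℝ≥0∞) • volume.restrict (zA t s)) γ = v * zV p (volume.restrict (zA t s)) γ := by
      unfold zV; rw [lintegral_smul_measure]; rfl
    rw [h3, h1, hcard.symm]
    refine le_trans (le_of_eq ?_) (mul_le_mul_right (mul_le_mul_right h2 _) _)
    rw [← ENNReal.ofReal_coe_nnreal, ← ENNReal.ofReal_mul (by positivity), ← ENNReal.ofReal_mul (by positivity),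
      ← ENNReal.ofReal_mul (by positivity)]
    congr 1
    rw [Real.mul_rpow (by positivity) (by positivity),
            Real.mul_rpow zJ_nn (by positivity), zth_pow hp (by positivity), zJ, zth_pow hp hJ]
    rw [Real.rpow_add (by positivity), Real.rpow_one, ← Real.rpow_natCast s d, ← Real.rpow_mul hs.le]
    have : (d:ℝ) * (p / d) = p := by field_simp
    rw [this]; ring

lemma zapprox {κ : Measure (EuclideanSpace ℝ (Fin d))} {h : EuclideanSpace ℝ (Fin d) → ℝ≥0∞}
    (hfin : ∫⁻ x, h x ∂κ ≠ ⊤) {η : ℝ≥0∞} (hη : η ≠ 0) :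
    ∃ (S : Finset ℝ≥0) (K : ℝ≥0 → Set (EuclideanSpace ℝ (Fin d))), (∀ v ∈ S, v ≠ 0) ∧
      (∀ v ∈ S, IsCompact (K v)) ∧ (S : Set ℝ≥0).PairwiseDisjoint K ∧
      (∀ v ∈ S, ∀ x ∈ K v, (v : ℝ≥0∞) ≤ h x) ∧
      ∫⁻ x, h x ∂κ ≤ ∑ v ∈ S, (v : ℝ≥0∞) * κ (K v) + η := by
  classical
  have hη2 : η / 2 ≠ 0 := by simp [hη]
  obtain ⟨φ, hφ, hφ2⟩ : ∃ φ : SimpleFunc (EuclideanSpace ℝ (Fin d)) ℝ≥0,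
      (∀ x, (φ x : ℝ≥0∞) ≤ h x) ∧ ∫⁻ x, h x ∂κ ≤ ∫⁻ x, φ x ∂κ + η / 2 := by
    by_cases h0 : ∫⁻ x, h x ∂κ = 0
    · exact ⟨0, by simp, by simp [h0]⟩
    have h1 : ∫⁻ x, h x ∂κ - η / 2 < ∫⁻ x, h x ∂κ := ENNReal.sub_lt_self hfin h0 hη2
    nth_rewrite 2 [lintegral_eq_nnreal] at h1
    simp only [lt_iSup_iff] at h1
    obtain ⟨φ, h2, h3⟩ := h1
    refine ⟨φ, h2, ?_⟩
    rw [← SimpleFunc.lintegral_eq_lintegral] at h3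
    rw [← tsub_le_iff_right]
    exact h3.le
  have hsum : ∫⁻ x, φ x ∂κ = ∑ v ∈ φ.range with v ≠ 0, (v : ℝ≥0∞) * κ (φ ⁻¹' {v}) := by
    rw [Finset.sum_filter_of_ne, ← SimpleFunc.map_lintegral (fun v : ℝ≥0 => (v : ℝ≥0∞)) φ, ← SimpleFunc.lintegral_eq_lintegral]
    · rfl
    · intro v _ hv h0
      simp [h0] at hv
  set S := φ.range.filter (· ≠ 0) with hS
  have hfinA : ∀ v ∈ S, κ (φ ⁻¹' {v}) ≠ ⊤ := by
    intro v hv h0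
    have hv0 : v ≠ 0 := (Finset.mem_filter.1 hv).2
    have h1 : (v : ℝ≥0∞) * κ (φ ⁻¹' {v}) ≤ ∫⁻ x, h x ∂κ := by
      refine le_trans ?_ ((hsum.symm.le).trans (lintegral_mono hφ))
      exact Finset.single_le_sum (f := fun v : ℝ≥0 => (v : ℝ≥0∞) * κ (φ ⁻¹' {v})) (fun _ _ => zero_le) hv
    rw [h0, ENNReal.mul_top (by simpa using hv0)] at h1
    exact hfin (top_le_iff.1 h1)
  have hex : ∀ v ∈ S, ∃ K ⊆ φ ⁻¹' {v}, IsCompact K ∧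
      (v : ℝ≥0∞) * κ (φ ⁻¹' {v}) ≤ v * κ K + η / 2 / (S.card + 1) := by
    intro v hv
    have hv0 : v ≠ 0 := (Finset.mem_filter.1 hv).2
    have hm : MeasurableSet (φ ⁻¹' {v}) := φ.measurableSet_fiber v
    haveI : IsFiniteMeasure (κ.restrict (φ ⁻¹' {v})) := ⟨by
      rw [Measure.restrict_apply_univ]; exact (hfinA v hv).lt_top⟩
    have hne : η / 2 / (S.card + 1) / v ≠ 0 := by
      refine ENNReal.div_ne_zero.2 ⟨ENNReal.div_ne_zero.2 ⟨hη2, ?_⟩, ENNReal.coe_ne_top⟩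
      exact ENNReal.add_ne_top.2 ⟨ENNReal.natCast_ne_top _, ENNReal.one_ne_top⟩
    obtain ⟨K, hKs, hK, hlt⟩ := hm.exists_isCompact_lt_add (μ := κ.restrict (φ ⁻¹' {v}))
      (measure_ne_top _ _) hne
    refine ⟨K, hKs, hK, ?_⟩
    rw [Measure.restrict_apply_self, Measure.restrict_apply hK.measurableSet, Set.inter_eq_left.2 hKs] at hlt
    refine (mul_le_mul_right hlt.le _).trans ?_
    rw [mul_add, ENNReal.mul_div_cancel (by simpa using hv0) ENNReal.coe_ne_top]
  choose! K hKs hK hKm using hex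
  refine ⟨S, K, fun v hv => (Finset.mem_filter.1 hv).2, hK, ?_, ?_, ?_⟩
  · intro v hv w hw hvw
    refine Set.disjoint_of_subset (hKs v hv) (hKs w hw) ?_
    rw [Set.disjoint_left]
    intro x hx hx'
    exact hvw (hx.symm.trans hx')
  · intro v hv x hx
    have : φ x = v := hKs v hv hx
    rw [← this]; exact hφ x
  · refine hφ2.trans ?_
    rw [hsum]
    calc _ ≤ ∑ v ∈ S, ((v : ℝ≥0∞) * κ (K v) + η / 2 / (S.card + 1)) + η / 2 := by
          gcongr with v hv
          exact hKm v hv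
      _ = ∑ v ∈ S, (v : ℝ≥0∞) * κ (K v) + (S.card * (η / 2 / (S.card + 1)) + η / 2) := by
          rw [Finset.sum_add_distrib, Finset.sum_const, nsmul_eq_mul, add_assoc]
      _ ≤ ∑ v ∈ S, (v : ℝ≥0∞) * κ (K v) + (η / 2 + η / 2) := by
          gcongr
          exact (mul_le_mul' le_self_add le_rfl).trans ENNReal.mul_div_le
      _ = _ := by rw [ENNReal.add_halves]

lemma zth_fin (hd : 1 ≤ d) (hp : 0 < p) (hδ : 0 < δ) {f : EuclideanSpace ℝ (Fin d) → ℝ≥0∞}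
    (hW : ∫⁻ x, f x * zW (p + δ) x ≠ ⊤) : ∫⁻ x, f x ^ zth p d ≠ ⊤ := by
  have hd0 : (0:ℝ) < d := by exact_mod_cast hd
  have hth := zth_pos (d := d) hp
  have hth1 : zth p d < 1 := by
    unfold zth
    rw [div_lt_one (by positivity)]
    have : 0 < p / d := by positivity
    linarith
  set r : ℝ := d * (1 + δ / p) with hr
  have hI : ∫⁻ x : EuclideanSpace ℝ (Fin d), zW (-r) x ≠ ⊤ := by
    have : Integrable (fun x : EuclideanSpace ℝ (Fin d) => (1 + ‖x‖) ^ (-r)) := by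
      apply integrable_one_add_norm
      rw [finrank_euclideanSpace_fin, hr]
      have : 0 < δ / p := by positivity
      nlinarith
    have h2 := this.2
    rw [hasFiniteIntegral_iff_ofReal (ae_of_all _ fun x => by positivity)] at h2
    exact h2.ne
  refine ne_top_of_le_ne_top (ENNReal.add_ne_top.2 ⟨hW, hI⟩) ?_
  rw [← lintegral_add_right _ (zW_meas _)]
  apply lintegral_mono
  intro x
  have key : f x ^ zth p d = (f x * zW (p + δ) x) ^ zth p d * (zW (-r) x) ^ (1 - zth p d) := by
    rw [ENNReal.mul_rpow_of_nonneg _ _ hth.le, mul_assoc]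
    have : zW (p + δ) x ^ zth p d * (zW (-r) x) ^ (1 - zth p d) = 1 := by
      rw [zW_eq, zW_eq, ENNReal.ofReal_rpow_of_nonneg (by positivity) hth.le,
        ENNReal.ofReal_rpow_of_nonneg (by positivity) (by linarith), ← ENNReal.ofReal_mul (by positivity),
        ← Real.rpow_mul (by positivity), ← Real.rpow_mul (by positivity), ← Real.rpow_add (by positivity)]
      have : (p + δ) * zth p d + -r * (1 - zth p d) = 0 := by
        rw [hr]; unfold zth; field_simp; ring
      rw [this]; simp
    rw [this, mul_one]
  beta_reduce
  rw [key]
  have hm1 : f x * zW (p + δ) x ≤ f x * zW (p + δ) x + zW (-r) x := le_self_add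
  have hm2 : zW (-r) x ≤ f x * zW (p + δ) x + zW (-r) x := le_add_self
  refine (mul_le_mul' (ENNReal.rpow_le_rpow hm1 hth.le) (ENNReal.rpow_le_rpow hm2 (by linarith))).trans ?_
  rw [← ENNReal.rpow_add_of_nonneg _ _ hth.le (by linarith)]
  simp

end partSix
end

noncomputable section
open scoped ENNReal NNReal Topology
section partSeven
variable {d : ℕ} {p b δ : ℝ} {μ μ₁ μ₂ : Measure (EuclideanSpace ℝ (Fin d))}
  {γ γ' : Finset (EuclideanSpace ℝ (Fin d))} {a c : ℝ}

lemma zdisj (m : Measure (EuclideanSpace ℝ (Fin d))) (S : Finset ℝ≥0)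
    (K : ℝ≥0 → Set (EuclideanSpace ℝ (Fin d))) (hK : ∀ v ∈ S, IsCompact (K v))
    (hdis : (S : Set ℝ≥0).PairwiseDisjoint K) {s : Set (EuclideanSpace ℝ (Fin d))} (hs : MeasurableSet s)
    (g : EuclideanSpace ℝ (Fin d) → ℝ≥0∞) :
    ∑ v ∈ S, ∫⁻ x in s ∩ K v, g x ∂m ≤ ∫⁻ x in s, g x ∂m := by
  rw [← lintegral_biUnion_finset]
  · exact lintegral_mono_set (Set.iUnion₂_subset fun v _ => Set.inter_subset_left)
  · intro v hv w hw hvw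
    exact (hdis hv hw hvw).mono Set.inter_subset_right Set.inter_subset_right
  · intro v hv
    exact hs.inter (hK v hv).measurableSet

lemma zsig_le (S : Finset ℝ≥0) (c : ℝ≥0 → ℝ≥0)
    (K : ℝ≥0 → Set (EuclideanSpace ℝ (Fin d))) (hK : ∀ v ∈ S, IsCompact (K v))
    (hdis : (S : Set ℝ≥0).PairwiseDisjoint K) (f : EuclideanSpace ℝ (Fin d) → ℝ≥0∞)
    (hc : ∀ v ∈ S, ∀ x ∈ K v, (c v : ℝ≥0∞) ≤ f x) :
    ∑ v ∈ S, (c v : ℝ≥0∞) • volume.restrict (K v) ≤ volume.withDensity f := by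
  rw [Measure.le_iff]
  intro s hs
  rw [Measure.finsetSum_apply, withDensity_apply _ hs]
  refine le_trans ?_ (zdisj volume S K hK hdis hs f)
  apply Finset.sum_le_sum
  intro v hv
  rw [Measure.smul_apply, Measure.restrict_apply hs, smul_eq_mul, ← setLIntegral_const]
  exact setLIntegral_mono' (hs.inter (hK v hv).measurableSet) (fun x hx => hc v hv x hx.2)

lemma zW_one (q : ℝ) (hq : 0 ≤ q) (x : EuclideanSpace ℝ (Fin d)) : 1 ≤ zW q x := by
  rw [zW_eq, ENNReal.one_le_ofReal]
  exact Real.one_le_rpow (by linarith [norm_nonneg x]) hq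

theorem zUpper (hd : 1 ≤ d) (hp : 0 < p) (hδ : 0 < δ) {f : EuclideanSpace ℝ (Fin d) → ℝ≥0∞}
    (hf : Measurable f) (hW : ∫⁻ x, f x * zW (p + δ) x ≠ ⊤) (ν : Measure (EuclideanSpace ℝ (Fin d)))
    (hν : ∫⁻ x, zW (p + δ) x ∂ν ≠ ⊤) (hs : ν.MutuallySingular volume) :
    zU p (p / d) (volume.withDensity f + ν) (zJ p d * (∫⁻ x, f x ^ zth p d).toReal) := by
  intro a' ha'
  have hth := zth_pos (d := d) hp
  have hthf := zth_fin hd hp hδ hW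
  have hb : 0 < p / d := by
    have : (0:ℝ) < d := by exact_mod_cast hd
    positivity
  obtain ⟨C, hC, htail⟩ := ztail (δ := δ) hd hp hδ
  set a := zJ p d * (∫⁻ x, f x ^ zth p d).toReal with ha
  have ha0 : 0 ≤ a := mul_nonneg zJ_nn ENNReal.toReal_nonneg
  set e := (a' - a) / 4 with he
  have he0 : 0 < e := by rw [he]; linarith
  set η := e ^ (1 + p / d) / C with hη
  have hη0 : 0 < η := by positivity
  have hCη : C * η ≤ e ^ (1 + p / d) := by rw [hη]; field_simp; exact le_rfl
  have hWm := zW_meas (d := d) (p + δ)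
  -- the absolutely continuous part
  have hκ : ∫⁻ x, f x ∂(volume.withDensity (zW (p + δ))) = ∫⁻ x, f x * zW (p + δ) x := by
    rw [lintegral_withDensity_eq_lintegral_mul _ hWm hf]
    apply lintegral_congr; intro x; rw [Pi.mul_apply, mul_comm]
  obtain ⟨S, K, -, hK, hdis, hle, hsum⟩ := zapprox (κ := volume.withDensity (zW (p + δ))) (h := f)
    (by rw [hκ]; exact hW) (η := ENNReal.ofReal η) (by simpa using hη0)
  rw [hκ] at hsum
  set σ : Measure (EuclideanSpace ℝ (Fin d)) := ∑ v ∈ S, (v : ℝ≥0∞) • volume.restrict (K v) with hσ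
  have hσle : σ ≤ volume.withDensity f := zsig_le S (fun v => v) K hK hdis f hle
  have hσW : ∫⁻ x, zW (p + δ) x ∂σ = ∑ v ∈ S, (v : ℝ≥0∞) * (volume.withDensity (zW (p + δ))) (K v) := by
    rw [hσ, lintegral_finsetSum_measure]
    apply Finset.sum_congr rfl
    intro v hv
    rw [lintegral_smul_measure, withDensity_apply _ (hK v hv).measurableSet]; rfl
  have hfW : ∫⁻ x, zW (p + δ) x ∂(volume.withDensity f) = ∫⁻ x, f x * zW (p + δ) x := by
    rw [lintegral_withDensity_eq_lintegral_mul _ hf hWm]; rfl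
  have hσWfin : ∫⁻ x, zW (p + δ) x ∂σ ≠ ⊤ :=
    ne_top_of_le_ne_top hW (hfW ▸ lintegral_mono' hσle le_rfl)
  have hσfin : IsFiniteMeasure σ := ⟨by
    refine lt_of_le_of_lt ?_ hσWfin.lt_top
    rw [← lintegral_one]
    exact lintegral_mono (zW_one _ (by linarith))⟩
  set ρ := volume.withDensity f - σ with hρ
  have hρσ : ρ + σ = volume.withDensity f := Measure.sub_add_cancel_of_le hσle
  have hρW : ∫⁻ x, zW (p + δ) x ∂ρ ≤ ENNReal.ofReal η := by
    rw [← hfW, ← hρσ, lintegral_add_measure, ← hσW, add_comm] at hsum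
    exact (ENNReal.add_le_add_iff_left hσWfin).1 hsum
  have hUρ : zUat p (p / d) ρ e := htail ρ η hη0.le hρW e he0 hCη
  have hUσ : zUat p (p / d) σ (a + e) := by
    refine zU_sum S (fun v => (v : ℝ≥0∞) • volume.restrict (K v))
      (fun v => zJ p d * (v : ℝ) ^ zth p d * (volume (K v)).toReal) ?_ hp.le ?_ (a + e) ?_
    · intro v hv
      have := zJ_nn (p := p) (d := d)
      positivity
    · intro v hv
      exact zU_piece hd hp (hK v hv) v
    · have h1 : ∑ v ∈ S, ((v : ℝ≥0∞) ^ zth p d) * volume (K v) ≤ ∫⁻ x, f x ^ zth p d := by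
        have := zdisj volume S K hK hdis MeasurableSet.univ (fun x => f x ^ zth p d)
        rw [Measure.restrict_univ] at this
        refine le_trans ?_ this
        apply Finset.sum_le_sum
        intro v hv
        rw [Set.univ_inter, ← setLIntegral_const]
        exact setLIntegral_mono' (hK v hv).measurableSet
          (fun x hx => ENNReal.rpow_le_rpow (hle v hv x hx) hth.le)
      have h2 := ENNReal.toReal_mono hthf h1
      rw [ENNReal.toReal_sum (fun v hv => ENNReal.mul_ne_top
        (ENNReal.rpow_ne_top_of_nonneg hth.le ENNReal.coe_ne_top) (hK v hv).measure_lt_top.ne)] at h2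
      have h3 : ∑ v ∈ S, zJ p d * (v : ℝ) ^ zth p d * (volume (K v)).toReal ≤ a := by
        rw [ha]
        refine le_trans (le_of_eq ?_) (mul_le_mul_of_nonneg_left h2 zJ_nn)
        rw [Finset.mul_sum]
        apply Finset.sum_congr rfl
        intro v hv
        rw [ENNReal.toReal_mul, ← ENNReal.toReal_rpow, ENNReal.coe_toReal, mul_assoc]
      linarith
  -- the singular part
  have hνfin : IsFiniteMeasure ν := ⟨by
    refine lt_of_le_of_lt ?_ hν.lt_top
    rw [← lintegral_one]
    exact lintegral_mono (zW_one _ (by linarith))⟩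
  obtain ⟨s, hsm, hs1, hs2⟩ := hs
  have hmfin : IsFiniteMeasure (ν.withDensity (zW (p + δ))) := isFiniteMeasure_withDensity hν
  obtain ⟨K0, hK0s, hK0, hK0m⟩ := hsm.compl.exists_isCompact_sdiff_lt (μ := ν.withDensity (zW (p + δ)))
    (measure_ne_top _ _) (ε := ENNReal.ofReal η) (by simpa using hη0)
  have hUn : zUat p (p / d) (ν.restrict K0) e :=
    zU_null hd hp hK0 (measure_mono_null hK0s hs2)
      (by rw [Measure.restrict_apply hK0.measurableSet.compl]; simp) e he0
  have hUr : zUat p (p / d) (ν.restrict K0ᶜ) e := by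
    refine htail _ η hη0.le ?_ e he0 hCη
    rw [← withDensity_apply _ hK0.measurableSet.compl]
    have : K0ᶜ ⊆ s ∪ (sᶜ \ K0) := by
      intro x hx
      by_cases h : x ∈ s
      · exact Or.inl h
      · exact Or.inr ⟨h, hx⟩
    refine (measure_mono this).trans ((measure_union_le _ _).trans ?_)
    rw [withDensity_absolutelyContinuous _ _ hs1, zero_add]
    exact hK0m.le
  have hfinal := zUat_add (zUat_add (zUat_add hUρ hUσ he0.le (by linarith) hp.le) hUn
    (by linarith) he0.le hp.le) hUr (by linarith) he0.le hp.le
  rw [hρσ, add_assoc, Measure.restrict_add_restrict_compl hK0.measurableSet] at hfinal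
  convert hfinal using 1
  rw [he]; ring

end partSeven
end

noncomputable section
open scoped ENNReal NNReal Topology
section partEight
variable {d : ℕ} {p b δ : ℝ} {μ μ₁ μ₂ : Measure (EuclideanSpace ℝ (Fin d))}
  {γ γ' : Finset (EuclideanSpace ℝ (Fin d))} {a c : ℝ}

lemma zA_sup {K : Set (EuclideanSpace ℝ (Fin d))} (hK : IsCompact K) :
    ∃ (t : EuclideanSpace ℝ (Fin d)) (s : ℝ), 0 < s ∧ K ⊆ zA t s := by
  obtain ⟨M, hM0, hM⟩ := hK.isBounded.exists_pos_norm_le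
  refine ⟨WithLp.toLp 2 (fun _ => -M), 2 * M, by linarith, ?_⟩
  intro x hx i
  have h1 := (PiLp.norm_apply_le x i).trans (hM x hx)
  rw [Real.norm_eq_abs, abs_le] at h1
  simp only [Set.mem_Icc]
  constructor <;> linarith

lemma zL_piece (hd : 1 ≤ d) (hp : 0 < p) {K : Set (EuclideanSpace ℝ (Fin d))} (hK : IsCompact K)
    {v : ℝ≥0} (hv : v ≠ 0) : zL p (p / d) ((v : ℝ≥0∞) • volume.restrict K)
      (zJ p d * (v : ℝ) ^ zth p d * (volume K).toReal) := by
  obtain ⟨t, s, hs, hKA⟩ := zA_sup hK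
  have hb : 0 ≤ p / d := by positivity
  have hth := zth_pos (d := d) hp
  have hAm := (zA_closed t s).measurableSet
  have hDm : MeasurableSet (zA t s \ K) := hAm.diff hK.measurableSet
  have hL := zL_cube hd hp t hs hv
  set f : EuclideanSpace ℝ (Fin d) → ℝ≥0∞ := (zA t s \ K).indicator (fun _ => (v : ℝ≥0∞)) with hf
  have hfm : Measurable f := measurable_const.indicator hDm
  have hwd : volume.withDensity f = (v : ℝ≥0∞) • volume.restrict (zA t s \ K) := by
    rw [hf, withDensity_indicator hDm, withDensity_const]
  have hvA : volume (zA t s) ≠ ⊤ := (zA_compact t s).measure_lt_top.ne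
  have hvD : volume (zA t s \ K) ≠ ⊤ := ne_top_of_le_ne_top hvA (measure_mono Set.diff_subset)
  have hU := zUpper (δ := 1) hd hp one_pos hfm ?_ 0 (by simp) Measure.MutuallySingular.zero_left
  · have hI : (∫⁻ x, f x ^ zth p d).toReal = (v : ℝ) ^ zth p d * (volume (zA t s \ K)).toReal := by
      have : ∀ x, f x ^ zth p d = (zA t s \ K).indicator (fun _ => (v : ℝ≥0∞) ^ zth p d) x := by
        intro x
        rw [hf]
        by_cases hx : x ∈ zA t s \ K
        · rw [Set.indicator_of_mem hx, Set.indicator_of_mem hx]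
        · rw [Set.indicator_of_notMem hx, Set.indicator_of_notMem hx, ENNReal.zero_rpow_of_pos hth]
      rw [lintegral_congr this, lintegral_indicator_const hDm, ENNReal.toReal_mul, ← ENNReal.toReal_rpow,
        ENNReal.coe_toReal]
    rw [add_zero, hwd, hI] at hU
    have hsplit : (v : ℝ≥0∞) • volume.restrict (zA t s) =
        (v : ℝ≥0∞) • volume.restrict K + (v : ℝ≥0∞) • volume.restrict (zA t s \ K) := by
      rw [← smul_add, ← Measure.restrict_union Set.disjoint_sdiff_right hDm, Set.union_diff_cancel hKA]
    rw [hsplit] at hL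
    have hJ := zJ_nn (p := p) (d := d)
    have := zL_sub hp.le hb hL hU (by positivity)
    convert this using 1
    have hm : (volume (zA t s \ K)).toReal = s ^ d - (volume K).toReal := by
      rw [measure_diff hKA hK.measurableSet.nullMeasurableSet hK.measure_lt_top.ne,
        ENNReal.toReal_sub_of_le (measure_mono hKA) hvA, zA_vol t hs, ENNReal.toReal_ofReal (by positivity)]
    rw [hm]; ring
  · have h1 : ∫⁻ x, zW (p + 1) x ∂(volume.withDensity f) = ∫⁻ x, f x * zW (p + 1) x := by
      rw [lintegral_withDensity_eq_lintegral_mul _ hfm (zW_meas _)]; rfl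
    rw [← h1, hwd, lintegral_smul_measure]
    refine ENNReal.mul_ne_top ENNReal.coe_ne_top ?_
    exact ne_top_of_le_ne_top (zW_fin_cpt (zA_compact t s) _ hvA)
      (lintegral_mono_set Set.diff_subset)

theorem zLower (hd : 1 ≤ d) (hp : 0 < p) {f : EuclideanSpace ℝ (Fin d) → ℝ≥0∞}
    (hI : ∫⁻ x, f x ^ zth p d ≠ ⊤) :
    zL p (p / d) (volume.withDensity f) (zJ p d * (∫⁻ x, f x ^ zth p d).toReal) := by
  intro a' ha'
  have hth := zth_pos (d := d) hp
  have hb : 0 ≤ p / d := by positivity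
  have hJ := zJ_nn (p := p) (d := d)
  set I := (∫⁻ x, f x ^ zth p d).toReal with hIdef
  set η := (zJ p d * I - a') / (2 * (zJ p d + 1)) with hη
  have hη0 : 0 < η := by
    rw [hη]; apply div_pos <;> linarith
  have hη1 : zJ p d * η < zJ p d * I - a' := by
    have : 2 * (zJ p d + 1) * η = zJ p d * I - a' := by rw [hη]; field_simp
    nlinarith
  obtain ⟨S, K, hS0, hK, hdis, hle, hsum⟩ := zapprox hI (η := ENNReal.ofReal η) (by simpa using hη0)
  set c : ℝ≥0 → ℝ≥0 := fun v => v ^ (1 + p / d) with hc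
  have hcle : ∀ v ∈ S, ∀ x ∈ K v, (c v : ℝ≥0∞) ≤ f x := by
    intro v hv x hx
    have h1 := ENNReal.rpow_le_rpow (hle v hv x hx) (z := 1 + p / d) (by positivity)
    rw [← ENNReal.rpow_mul, zth_mul hp, ENNReal.rpow_one, ← ENNReal.coe_rpow_of_nonneg _ (by positivity)] at h1
    exact h1
  have hσ := zsig_le S c K hK hdis f hcle
  have hL := zL_sum S (fun v => (c v : ℝ≥0∞) • volume.restrict (K v))
    (fun v => zJ p d * (c v : ℝ) ^ zth p d * (volume (K v)).toReal) K hK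
    (by intro v hv
        simp [Measure.restrict_apply (hK v hv).measurableSet.compl]) hdis hp.le hb
    (by intro v hv
        refine zL_piece hd hp (hK v hv) ?_
        have : 0 < v := pos_iff_ne_zero.2 (hS0 v hv)
        exact (NNReal.rpow_pos this).ne')
  refine zL_mono hσ hL a' ?_
  have hfin : ∀ v ∈ S, (v : ℝ≥0∞) * volume (K v) ≠ ⊤ := fun v hv =>
    ENNReal.mul_ne_top ENNReal.coe_ne_top (hK v hv).measure_lt_top.ne
  have h2 : I ≤ ∑ v ∈ S, (v : ℝ) * (volume (K v)).toReal + η := by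
    have := ENNReal.toReal_mono (ENNReal.add_ne_top.2 ⟨ENNReal.sum_ne_top.2 hfin, ENNReal.ofReal_ne_top⟩) hsum
    rw [ENNReal.toReal_add (ENNReal.sum_ne_top.2 hfin) ENNReal.ofReal_ne_top, ENNReal.toReal_sum hfin,
      ENNReal.toReal_ofReal hη0.le] at this
    simpa [ENNReal.toReal_mul] using this
  have h3 : ∑ v ∈ S, zJ p d * (c v : ℝ) ^ zth p d * (volume (K v)).toReal =
      zJ p d * ∑ v ∈ S, (v : ℝ) * (volume (K v)).toReal := by
    rw [Finset.mul_sum]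
    apply Finset.sum_congr rfl
    intro v hv
    rw [hc, NNReal.coe_rpow, ← Real.rpow_mul (by positivity), mul_comm (1 + p / d), zth_mul hp, Real.rpow_one,
      mul_assoc]
  rw [h3]
  have := mul_le_mul_of_nonneg_left h2 hJ
  linarith

end partEight
end

/-- Zador's theorem: if `E[|X|^{p+δ}] < ∞` for some `δ > 0` and
`P_X = f·λ_d + ν` is the Lebesgue decomposition of the law of `X` (with `ν ⊥ λ_d`), then
`N^{p/d} · inf_{card γ ≤ N} E[dist(X,γ)^p] → J_{p,d} · (∫ f^{d/(p+d)})^{(p+d)/d}`. -/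
theorem zador {d : ℕ} (hd : 1 ≤ d) (p δ : ℝ) (hp : 1 ≤ p) (hδ : 0 < δ)
    (μ : Measure (EuclideanSpace ℝ (Fin d))) [IsProbabilityMeasure μ]
    (hmom : Integrable (fun z => ‖z‖ ^ (p + δ)) μ)
    (f : EuclideanSpace ℝ (Fin d) → ℝ) (hf : Measurable f) (hf0 : ∀ u, 0 ≤ f u)
    (ν : Measure (EuclideanSpace ℝ (Fin d)))
    (hdecomp : μ = volume.withDensity (fun u => ENNReal.ofReal (f u)) + ν)
    (hsing : ν.MutuallySingular volume) :
    Tendsto (fun N : ℕ => (N : ℝ) ^ (p / (d : ℝ)) * optQErr μ p N) atTop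
      (nhds (zadorConst p d * (∫ u, f u ^ ((d : ℝ) / (p + (d : ℝ)))) ^ ((p + (d : ℝ)) / (d : ℝ)))) := by
  have hp0 : 0 < p := by linarith
  have hd0 : (0:ℝ) < d := by exact_mod_cast hd
  have hWm := zW_meas (d := d) (p + δ)
  have hth := zth_pos (d := d) hp0
  have hthe : (d : ℝ) / (p + d) = zth p d := by unfold zth; field_simp; ring
  have hWμ : ∫⁻ x, zW (p + δ) x ∂μ ≠ ⊤ := by
    have h1 : Integrable (fun z : EuclideanSpace ℝ (Fin d) => 2 ^ (p + δ) * (1 + ‖z‖ ^ (p + δ))) μ :=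
      ((integrable_const 1).add hmom).const_mul _
    have h2 := h1.2
    rw [hasFiniteIntegral_iff_ofReal (ae_of_all _ fun x => by positivity)] at h2
    refine ne_top_of_le_ne_top h2.ne (lintegral_mono fun x => ENNReal.ofReal_le_ofReal ?_)
    have h3 : 1 + ‖x‖ ≤ 2 * max 1 ‖x‖ := by linarith [le_max_left 1 ‖x‖, le_max_right 1 ‖x‖]
    calc (1 + ‖x‖) ^ (p + δ) ≤ (2 * max 1 ‖x‖) ^ (p + δ) := by gcongr
      _ = 2 ^ (p + δ) * (max 1 ‖x‖) ^ (p + δ) := Real.mul_rpow (by norm_num) (by positivity)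
      _ ≤ _ := by
        gcongr
        rcases max_cases 1 ‖x‖ with h | h
        · rw [h.1, Real.one_rpow]
          have : 0 ≤ ‖x‖ ^ (p + δ) := by positivity
          linarith
        · rw [h.1]; linarith
  set g : EuclideanSpace ℝ (Fin d) → ENNReal := fun u => ENNReal.ofReal (f u) with hg
  have hgm : Measurable g := hf.ennreal_ofReal
  have hsplit := hWμ
  rw [hdecomp, lintegral_add_measure, ENNReal.add_ne_top,
    lintegral_withDensity_eq_lintegral_mul _ hgm hWm] at hsplit
  obtain ⟨hgW, hνW⟩ := hsplit
  have hgW : ∫⁻ x, g x * zW (p + δ) x ≠ ⊤ := hgW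
  have hI := zth_fin hd hp0 hδ hgW
  have hIe : (∫⁻ x, g x ^ zth p d).toReal = ∫ u, f u ^ ((d : ℝ) / (p + (d : ℝ))) := by
    rw [integral_eq_lintegral_of_nonneg_ae (ae_of_all _ fun u => Real.rpow_nonneg (hf0 u) _)
      (hf.pow_const _).aestronglyMeasurable, hthe]
    congr 1
    apply lintegral_congr
    intro x
    rw [hg, ENNReal.ofReal_rpow_of_nonneg (hf0 x) hth.le]
  have hU := zUpper hd hp0 hδ hgm hgW ν hνW hsing
  have hL := zL_mono (μ₂ := volume.withDensity g + ν) (Measure.le_add_right le_rfl) (zLower hd hp0 hI)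
  rw [← hdecomp] at hU hL
  have := z_final hp0 (by positivity)
    (mul_nonneg zJ_nn ENNReal.toReal_nonneg) (IsProbabilityMeasure.ne_zero μ)
    (fun γ hγ => zV_fin hp0 hδ.le hWμ hγ) hU hL
  convert this using 2
  rw [hIe, Real.mul_rpow zJ_nn (integral_nonneg fun u => Real.rpow_nonneg (hf0 u) _), zJ, zth_pow hp0 zJ_nonneg]
  congr 2
  field_simp
  ring
end

section
/- Let p ≥ 1, d ≥ 1, δ > 0, and let X be an ℝ^d-valued random vector with E[|X|^{p+δ}] < ∞. Then there exist real constants C, D and an integer N₀ such that for every N ≥ N₀, inf{ E[dist(X,γ)^p] : γ ⊂ ℝ^d, card(γ) ≤ N } ≤ N^{−p/d} ( C·E[|X|^{p+δ}] + D ). In particular, for every L_p-optimal N-grid γ^N, E[dist(X,γ^N)^p] ≤ N^{−p/d} ( C·E[|X|^{p+δ}] + D ) for N ≥ N₀. -/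
open MeasureTheory ProbabilityTheory Filter

/-- `γ` is an `L_p`-optimal `N`-grid for (the law) `μ`. -/
def IsOptimalGrid {d : ℕ} (μ : Measure (EuclideanSpace ℝ (Fin d))) (p : ℝ) (N : ℕ)
    (γ : Finset (EuclideanSpace ℝ (Fin d))) : Prop :=
  γ.Nonempty ∧ γ.card ≤ N ∧
    ∀ γ' : Finset (EuclideanSpace ℝ (Fin d)), γ'.Nonempty → γ'.card ≤ N →
      qErr μ p ↑γ ≤ qErr μ p ↑γ'

theorem aux_card {d : ℕ} (hd : 1 ≤ d) (θ : ℝ) (hθ : 1 < θ) :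
    ∃ K : ℝ, 0 < K ∧ ∀ ε : ℝ, 0 < ε → ∀ S : Finset (EuclideanSpace ℝ (Fin d)),
      (∀ x ∈ S, ε * (1 + ‖x‖) ^ θ ≤ 1 + ‖x‖) →
      ((S : Set (EuclideanSpace ℝ (Fin d))).PairwiseDisjoint
        (fun x => Metric.ball x (ε * (1 + ‖x‖) ^ θ / 4))) →
      (S.card : ℝ) * ε ^ d ≤ K := by
  have hd0 : (0 : ℝ) < d := by exact_mod_cast hd
  set g : EuclideanSpace ℝ (Fin d) → ℝ := fun z => (1 + ‖z‖) ^ (-(θ * d)) with hg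
  have hgi : Integrable g volume := by
    apply integrable_one_add_norm
    rw [finrank_euclideanSpace_fin]
    nlinarith
  have hg0 : ∀ z, 0 ≤ g z := fun z => Real.rpow_nonneg (by positivity) _
  set v : ℝ := volume.real (Metric.ball (0 : EuclideanSpace ℝ (Fin d)) 1) with hv
  have hv0 : 0 < v := by
    apply ENNReal.toReal_pos
    · exact (Metric.measure_ball_pos volume _ one_pos).ne'
    · exact measure_ball_lt_top.ne
  set c : ℝ := (2 : ℝ) ^ (-(θ * d)) * (1 / 4) ^ d * v with hc
  have hc0 : 0 < c := by positivity
  refine ⟨(∫ z, g z) / c + 1, ?_, ?_⟩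
  · have : 0 ≤ ∫ z, g z := integral_nonneg hg0
    positivity
  intro ε hε S hS hdisj
  have key : ∀ x ∈ S, c * ε ^ d ≤ ∫ z in Metric.ball x (ε * (1 + ‖x‖) ^ θ / 4), g z := by
    intro x hx
    have h1 : (0 : ℝ) < 1 + ‖x‖ := by positivity
    have hw : 0 < (1 + ‖x‖) ^ θ := Real.rpow_pos_of_pos h1 _
    have hvol : volume.real (Metric.ball x (ε * (1 + ‖x‖) ^ θ / 4)) =
        (ε * (1 + ‖x‖) ^ θ / 4) ^ d * v := by
      rw [measureReal_def, Measure.addHaar_ball_of_pos volume x (by positivity),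
        finrank_euclideanSpace_fin, ENNReal.toReal_mul, ENNReal.toReal_ofReal (by positivity),
        hv, measureReal_def]
    have hlow := setIntegral_ge_of_const_le_real (μ := volume) (f := g)
      (s := Metric.ball x (ε * (1 + ‖x‖) ^ θ / 4))
      (c := (2 * (1 + ‖x‖)) ^ (-(θ * d))) measurableSet_ball measure_ball_lt_top.ne
      (by
        intro z hz
        have hz' : ‖z - x‖ < ε * (1 + ‖x‖) ^ θ / 4 := by
          simpa [dist_eq_norm] using hz
        have := hS x hx
        have h3 : ‖z‖ ≤ ‖z - x‖ + ‖x‖ := by simpa using norm_add_le (z - x) x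
        apply Real.rpow_le_rpow_of_nonpos (by positivity)
        · linarith
        · have : 0 < θ * d := by positivity
          linarith) hgi.integrableOn
    refine le_trans (le_of_eq ?_) hlow
    rw [hvol, Real.mul_rpow (by norm_num) h1.le, hc, div_pow (ε * _), mul_pow ε,
      one_div_pow, Real.rpow_neg h1.le, Real.rpow_mul h1.le, Real.rpow_natCast]
    field_simp
  have hsum : (S.card : ℝ) * (c * ε ^ d) ≤ ∫ z, g z := by
    calc (S.card : ℝ) * (c * ε ^ d) = ∑ x ∈ S, c * ε ^ d := by simp
      _ ≤ ∑ x ∈ S, ∫ z in Metric.ball x (ε * (1 + ‖x‖) ^ θ / 4), g z := Finset.sum_le_sum key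
      _ = ∫ z in ⋃ x ∈ S, Metric.ball x (ε * (1 + ‖x‖) ^ θ / 4), g z := by
        rw [integral_biUnion_finset]
        · intro x _; exact measurableSet_ball
        · exact hdisj
        · intro x _; exact hgi.integrableOn
      _ ≤ ∫ z, g z := setIntegral_le_integral hgi (Eventually.of_forall hg0)
  have : (S.card : ℝ) * ε ^ d ≤ (∫ z, g z) / c := by
    rw [le_div_iff₀ hc0]
    linarith
  linarith

theorem aux_grid {d : ℕ} (hd : 1 ≤ d) (θ : ℝ) (hθ : 1 < θ) :
    ∃ K : ℝ, 0 < K ∧ ∀ ε : ℝ, 0 < ε → ∃ γ : Finset (EuclideanSpace ℝ (Fin d)),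
      γ.Nonempty ∧ (γ.card : ℝ) ≤ K / ε ^ d + 1 ∧
      ∀ z, Metric.infDist z (γ : Set (EuclideanSpace ℝ (Fin d))) ≤
        (1 + 2 ^ θ) * (ε * (1 + ‖z‖) ^ θ) := by
  classical
  obtain ⟨K, hK, hcard⟩ := aux_card hd θ hθ
  refine ⟨K, hK, fun ε hε => ?_⟩
  set P : Finset (EuclideanSpace ℝ (Fin d)) → Prop := fun S =>
      (∀ x ∈ S, ε * (1 + ‖x‖) ^ θ ≤ 1 + ‖x‖) ∧
      ((S : Set (EuclideanSpace ℝ (Fin d))).PairwiseDisjoint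
        (fun x => Metric.ball x (ε * (1 + ‖x‖) ^ θ / 4))) with hP
  have hb : ∀ S, P S → (S.card : ℝ) ≤ K / ε ^ d := by
    intro S hS
    rw [le_div_iff₀ (by positivity)]
    exact hcard ε hε S hS.1 hS.2
  obtain ⟨S, hS, hmax⟩ : ∃ S, P S ∧ ∀ T, P T → T.card ≤ S.card := by
    set A : Set ℕ := {n | ∃ S, P S ∧ S.card = n}
    have hne : A.Nonempty := ⟨0, ∅, by simp [hP], rfl⟩
    have hbd : BddAbove A := by
      refine ⟨⌊K / ε ^ d⌋₊, ?_⟩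
      rintro n ⟨S, hS, rfl⟩
      exact Nat.le_floor (hb S hS)
    obtain ⟨S, hS, hn⟩ := Nat.sSup_mem hne hbd
    refine ⟨S, hS, fun T hT => ?_⟩
    rw [hn]
    exact le_csSup hbd ⟨T, hT, rfl⟩
  refine ⟨insert 0 S, by simp, ?_, ?_⟩
  · have h1 : ((insert 0 S).card : ℝ) ≤ S.card + 1 := by
      exact_mod_cast Finset.card_insert_le 0 S
    linarith [hb S hS]
  intro z
  have h1 : (0 : ℝ) < 1 + ‖z‖ := by positivity
  have hw : 0 < (1 + ‖z‖) ^ θ := Real.rpow_pos_of_pos h1 _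
  have h2 : (0 : ℝ) < 2 ^ θ := by positivity
  have hew : 0 < ε * (1 + ‖z‖) ^ θ := by positivity
  have h2ew : 0 < 2 ^ θ * (ε * (1 + ‖z‖) ^ θ) := by positivity
  by_cases hz : ε * (1 + ‖z‖) ^ θ ≤ 1 + ‖z‖
  · obtain ⟨x, hx, hdist⟩ : ∃ x ∈ S, x = z ∨
        ¬ Disjoint (Metric.ball z (ε * (1 + ‖z‖) ^ θ / 4))
          (Metric.ball x (ε * (1 + ‖x‖) ^ θ / 4)) := by
      by_contra! hcon
      have hzS : z ∉ S := fun h => (hcon z h).1 rfl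
      have hPi : P (insert z S) := by
        refine ⟨?_, ?_⟩
        · intro x hx
          rcases Finset.mem_insert.1 hx with rfl | hx
          · exact hz
          · exact hS.1 x hx
        · rw [Finset.coe_insert]
          exact hS.2.insert (fun x hx _ => (hcon x hx).2)
      have := hmax _ hPi
      rw [Finset.card_insert_of_notMem hzS] at this
      omega
    have hinf : Metric.infDist z ((insert 0 S : Finset _) : Set (EuclideanSpace ℝ (Fin d)))
        ≤ dist z x := Metric.infDist_le_dist_of_mem (by simp [hx])
    refine hinf.trans ?_
    rcases hdist with rfl | hnd
    · rw [dist_self]; positivity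
    obtain ⟨y, hy1, hy2⟩ := Set.not_disjoint_iff.1 hnd
    rw [Metric.mem_ball] at hy1 hy2
    have hzx : dist z x ≤ dist y z + dist y x := dist_triangle_left z x y
    have hxS := hS.1 x hx
    have hn : ‖x‖ ≤ ‖z‖ + dist z x := by
      rw [dist_eq_norm, norm_sub_rev]
      simpa using norm_add_le z (x - z)
    have hx2 : 1 + ‖x‖ ≤ 2 * (1 + ‖z‖) := by linarith
    have hwx : (1 + ‖x‖) ^ θ ≤ 2 ^ θ * (1 + ‖z‖) ^ θ := by
      rw [← Real.mul_rpow (by norm_num) h1.le]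
      exact Real.rpow_le_rpow (by positivity) hx2 (by linarith)
    have := mul_le_mul_of_nonneg_left hwx hε.le
    linarith
  · have hinf : Metric.infDist z ((insert 0 S : Finset _) : Set (EuclideanSpace ℝ (Fin d)))
        ≤ dist z 0 := Metric.infDist_le_dist_of_mem (by simp)
    rw [dist_zero_right] at hinf
    linarith

/-- if `E[|X|^{p+δ}] < ∞` then there are constants `C`, `D` and `N₀` such that
for all `N ≥ N₀` the optimal `L_p`-quantization error at level `N` is at most
`N^{−p/d}(C·E[|X|^{p+δ}] + D)`; in particular every `L_p`-optimal `N`-grid `γ` satisfies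
`E[dist(X,γ)^p] ≤ N^{−p/d}(C·E[|X|^{p+δ}] + D)`. -/
theorem quantization_error_rate {d : ℕ} (hd : 1 ≤ d) (p δ : ℝ) (hp : 1 ≤ p) (hδ : 0 < δ)
    (μ : Measure (EuclideanSpace ℝ (Fin d))) [IsProbabilityMeasure μ]
    (hmom : Integrable (fun z => ‖z‖ ^ (p + δ)) μ) :
    ∃ (C D : ℝ) (N₀ : ℕ), ∀ N ≥ N₀,
      optQErr μ p N ≤ (N : ℝ) ^ (-(p / (d : ℝ))) * (C * (∫ z, ‖z‖ ^ (p + δ) ∂μ) + D) ∧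
      ∀ γ : Finset (EuclideanSpace ℝ (Fin d)), IsOptimalGrid μ p N γ →
        qErr μ p ↑γ ≤ (N : ℝ) ^ (-(p / (d : ℝ))) * (C * (∫ z, ‖z‖ ^ (p + δ) ∂μ) + D) := by
  have hd0 : (0 : ℝ) < d := by exact_mod_cast hd
  have hp0 : 0 < p := by linarith
  have hθ : 1 < (p + δ) / p := by rw [lt_div_iff₀ hp0]; linarith
  obtain ⟨K, hK, hgrid⟩ := aux_grid hd ((p + δ) / p) hθ
  set θ := (p + δ) / p with hθdef
  have hθp : θ * p = p + δ := by rw [hθdef]; field_simp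
  set I : ℝ := ∫ z, (1 + ‖z‖) ^ (p + δ) ∂μ with hI
  have hint : Integrable (fun z : EuclideanSpace ℝ (Fin d) => (1 + ‖z‖) ^ (p + δ)) μ := by
    refine Integrable.mono' (g := fun z => 2 ^ (p + δ) * (1 + ‖z‖ ^ (p + δ)))
      (((integrable_const 1).add hmom).const_mul _) ?_ ?_
    · apply Measurable.aestronglyMeasurable
      fun_prop
    · refine Eventually.of_forall fun z => ?_
      have hz := norm_nonneg z
      have hs : 0 ≤ p + δ := by linarith
      rw [Real.norm_of_nonneg (by positivity)]
      have hzs : 0 ≤ ‖z‖ ^ (p + δ) := by positivity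
      have h2s : (0 : ℝ) < 2 ^ (p + δ) := by positivity
      rcases le_total ‖z‖ 1 with h | h
      · calc (1 + ‖z‖) ^ (p + δ) ≤ 2 ^ (p + δ) :=
              Real.rpow_le_rpow (by positivity) (by linarith) hs
          _ ≤ _ := by nlinarith
      · calc (1 + ‖z‖) ^ (p + δ) ≤ (2 * ‖z‖) ^ (p + δ) :=
              Real.rpow_le_rpow (by positivity) (by linarith) hs
          _ = 2 ^ (p + δ) * ‖z‖ ^ (p + δ) := Real.mul_rpow (by norm_num) hz
          _ ≤ _ := by nlinarith
  set B : ℝ := 1 + 2 ^ θ with hB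
  have hB0 : 0 < B := by positivity
  refine ⟨0, B ^ p * (2 * K) ^ (p / (d : ℝ)) * I, 2, fun N hN => ?_⟩
  have hN2 : (2 : ℝ) ≤ N := by exact_mod_cast hN
  have hN0 : (0 : ℝ) < N := by linarith
  set ε : ℝ := (2 * K / N) ^ (1 / (d : ℝ)) with hε
  have hε0 : 0 < ε := by positivity
  have hεd : ε ^ d = 2 * K / N := by
    rw [hε, ← Real.rpow_natCast, ← Real.rpow_mul (by positivity)]
    rw [one_div_mul_cancel hd0.ne', Real.rpow_one]
  have hεp : ε ^ p = (N : ℝ) ^ (-(p / (d : ℝ))) * (2 * K) ^ (p / (d : ℝ)) := by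
    rw [hε, ← Real.rpow_mul (by positivity), Real.div_rpow (by positivity) hN0.le,
      Real.rpow_neg hN0.le, one_div_mul_eq_div]
    ring
  obtain ⟨γ, hγ, hγc, hγd⟩ := hgrid ε hε0
  have hcardN : γ.card ≤ N := by
    have : K / ε ^ d = N / 2 := by rw [hεd]; field_simp
    rw [this] at hγc
    have : (γ.card : ℝ) ≤ N := by linarith
    exact_mod_cast this
  have hbound : qErr μ p ↑γ ≤ (N : ℝ) ^ (-(p / (d : ℝ))) *
      (0 * (∫ z, ‖z‖ ^ (p + δ) ∂μ) + B ^ p * (2 * K) ^ (p / (d : ℝ)) * I) := by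
    have h1 : qErr μ p ↑γ ≤ ∫ z, B ^ p * ε ^ p * (1 + ‖z‖) ^ (p + δ) ∂μ := by
      refine integral_mono_of_nonneg ?_ (hint.const_mul _) ?_
      · exact Eventually.of_forall fun z => Real.rpow_nonneg Metric.infDist_nonneg _
      · refine Eventually.of_forall fun z => ?_
        have hz : (0 : ℝ) ≤ 1 + ‖z‖ := by positivity
        have := Real.rpow_le_rpow Metric.infDist_nonneg (hγd z) hp0.le
        rw [Real.mul_rpow hB0.le (by positivity), Real.mul_rpow hε0.le (by positivity),
          ← Real.rpow_mul hz, hθp, ← mul_assoc] at this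
        exact this
    rw [integral_const_mul, hεp] at h1
    refine h1.trans (le_of_eq ?_)
    ring
  refine ⟨?_, fun γ' hγ' => (hγ'.2.2 γ hγ hcardN).trans hbound⟩
  refine le_trans (csInf_le ⟨0, ?_⟩ ⟨γ, hγ, hcardN, rfl⟩) hbound
  rintro e ⟨γ', -, -, rfl⟩
  exact integral_nonneg fun z => Real.rpow_nonneg Metric.infDist_nonneg _
end

section
/- Let P be a probability measure on ℝ that is absolutely continuous with a density f : [a,b] → [0,∞) supported on the compact interval [a,b], with f positive on (a,b). Assume either that log f is strictly concave on (a,b), or that log f is concave on (a,b) and the one-sided limits f(a+) = lim_{x→a+} f(x) and f(b−) = lim_{x→b−} f(x) exist with f(a+) − f(b−) > 0. Then for every N ≥ 1 the squared L₂-quantization-error function x = (x₁,…,x_N) ↦ D_N(x) = ∫_{[a,b]} min_{1≤i≤N} |x_i − w|² dP(w) admits a unique minimizer x* over the closure of the set F_N^+ = { (x₁,…,x_N) : a < x₁ < ⋯ < x_N < b }. -/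
open MeasureTheory Filter

/-- The squared `L₂`-quantization error of the grid `x = (x₁,…,x_N)` with respect to `P`:
`D_N(x) = ∫ min_{1≤i≤N} |x_i − w|² dP(w)`. -/
noncomputable def sqQErr {N : ℕ} (P : Measure ℝ) (x : Fin N → ℝ) : ℝ :=
  ∫ w, (⨅ i, (x i - w) ^ 2) ∂P

/-- `F_N^+`: the set of `N`-tuples of pairwise distinct points of `(a,b)` listed in strictly
increasing order. -/
def FNplus (a b : ℝ) (N : ℕ) : Set (Fin N → ℝ) :=
  {x | StrictMono x ∧ ∀ i, x i ∈ Set.Ioo a b}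

namespace QG

def cell {N : ℕ} (x : Fin N → ℝ) (i : Fin N) : Set ℝ :=
  {w | (∀ j, j < i → (x j + x i) / 2 ≤ w) ∧ (∀ j, i < j → w ≤ (x i + x j) / 2)}

lemma isClosed_cell {N : ℕ} (x : Fin N → ℝ) (i : Fin N) : IsClosed (cell x i) := by
  have : cell x i = (⋂ j, ⋂ (_ : j < i), Set.Ici ((x j + x i) / 2)) ∩
      (⋂ j, ⋂ (_ : i < j), Set.Iic ((x i + x j) / 2)) := by
    ext w; simp [cell]
  rw [this]
  exact (isClosed_iInter fun j => isClosed_iInter fun _ => isClosed_Ici).inter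
    (isClosed_iInter fun j => isClosed_iInter fun _ => isClosed_Iic)

lemma cell_mem_nhds {N : ℕ} {x : Fin N → ℝ} (hx : StrictMono x) (i : Fin N) :
    cell x i ∈ nhds (x i) := by
  have : cell x i = (⋂ j, ⋂ (_ : j < i), Set.Ici ((x j + x i) / 2)) ∩
      (⋂ j, ⋂ (_ : i < j), Set.Iic ((x i + x j) / 2)) := by
    ext w; simp [cell]
  rw [this]
  refine Filter.inter_mem ?_ ?_
  · refine (Filter.iInter_mem).2 fun j => (Filter.iInter_mem).2 fun h => Ici_mem_nhds ?_
    have := hx h; linarith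
  · refine (Filter.iInter_mem).2 fun j => (Filter.iInter_mem).2 fun h => Iic_mem_nhds ?_
    have := hx h; linarith

lemma iInf_le' {N : ℕ} (x : Fin N → ℝ) (w : ℝ) (i : Fin N) :
    (⨅ j, (x j - w) ^ 2) ≤ (x i - w) ^ 2 :=
  ciInf_le (Set.finite_range _).bddBelow i

lemma iInf_nonneg' {N : ℕ} (x : Fin N → ℝ) (w : ℝ) : 0 ≤ (⨅ j, (x j - w) ^ 2) :=
  Real.iInf_nonneg fun _ => sq_nonneg _

lemma iInf_att {N : ℕ} [NeZero N] (x : Fin N → ℝ) (w : ℝ) :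
    ∃ i, (⨅ j, (x j - w) ^ 2) = (x i - w) ^ 2 := by
  obtain ⟨i, hi⟩ := exists_eq_ciInf_of_finite (f := fun j => (x j - w) ^ 2)
  exact ⟨i, hi.symm⟩

lemma le_of_mem_cell {N : ℕ} {x : Fin N → ℝ} (hx : StrictMono x) {i : Fin N} {w : ℝ}
    (hw : w ∈ cell x i) (j : Fin N) : (x i - w) ^ 2 ≤ (x j - w) ^ 2 := by
  rcases lt_trichotomy j i with h | h | h
  · have := hw.1 j h; have := hx h; nlinarith
  · rw [h]
  · have := hw.2 j h; have := hx h; nlinarith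

lemma exists_of_not_mem_cell {N : ℕ} {x : Fin N → ℝ} (hx : StrictMono x) {i : Fin N} {w : ℝ}
    (hw : w ∉ cell x i) : ∃ j, j ≠ i ∧ (x j - w) ^ 2 ≤ (x i - w) ^ 2 := by
  have : (∃ j, j < i ∧ w < (x j + x i) / 2) ∨ (∃ j, i < j ∧ (x i + x j) / 2 < w) := by
    by_contra hc
    push Not at hc
    exact hw ⟨hc.1, hc.2⟩
  rcases this with ⟨j, h, h2⟩ | ⟨j, h, h2⟩
  · exact ⟨j, h.ne, by have := hx h; nlinarith⟩
  · exact ⟨j, h.ne', by have := hx h; nlinarith⟩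

lemma update_le {N : ℕ} [NeZero N] {x : Fin N → ℝ} (hx : StrictMono x) (i : Fin N) (c w : ℝ) :
    (⨅ j, (Function.update x i c j - w) ^ 2) ≤ (⨅ j, (x j - w) ^ 2) +
      (cell x i).indicator (fun w => (c - w) ^ 2 - (x i - w) ^ 2) w := by
  by_cases hw : w ∈ cell x i
  · rw [Set.indicator_of_mem hw]
    have h1 := iInf_le' (Function.update x i c) w i
    have h2 : (x i - w) ^ 2 ≤ (⨅ j, (x j - w) ^ 2) := le_ciInf (le_of_mem_cell hx hw)
    simp only [Function.update_self] at h1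
    linarith
  · rw [Set.indicator_of_notMem hw, add_zero]
    obtain ⟨k, hk⟩ := iInf_att x w
    obtain ⟨j, hj, hj2⟩ := exists_of_not_mem_cell hx hw
    by_cases hki : k = i
    · have h1 := iInf_le' (Function.update x i c) w j
      rw [Function.update_of_ne hj] at h1
      rw [hk, hki]; linarith
    · have h1 := iInf_le' (Function.update x i c) w k
      rw [Function.update_of_ne hki] at h1
      rw [hk]; linarith

lemma continuous_iInf {N : ℕ} [NeZero N] :
    Continuous (fun p : (Fin N → ℝ) × ℝ => ⨅ j, (p.1 j - p.2) ^ 2) := by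
  have : (fun p : (Fin N → ℝ) × ℝ => ⨅ j, (p.1 j - p.2) ^ 2) =
      fun p => Finset.univ.inf' Finset.univ_nonempty (fun j => (p.1 j - p.2) ^ 2) := by
    funext p
    rw [Finset.inf'_univ_eq_ciInf]
  rw [this]
  apply Continuous.finset_inf'_apply
  intro i _
  fun_prop

lemma cont_w {N : ℕ} [NeZero N] (x : Fin N → ℝ) : Continuous fun w => ⨅ k, (x k - w) ^ 2 :=
  continuous_iInf.comp (Continuous.prodMk_right x)

lemma closure_FNplus {a b : ℝ} (hab : a < b) (N : ℕ) :
    closure (FNplus a b N) = {x | Monotone x ∧ ∀ i, x i ∈ Set.Icc a b} := by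
  apply Set.Subset.antisymm
  · apply closure_minimal
    · rintro x ⟨h1, h2⟩
      exact ⟨h1.monotone, fun i => Set.Ioo_subset_Icc_self (h2 i)⟩
    · have : {x : Fin N → ℝ | Monotone x ∧ ∀ i, x i ∈ Set.Icc a b} =
        (⋂ i, ⋂ j, ⋂ (_ : i ≤ j), {x | x i ≤ x j}) ∩ (⋂ i, {x | x i ∈ Set.Icc a b}) := by
        ext x; simp only [Set.mem_inter_iff, Set.mem_iInter, Set.mem_ofPred_eq]; rfl
      rw [this]
      refine (isClosed_iInter fun i => isClosed_iInter fun j => isClosed_iInter fun _ => ?_).inter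
        (isClosed_iInter fun i => ?_)
      · exact isClosed_le (continuous_apply i) (continuous_apply j)
      · exact isClosed_Icc.preimage (continuous_apply i)
  · rintro x ⟨h1, h2⟩
    set z : Fin N → ℝ := fun i => a + (b - a) * ((i : ℝ) + 1) / ((N : ℝ) + 1) with hz
    have hN : (0 : ℝ) < (N : ℝ) + 1 := by positivity
    have hba : 0 < b - a := by linarith
    have hzm : StrictMono z := by
      intro i j hij
      have : (i : ℝ) < (j : ℝ) := by exact_mod_cast hij
      simp only [hz]
      gcongr
    have hzI : ∀ i, z i ∈ Set.Ioo a b := by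
      intro i
      have h3 : (i : ℝ) < N := by exact_mod_cast i.2
      constructor
      · simp only [hz]
        have : 0 < (b - a) * ((i : ℝ) + 1) / ((N : ℝ) + 1) := by positivity
        linarith
      · simp only [hz]
        have : (b - a) * ((i : ℝ) + 1) / ((N : ℝ) + 1) < b - a := by
          rw [div_lt_iff₀ hN]
          nlinarith
        linarith
    have hcont : Continuous (fun s : ℝ => (fun i => (1 - s) * x i + s * z i : Fin N → ℝ)) := by
      fun_prop
    have ht : Tendsto (fun s : ℝ => (fun i => (1 - s) * x i + s * z i : Fin N → ℝ))
        (nhdsWithin 0 (Set.Ioi 0)) (nhds x) := by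
      have := (hcont.tendsto 0).mono_left (nhdsWithin_le_nhds (s := Set.Ioi 0))
      simpa using this
    refine mem_closure_of_tendsto ht ?_
    filter_upwards [Ioo_mem_nhdsGT (show (0 : ℝ) < 1 by norm_num)] with s hs
    obtain ⟨hs0, hs1⟩ := hs
    refine ⟨fun i j hij => ?_, fun i => ?_⟩
    · have e1 := h1 hij.le
      have e2 := hzm hij
      show (1 - s) * x i + s * z i < (1 - s) * x j + s * z j
      nlinarith
    · obtain ⟨e1, e2⟩ := h2 i
      obtain ⟨e3, e4⟩ := hzI i
      constructor <;> nlinarith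

lemma sqQErr_perm {N : ℕ} (P : Measure ℝ) (x : Fin N → ℝ) (σ : Equiv.Perm (Fin N)) :
    sqQErr P (x ∘ σ) = sqQErr P x := by
  unfold sqQErr
  congr 1
  funext w
  exact σ.iInf_comp (g := fun i => (x i - w) ^ 2)

lemma integrable_of_cont {a b : ℝ} {P : Measure ℝ} [IsProbabilityMeasure P]
    (hP : ∀ᵐ w ∂P, w ∈ Set.Ioo a b) {g : ℝ → ℝ} (hg : Continuous g) : Integrable g P := by
  obtain ⟨C, hC⟩ := (isCompact_Icc (a := a) (b := b)).exists_bound_of_continuousOn hg.continuousOn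
  refine Integrable.of_bound hg.aestronglyMeasurable C ?_
  filter_upwards [hP] with w hw
  exact hC w (Set.Ioo_subset_Icc_self hw)

lemma continuousOn_sqQErr {a b : ℝ} {N : ℕ} [NeZero N] {P : Measure ℝ} [IsProbabilityMeasure P]
    (hP : ∀ᵐ w ∂P, w ∈ Set.Ioo a b) :
    ContinuousOn (sqQErr (N := N) P) {x | Monotone x ∧ ∀ i, x i ∈ Set.Icc a b} := by
  unfold sqQErr
  refine continuousOn_of_dominated (bound := fun _ => (b - a) ^ 2) ?_ ?_ ?_ ?_
  · intro x _
    exact (continuous_iInf.comp (Continuous.prodMk_right x)).aestronglyMeasurable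
  · rintro x ⟨-, hx⟩
    filter_upwards [hP] with w hw
    rw [Real.norm_of_nonneg (iInf_nonneg' x w)]
    refine (iInf_le' x w 0).trans ?_
    have := hx 0
    obtain ⟨h1, h2⟩ := this
    obtain ⟨h3, h4⟩ := hw
    nlinarith
  · exact integrable_const _
  · refine Filter.Eventually.of_forall fun w => Continuous.continuousOn ?_
    exact continuous_iInf.comp (Continuous.prodMk_left w)

/-- minimality over all tuples -/
lemma min_all {a b : ℝ} (hab : a < b) {N : ℕ} {P : Measure ℝ} {x : Fin N → ℝ}
    (hmin : ∀ ys ∈ closure (FNplus a b N), sqQErr P x ≤ sqQErr P ys)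
    (z : Fin N → ℝ) (hz : ∀ i, z i ∈ Set.Icc a b) : sqQErr P x ≤ sqQErr P z := by
  rw [← sqQErr_perm P z (Tuple.sort z)]
  apply hmin
  rw [closure_FNplus hab]
  exact ⟨Tuple.monotone_sort z, fun i => hz _⟩

lemma strictMono_of_min {a b : ℝ} (hab : a < b) {N : ℕ} [NeZero N] {P : Measure ℝ}
    [IsProbabilityMeasure P] (hP : ∀ᵐ w ∂P, w ∈ Set.Ioo a b)
    (hop : ∀ U, IsOpen U → (U ∩ Set.Ioo a b).Nonempty → 0 < P U)
    {x : Fin N → ℝ} (hm : Monotone x) (hI : ∀ i, x i ∈ Set.Icc a b)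
    (hmin : ∀ z : Fin N → ℝ, (∀ i, z i ∈ Set.Icc a b) → sqQErr P x ≤ sqQErr P z) :
    StrictMono x := by
  refine hm.strictMono_of_injective ?_
  by_contra hinj
  simp only [Function.Injective, not_forall] at hinj
  obtain ⟨i, j, hij, hne⟩ := hinj
  obtain ⟨c, hc, hcx⟩ := (Set.Ioo_infinite hab).exists_notMem_finite (Set.finite_range x)
  set z := Function.update x j c with hz
  have hzI : ∀ k, z k ∈ Set.Icc a b := by
    intro k
    by_cases h : k = j
    · rw [h, hz, Function.update_self]; exact Set.Ioo_subset_Icc_self hc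
    · rw [hz, Function.update_of_ne h]; exact hI k
  have hle : ∀ w, (⨅ k, (z k - w) ^ 2) ≤ ⨅ k, (x k - w) ^ 2 := by
    intro w
    refine le_ciInf fun k => ?_
    by_cases h : k = j
    · have := iInf_le' z w i
      rw [hz, Function.update_of_ne hne] at this
      rw [h, ← hij]; exact this
    · have := iInf_le' z w k
      rw [hz, Function.update_of_ne h] at this
      exact this
  have cx : Continuous fun w => ⨅ k, (x k - w) ^ 2 :=
    cont_w x
  have cz : Continuous fun w => ⨅ k, (z k - w) ^ 2 :=
    cont_w z
  have ix := integrable_of_cont hP cx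
  have iz := integrable_of_cont hP cz
  have hpos : 0 < ∫ w, ((⨅ k, (x k - w) ^ 2) - (⨅ k, (z k - w) ^ 2)) ∂P := by
    rw [integral_pos_iff_support_of_nonneg (fun w => sub_nonneg.2 (hle w)) (ix.sub iz)]
    apply hop
    · exact (cx.sub cz).isOpen_support
    · refine ⟨c, ?_, hc⟩
      rw [Function.mem_support]
      have h1 := iInf_le' z c j
      rw [hz, Function.update_self, sub_self] at h1
      obtain ⟨k, hk⟩ := iInf_att x c
      have : 0 < (x k - c) ^ 2 := by
        have : x k - c ≠ 0 := fun h => hcx ⟨k, by linarith⟩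
        positivity
      rw [← hz] at h1
      apply ne_of_gt
      rw [hk]; linarith
  rw [integral_sub ix iz] at hpos
  have := hmin z hzI
  unfold sqQErr at this
  linarith

lemma centroid {a b : ℝ} {N : ℕ} [NeZero N] {P : Measure ℝ}
    [IsProbabilityMeasure P] (hP : ∀ᵐ w ∂P, w ∈ Set.Ioo a b)
    (hop : ∀ U, IsOpen U → (U ∩ Set.Ioo a b).Nonempty → 0 < P U)
    {x : Fin N → ℝ} (hm : StrictMono x) (hI : ∀ i, x i ∈ Set.Icc a b) (hab : a < b)
    (hmin : ∀ z : Fin N → ℝ, (∀ i, z i ∈ Set.Icc a b) → sqQErr P x ≤ sqQErr P z) (i : Fin N) :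
    ∫ w in cell x i, (w - x i) ∂P = 0 ∧ x i ∈ Set.Ioo a b := by
  have hmeas : MeasurableSet (cell x i) := (isClosed_cell x i).measurableSet
  have hA : 0 < P.real (cell x i) := by
    refine ENNReal.toReal_pos ?_ (measure_ne_top _ _)
    refine ne_of_gt (lt_of_lt_of_le (hop (interior (cell x i)) isOpen_interior ?_)
      (measure_mono interior_subset))
    have h1 : x i ∈ closure (Set.Ioo a b) := by rw [closure_Ioo hab.ne]; exact hI i
    exact mem_closure_iff.1 h1 _ isOpen_interior (mem_interior_iff_mem_nhds.2 (cell_mem_nhds hm i))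
  set A := P.real (cell x i) with hAdef
  have iid : Integrable (fun w : ℝ => w) P := integrable_of_cont hP continuous_id
  set B := ∫ w in cell x i, w ∂P with hB
  have hlin : ∀ p q : ℝ, ∫ w in cell x i, (p + q * w) ∂P = p * A + q * B := by
    intro p q
    rw [integral_add (integrable_const _) (iid.integrableOn.const_mul q), integral_const_mul,
      setIntegral_const]
    rw [smul_eq_mul, mul_comm]
  have hPc : ∀ᵐ w ∂(P.restrict (cell x i)), w ∈ Set.Ioo a b := ae_restrict_of_ae hP
  have ilin : ∀ p q : ℝ, Integrable (fun w : ℝ => p + q * w) (P.restrict (cell x i)) := by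
    intro p q
    exact (integrable_of_cont hP (by fun_prop)).integrableOn
  have strict : ∀ p q : ℝ, (∀ w ∈ Set.Ioo a b, 0 < p + q * w) → 0 < p * A + q * B := by
    intro p q h
    rw [← hlin]
    have h2 : ∀ᵐ w ∂(P.restrict (cell x i)), 0 < p + q * w := hPc.mono h
    rw [integral_pos_iff_support_of_nonneg_ae (h2.mono fun w h => h.le) (ilin p q)]
    have h3 : (P.restrict (cell x i)) (Function.support fun w => p + q * w)ᶜ = 0 := by
      rw [← mem_ae_iff]
      exact h2.mono fun w h => h.ne'
    have h4 : (P.restrict (cell x i)) (Function.support fun w => p + q * w) =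
        (P.restrict (cell x i)) Set.univ :=
      measure_congr (by
        filter_upwards [h2] with w hw
        apply propext
        exact ⟨fun _ => trivial, fun _ => hw.ne'⟩)
    rw [h4, Measure.restrict_apply_univ]
    exact (ENNReal.toReal_pos_iff.1 hA).1
  have hBa : 0 < -a * A + 1 * B := strict _ _ fun w hw => by linarith [hw.1]
  have hBb : 0 < b * A + (-1) * B := strict _ _ fun w hw => by linarith [hw.2]
  set c := B / A with hc
  have hcA : c * A = B := by rw [hc]; field_simp
  have hca : a < c := by rw [hc, lt_div_iff₀ hA]; linarith
  have hcb : c < b := by rw [hc, div_lt_iff₀ hA]; linarith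
  have key : x i = c := by
    have h1 : sqQErr P x ≤ sqQErr P (Function.update x i c) := by
      apply hmin
      intro k
      by_cases h : k = i
      · rw [h, Function.update_self]; exact ⟨hca.le, hcb.le⟩
      · rw [Function.update_of_ne h]; exact hI k
    have cx : Continuous fun w => ⨅ k, (x k - w) ^ 2 :=
      cont_w x
    have cz : Continuous fun w => ⨅ k, (Function.update x i c k - w) ^ 2 :=
      cont_w _
    have ix := integrable_of_cont hP cx
    have iz := integrable_of_cont hP cz
    have iq : Integrable (fun w : ℝ => (c - w) ^ 2 - (x i - w) ^ 2) P :=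
      integrable_of_cont hP (by fun_prop)
    have h2 := integral_mono iz (ix.add (iq.indicator hmeas)) (fun w => update_le hm i c w)
    simp only [Pi.add_apply] at h2
    rw [integral_add ix (iq.indicator hmeas), integral_indicator hmeas] at h2
    have h3 : ∫ w in cell x i, ((c - w) ^ 2 - (x i - w) ^ 2) ∂P =
        (c ^ 2 - (x i) ^ 2) * A + (2 * x i - 2 * c) * B := by
      rw [← hlin]; congr 1; funext w; ring
    rw [h3, ← hcA] at h2
    unfold sqQErr at h1
    have h4 : 0 ≤ -((x i - c) ^ 2 * A) := by nlinarith
    have h5 : (x i - c) ^ 2 = 0 := by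
      have : 0 ≤ (x i - c) ^ 2 := sq_nonneg _
      by_contra hne
      have : 0 < (x i - c) ^ 2 := lt_of_le_of_ne this (Ne.symm hne)
      have := mul_pos this hA
      linarith
    have := pow_eq_zero_iff (two_ne_zero) |>.1 h5
    linarith
  refine ⟨?_, by rw [key]; exact ⟨hca, hcb⟩⟩
  have := hlin (-x i) 1
  rw [key, neg_mul, hcA] at this
  rw [key]
  have e : ∀ w : ℝ, w - c = -c + 1 * w := fun w => by ring
  simp_rw [e]
  rw [this]; ring

/-- The comparison argument. -/
lemma key {a b : ℝ} {N : ℕ} [NeZero N] {h : ℝ → ℝ}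
    (h0 : ∀ w, 0 ≤ h w) (hpos : ∀ w ∈ Set.Ioo a b, 0 < h w)
    (hz : ∀ w, w ∉ Set.Ioo a b → h w = 0)
    (hlc : ∀ w x t : ℝ, w ≤ x → 0 < t → h w * h (x + t) ≤ h (w + t) * h x)
    {x y : Fin N → ℝ} (hx : StrictMono x) (hy : StrictMono y)
    (hxI : ∀ i, x i ∈ Set.Ioo a b) (hyI : ∀ i, y i ∈ Set.Ioo a b)
    (hix : ∀ i, Integrable ((cell x i).indicator fun w => (w - x i) * h w))
    (hiy : ∀ i, Integrable ((cell y i).indicator fun w => (w - y i) * h w))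
    (hcx : ∀ i, ∫ w, (cell x i).indicator (fun w => (w - x i) * h w) w = 0)
    (hcy : ∀ i, ∫ w, (cell y i).indicator (fun w => (w - y i) * h w) w = 0) :
    ∀ i, y i ≤ x i := by
  by_contra hcon
  push Not at hcon
  obtain ⟨i₀, hi₀⟩ := hcon
  obtain ⟨m, hmmax⟩ := Finite.exists_max (fun i => y i - x i)
  -- minimal index attaining the maximum
  obtain ⟨i, hi1, hi2⟩ : ∃ i, (∀ j, y j - x j ≤ y i - x i) ∧
      ∀ j, j < i → y j - x j < y i - x i := by
    have hne : (Finset.univ.filter fun i => ∀ j, y j - x j ≤ y i - x i).Nonempty :=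
      ⟨m, by simpa using hmmax⟩
    refine ⟨Finset.min' _ hne, ?_, ?_⟩
    · have := Finset.min'_mem _ hne
      simpa using this
    · intro j hj
      by_contra hc
      push Not at hc
      have hmem := Finset.min'_mem _ hne
      rw [Finset.mem_filter] at hmem
      have : j ∈ (Finset.univ.filter fun i => ∀ j, y j - x j ≤ y i - x i) := by
        rw [Finset.mem_filter]
        exact ⟨Finset.mem_univ _, fun k => (hmem.2 k).trans hc⟩
      exact absurd (Finset.min'_le _ _ this) (not_le.2 hj)
  set t := y i - x i with ht
  have htpos : 0 < t := by have := hi1 i₀; linarith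
  have hyi : y i = x i + t := by rw [ht]; ring
  set X := x i with hX
  set φ : ℝ → ℝ := fun w => h X * (cell y i).indicator (fun w => (w - y i) * h w) (w + t) with hφ
  set ψ : ℝ → ℝ := fun w => h (X + t) * (cell x i).indicator (fun w => (w - x i) * h w) w with hψ
  have iφ : Integrable φ := ((hiy i).comp_add_right t).const_mul _
  have iψ : Integrable ψ := (hix i).const_mul _
  have eφ : ∫ w, φ w = 0 := by
    rw [hφ, integral_const_mul, integral_add_right_eq_self, hcy i, mul_zero]
  have eψ : ∫ w, ψ w = 0 := by
    rw [hψ, integral_const_mul, hcx i, mul_zero]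
  have hXpos : 0 < h X := hpos _ (hxI i)
  have hYpos : 0 < h (X + t) := by rw [← hyi]; exact hpos _ (hyI i)
  -- for w < X, cell x ⊆ shifted cell y
  have c1 : ∀ w, w < X → w ∈ cell x i → w + t ∈ cell y i := by
    intro w hw hwc
    refine ⟨fun j hj => ?_, fun j hj => ?_⟩
    · have e1 := hwc.1 j hj
      have e2 := hi1 j
      linarith
    · have := hy hj; linarith
  have c2 : ∀ w, X ≤ w → w + t ∈ cell y i → w ∈ cell x i := by
    intro w hw hwc
    refine ⟨fun j hj => ?_, fun j hj => ?_⟩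
    · have := hx hj; linarith
    · have e1 := hwc.2 j hj
      have e2 := hi1 j
      linarith
  have vφ : ∀ w, w + t ∈ cell y i → φ w = h X * ((w - X) * h (w + t)) := by
    intro w hw
    simp only [hφ]
    rw [Set.indicator_of_mem hw, hyi]; ring
  have vφ' : ∀ w, w + t ∉ cell y i → φ w = 0 := by
    intro w hw
    simp only [hφ]
    rw [Set.indicator_of_notMem hw, mul_zero]
  have vψ : ∀ w, w ∈ cell x i → ψ w = h (X + t) * ((w - X) * h w) := by
    intro w hw
    simp only [hψ]
    rw [Set.indicator_of_mem hw]
  have vψ' : ∀ w, w ∉ cell x i → ψ w = 0 := by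
    intro w hw
    simp only [hψ]
    rw [Set.indicator_of_notMem hw, mul_zero]
  have hle : ∀ w, φ w ≤ ψ w := by
    intro w
    rcases lt_or_ge w X with hw | hw
    · by_cases hc : w ∈ cell x i
      · rw [vφ w (c1 w hw hc), vψ w hc]
        have := hlc w X t hw.le htpos
        nlinarith
      · rw [vψ' w hc]
        by_cases hc' : w + t ∈ cell y i
        · rw [vφ w hc']
          have := mul_nonneg hXpos.le (mul_nonneg (sub_nonneg.2 hw.le) (h0 (w + t)))
          nlinarith
        · rw [vφ' w hc']
    · by_cases hc : w + t ∈ cell y i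
      · rw [vφ w hc, vψ w (c2 w hw hc)]
        have := hlc X w t hw htpos
        nlinarith
      · rw [vφ' w hc]
        by_cases hc' : w ∈ cell x i
        · rw [vψ w hc']
          exact mul_nonneg hYpos.le (mul_nonneg (sub_nonneg.2 hw) (h0 w))
        · rw [vψ' w hc']
  -- a nonempty interval on which the inequality is strict
  obtain ⟨p, q, hpq, hstrict⟩ : ∃ p q, p < q ∧ ∀ w ∈ Set.Ioo p q, φ w < ψ w := by
    have neg : ∀ w, w < X → w + t ∈ cell y i → w + t ∈ Set.Ioo a b → φ w < 0 := by
      intro w hw hc hI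
      rw [vφ w hc]
      have := mul_pos hXpos (mul_pos (sub_pos.2 hw) (hpos _ hI))
      nlinarith
    by_cases hi0 : i.val = 0
    · refine ⟨a - t, min a X, ?_, ?_⟩
      · rw [lt_min_iff]; have := (hxI i).1; constructor <;> linarith
      · rintro w ⟨hw1, hw2⟩
        rw [lt_min_iff] at hw2
        have : ψ w = 0 := by
          by_cases hc : w ∈ cell x i
          · rw [vψ w hc, hz w (fun h => absurd h.1 (not_lt.2 hw2.1.le))]; ring
          · exact vψ' w hc
        rw [this]
        refine neg w hw2.2 ⟨fun j hj => ?_, fun j hj => ?_⟩ ⟨by linarith, ?_⟩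
        · exact absurd hj (by rw [Fin.lt_def]; omega)
        · have := hy hj; linarith
        · have := (hyI i).2; linarith [hw2.2]
    · set k : Fin N := ⟨i.val - 1, by omega⟩ with hk
      have hki : k < i := by rw [Fin.lt_def]; simp only [hk]; omega
      have hjk : ∀ j, j < i → j ≤ k := by
        intro j hj; rw [Fin.lt_def] at hj; rw [Fin.le_def]; simp only [hk]; omega
      have e1 := hi2 k hki
      have e2 := hy hki
      have e3 := hx hki
      refine ⟨(y k + y i) / 2 - t, (x k + X) / 2, by linarith, ?_⟩
      rintro w ⟨hw1, hw2⟩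
      have hwX : w < X := by linarith
      rw [vψ' w (fun h => absurd (h.1 k hki) (not_le.2 hw2))]
      refine neg w hwX ⟨fun j hj => ?_, fun j hj => ?_⟩ ⟨?_, ?_⟩
      · have := hy.monotone (hjk j hj); linarith
      · have := hy hj; linarith
      · have := (hyI k).1; have := (hyI i).1; linarith
      · have := (hyI i).2; linarith
  have hint : ∫ w, (ψ w - φ w) = 0 := by rw [integral_sub iψ iφ, eφ, eψ, sub_zero]
  have hgt : 0 < ∫ w, (ψ w - φ w) := by
    rw [integral_pos_iff_support_of_nonneg (fun w => sub_nonneg.2 (hle w)) (iψ.sub iφ)]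
    refine lt_of_lt_of_le ?_ (measure_mono (s := Set.Ioo p q) ?_)
    · rw [Real.volume_Ioo]; simpa using hpq
    · intro w hw
      exact ne_of_gt (sub_pos.2 (hstrict w hw))
  linarith

lemma logconc {a b : ℝ} {f : ℝ → ℝ} (hf0 : ∀ x, 0 ≤ f x) (hpos : ∀ x ∈ Set.Ioo a b, 0 < f x)
    (hc : ConcaveOn ℝ (Set.Ioo a b) (fun x => Real.log (f x)))
    (w x t : ℝ) (hwx : w ≤ x) (ht : 0 < t) :
    (Set.Ioo a b).indicator f w * (Set.Ioo a b).indicator f (x + t) ≤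
      (Set.Ioo a b).indicator f (w + t) * (Set.Ioo a b).indicator f x := by
  have hn : ∀ z, 0 ≤ (Set.Ioo a b).indicator f z := Set.indicator_nonneg fun z _ => hf0 z
  by_cases hw : w ∈ Set.Ioo a b
  swap
  · rw [Set.indicator_of_notMem hw, zero_mul]; exact mul_nonneg (hn _) (hn _)
  by_cases hxt : x + t ∈ Set.Ioo a b
  swap
  · rw [Set.indicator_of_notMem hxt, mul_zero]; exact mul_nonneg (hn _) (hn _)
  have hx : x ∈ Set.Ioo a b := ⟨by linarith [hw.1], by linarith [hxt.2]⟩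
  have hwt : w + t ∈ Set.Ioo a b := ⟨by linarith [hw.1], by linarith [hxt.2]⟩
  rw [Set.indicator_of_mem hw, Set.indicator_of_mem hx, Set.indicator_of_mem hxt,
    Set.indicator_of_mem hwt]
  have hd : 0 < x + t - w := by linarith
  set α := t / (x + t - w) with hα
  set β := (x - w) / (x + t - w) with hβ
  have hα0 : 0 ≤ α := by positivity
  have hβ0 : 0 ≤ β := div_nonneg (by linarith) hd.le
  have hs : α + β = 1 := by rw [hα, hβ]; field_simp; ring
  have e1 := hc.2 hw hxt hα0 hβ0 hs
  have e2 := hc.2 hw hxt hβ0 hα0 (by linarith)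
  simp only [smul_eq_mul] at e1 e2
  have p1 : α * w + β * (x + t) = x := by rw [hα, hβ]; field_simp; ring
  have p2 : β * w + α * (x + t) = w + t := by rw [hα, hβ]; field_simp; ring
  rw [p1] at e1
  rw [p2] at e2
  have hsum : Real.log (f w) + Real.log (f (x + t)) ≤ Real.log (f (w + t)) + Real.log (f x) := by
    have hb : β = 1 - α := by linarith
    rw [hb] at e1 e2
    linarith
  rw [← Real.log_mul (hpos _ hw).ne' (hpos _ hxt).ne',
    ← Real.log_mul (hpos _ hwt).ne' (hpos _ hx).ne'] at hsum
  exact (Real.log_le_log_iff (mul_pos (hpos _ hw) (hpos _ hxt))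
    (mul_pos (hpos _ hwt) (hpos _ hx))).1 hsum

end QG

/-- if `P` has a density `f` supported on `[a,b]`, positive on `(a,b)`, with
`log f` strictly concave, or `log f` concave and `f(a+) − f(b−) > 0`, then for every `N ≥ 1`
the squared `L₂`-quantization-error function admits a unique minimizer over the closure
of `F_N^+`. -/
theorem unique_optimal_grid_of_logconcave (a b : ℝ) (hab : a < b)
    (P : Measure ℝ) [IsProbabilityMeasure P]
    (f : ℝ → ℝ) (hfm : Measurable f) (hf0 : ∀ x, 0 ≤ f x)
    (hsupp : ∀ x, x ∉ Set.Icc a b → f x = 0)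
    (hdens : P = volume.withDensity fun x => ENNReal.ofReal (f x))
    (hpos : ∀ x ∈ Set.Ioo a b, 0 < f x)
    (hconc : StrictConcaveOn ℝ (Set.Ioo a b) (fun x => Real.log (f x)) ∨
      (ConcaveOn ℝ (Set.Ioo a b) (fun x => Real.log (f x)) ∧
        ∃ fa fb : ℝ, Tendsto f (nhdsWithin a (Set.Ioi a)) (nhds fa) ∧
          Tendsto f (nhdsWithin b (Set.Iio b)) (nhds fb) ∧ fb < fa))
    (N : ℕ) (hN : 1 ≤ N) :
    ∃! xs : Fin N → ℝ, xs ∈ closure (FNplus a b N) ∧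
      ∀ ys ∈ closure (FNplus a b N), sqQErr P xs ≤ sqQErr P ys := by
  classical
  have : NeZero N := ⟨by omega⟩
  have hcc : ConcaveOn ℝ (Set.Ioo a b) (fun x => Real.log (f x)) := by
    rcases hconc with h | h
    · exact h.concaveOn
    · exact h.1
  set h : ℝ → ℝ := (Set.Ioo a b).indicator f with hh
  have hm : Measurable h := hfm.indicator measurableSet_Ioo
  have h0 : ∀ w, 0 ≤ h w := Set.indicator_nonneg fun z _ => hf0 z
  have hp : ∀ w ∈ Set.Ioo a b, 0 < h w := fun w hw => by
    rw [hh, Set.indicator_of_mem hw]; exact hpos w hw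
  have hz : ∀ w, w ∉ Set.Ioo a b → h w = 0 := fun w hw => Set.indicator_of_notMem hw f
  have hae : ∀ᵐ w : ℝ, h w = f w := by
    have e1 : ∀ᵐ w : ℝ, w ≠ a := by simp [ae_iff]
    have e2 : ∀ᵐ w : ℝ, w ≠ b := by simp [ae_iff]
    filter_upwards [e1, e2] with w h1 h2
    by_cases hw : w ∈ Set.Ioo a b
    · exact Set.indicator_of_mem hw f
    · rw [hz w hw, hsupp w]
      intro hc
      exact hw ⟨lt_of_le_of_ne hc.1 (Ne.symm h1), lt_of_le_of_ne hc.2 h2⟩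
  have hd : P = volume.withDensity fun x => ENNReal.ofReal (h x) := by
    rw [hdens]
    refine withDensity_congr_ae ?_
    filter_upwards [hae] with w hw
    rw [hw]
  have hmo : Measurable fun x => ENNReal.ofReal (h x) := hm.ennreal_ofReal
  have hP : ∀ᵐ w ∂P, w ∈ Set.Ioo a b := by
    rw [hd, ae_withDensity_iff hmo]
    refine Filter.Eventually.of_forall fun w hw => ?_
    by_contra hc
    exact hw (by rw [hz w hc, ENNReal.ofReal_zero])
  have hop : ∀ U, IsOpen U → (U ∩ Set.Ioo a b).Nonempty → 0 < P U := by
    intro U hU hne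
    rw [pos_iff_ne_zero]
    intro hc
    rw [hd, withDensity_apply_eq_zero hmo] at hc
    have : volume (U ∩ Set.Ioo a b) = 0 := by
      refine measure_mono_null ?_ hc
      rintro w ⟨h1, h2⟩
      refine ⟨?_, h1⟩
      simpa using hp w h2
    exact (((hU.inter isOpen_Ioo).measure_pos volume hne).ne') this
  have hconv : ∀ g : ℝ → ℝ, ∫ w, g w ∂P = ∫ w, h w * g w := by
    intro g
    rw [hd, integral_withDensity_eq_integral_toReal_smul hmo (by simp)]
    congr 1
    funext w
    rw [ENNReal.toReal_ofReal (h0 w), smul_eq_mul]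
  have hconvI : ∀ g : ℝ → ℝ, Integrable g P → Integrable fun w => h w * g w := by
    intro g hg
    rw [hd, integrable_withDensity_iff hmo (by simp)] at hg
    refine hg.congr (Filter.Eventually.of_forall fun w => ?_)
    simp only [ENNReal.toReal_ofReal (h0 w)]
    ring
  -- existence
  have hcl := QG.closure_FNplus hab N
  have hcomp : IsCompact (closure (FNplus a b N)) := by
    refine IsCompact.of_isClosed_subset (isCompact_univ_pi fun _ : Fin N => isCompact_Icc (a := a) (b := b))
      isClosed_closure ?_
    rw [hcl]
    rintro x ⟨-, hx⟩ i -
    exact hx i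
  have hne : (closure (FNplus a b N)).Nonempty := by
    rw [hcl]
    exact ⟨fun _ => a, fun _ _ _ => le_refl _, fun _ => ⟨le_refl _, hab.le⟩⟩
  obtain ⟨x, hx, hxmin⟩ := hcomp.exists_isMinOn hne
    (by rw [hcl]; exact QG.continuousOn_sqQErr hP)
  -- facts about minimizers
  have facts : ∀ z : Fin N → ℝ, z ∈ closure (FNplus a b N) →
      (∀ ys ∈ closure (FNplus a b N), sqQErr P z ≤ sqQErr P ys) →
      StrictMono z ∧ (∀ i, z i ∈ Set.Ioo a b) ∧
      (∀ i, Integrable ((QG.cell z i).indicator fun w => (w - z i) * h w)) ∧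
      (∀ i, ∫ w, (QG.cell z i).indicator (fun w => (w - z i) * h w) w = 0) := by
    intro z hzc hzmin
    have hzc' := hzc
    rw [hcl] at hzc'
    have hall := QG.min_all hab hzmin
    have hs := QG.strictMono_of_min hab hP hop hzc'.1 hzc'.2 hall
    have hcen := QG.centroid hP hop hs hzc'.2 hab hall
    have heq : ∀ i, ((QG.cell z i).indicator fun w => (w - z i) * h w) =
        fun w => h w * (QG.cell z i).indicator (fun w => w - z i) w := by
      intro i
      funext w
      by_cases hw : w ∈ QG.cell z i
      · rw [Set.indicator_of_mem hw, Set.indicator_of_mem hw]; ring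
      · rw [Set.indicator_of_notMem hw, Set.indicator_of_notMem hw]; ring
    refine ⟨hs, fun i => (hcen i).2, fun i => ?_, fun i => ?_⟩
    · rw [heq]
      apply hconvI
      exact (QG.integrable_of_cont hP (by fun_prop)).indicator (QG.isClosed_cell z i).measurableSet
    · rw [heq, ← hconv, integral_indicator (QG.isClosed_cell z i).measurableSet]
      exact (hcen i).1
  have hlc : ∀ w x t : ℝ, w ≤ x → 0 < t → h w * h (x + t) ≤ h (w + t) * h x :=
    fun w x t => QG.logconc hf0 hpos hcc w x t
  have hxm : ∀ ys ∈ closure (FNplus a b N), sqQErr P x ≤ sqQErr P ys :=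
    fun ys hys => isMinOn_iff.1 hxmin ys hys
  refine ⟨x, ⟨hx, hxm⟩, ?_⟩
  rintro y ⟨hy, hym⟩
  obtain ⟨x1, x2, x3, x4⟩ := facts x hx hxm
  obtain ⟨y1, y2, y3, y4⟩ := facts y hy hym
  funext i
  exact le_antisymm (QG.key h0 hp hz hlc x1 y1 x2 y2 x3 y3 x4 y4 i)
    (QG.key h0 hp hz hlc y1 x1 y2 x2 y3 x3 y4 x4 i)
end

section
/- Let P be the uniform distribution on the compact interval [a,b] with a < b, and let N ≥ 1. Then the grid x* = (x*₁,…,x*_N) with x*_k = a + (2k−1)(b−a)/(2N) for k = 1,…,N is the unique minimizer over the closure of F_N^+ = { (x₁,…,x_N) : a < x₁ < ⋯ < x_N < b } of the squared L₂-quantization-error function x ↦ D_N(x) = ∫_{[a,b]} min_{1≤i≤N} |x_i − w|² dP(w). -/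
open MeasureTheory Filter

/-- The uniform distribution on `[a,b]`. -/
noncomputable def unifIcc (a b : ℝ) : Measure ℝ :=
  (ENNReal.ofReal (b - a))⁻¹ • volume.restrict (Set.Icc a b)

noncomputable def psiQ (h u : ℝ) : ℝ := max (h ^ 2 - u ^ 2) 0

lemma psiQ_cont (h : ℝ) : Continuous (psiQ h) := by
  unfold psiQ; fun_prop

lemma psiQ_nonneg (h u : ℝ) : 0 ≤ psiQ h u := le_max_right _ _

lemma psiQ_ge (h u : ℝ) : h ^ 2 - u ^ 2 ≤ psiQ h u := le_max_left _ _

lemma psiQ_int_zero (h c d : ℝ) (hcd : c ≤ d) (hz : ∀ u ∈ Set.Icc c d, h ^ 2 ≤ u ^ 2) :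
    ∫ u in c..d, psiQ h u = 0 := by
  rw [intervalIntegral.integral_congr (g := fun _ => (0 : ℝ))]
  · simp
  · intro u hu
    rw [Set.uIcc_of_le hcd] at hu
    have := hz u hu
    simp [psiQ, this]

lemma psiQ_int_mid (h c : ℝ) (hc : -h ≤ c) (hc' : c ≤ h) :
    ∫ u in c..h, psiQ h u = h ^ 2 * (h - c) - (h ^ 3 - c ^ 3) / 3 := by
  rw [intervalIntegral.integral_congr (g := fun u => h ^ 2 - u ^ 2)]
  · rw [intervalIntegral.integral_sub (by simp) ((continuous_pow 2).intervalIntegrable _ _)]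
    simp only [intervalIntegral.integral_const, integral_pow, smul_eq_mul]
    norm_num
    ring
  · intro u hu
    rw [Set.uIcc_of_le hc'] at hu
    have : u ^ 2 ≤ h ^ 2 := by nlinarith [hu.1, hu.2]
    simp [psiQ, this]

lemma psiQ_int_le (h c d : ℝ) (hh : 0 < h) (hc : c ≤ 0) (hcd : c ≤ d) :
    ∫ u in c..d, psiQ h u ≤
      h ^ 2 * (h - max c (-h)) - (h ^ 3 - (max c (-h)) ^ 3) / 3 := by
  have hi : ∀ p q, IntervalIntegrable (psiQ h) volume p q :=
    fun p q => (psiQ_cont h).intervalIntegrable p q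
  have h1 : ∫ u in c..d, psiQ h u ≤ ∫ u in c..(max d h), psiQ h u :=
    intervalIntegral.integral_mono_interval le_rfl hcd (le_max_left _ _)
      (Eventually.of_forall fun u => psiQ_nonneg h u) (hi _ _)
  have h2 : ∫ u in c..(max c (-h)), psiQ h u = 0 := by
    rcases le_total c (-h) with hx | hx
    · rw [max_eq_right hx]
      apply psiQ_int_zero _ _ _ hx
      intro u hu
      nlinarith [hu.2]
    · rw [max_eq_left hx]
      simp
  have h3 : ∫ u in h..(max d h), psiQ h u = 0 := by
    apply psiQ_int_zero _ _ _ (le_max_right _ _)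
    intro u hu
    nlinarith [hu.1]
  have h4 := psiQ_int_mid h (max c (-h)) (le_max_right _ _) (max_le (by linarith) (by linarith))
  rw [← intervalIntegral.integral_add_adjacent_intervals (hi c (max c (-h))) (hi _ (max d h)),
    ← intervalIntegral.integral_add_adjacent_intervals (hi (max c (-h)) h) (hi _ (max d h)),
    h2, h3, h4] at h1
  linarith

lemma psiQ_bd (h c d : ℝ) (hh : 0 < h) (hc : c ≤ 0) (hd : 0 ≤ d) :
    ∫ u in c..d, psiQ h u ≤ 4 * h ^ 3 / 3 ∧
    (∫ u in c..d, psiQ h u = 4 * h ^ 3 / 3 → c ≤ -h) := by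
  have h1 := psiQ_int_le h c d hh hc (hc.trans hd)
  rcases le_or_gt c (-h) with hx | hx
  · rw [max_eq_right hx] at h1
    exact ⟨by nlinarith, fun _ => hx⟩
  · rw [max_eq_left hx.le] at h1
    have h2 : 0 < (c + h) ^ 2 * (2 * h - c) := by
      have : 0 < c + h := by linarith
      have : 0 < 2 * h - c := by linarith
      positivity
    exact ⟨by nlinarith, fun _ => by nlinarith⟩

lemma psiQ_bd_right (h c d : ℝ) (hh : 0 < h) (hc : c ≤ 0) (hd : 0 ≤ d)
    (he : ∫ u in c..d, psiQ h u = 4 * h ^ 3 / 3) : h ≤ d := by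
  have h1 : ∫ u in (-d)..(-c), psiQ h u = ∫ u in c..d, psiQ h u := by
    rw [← intervalIntegral.integral_comp_neg]
    simp [psiQ]
  have := (psiQ_bd h (-d) (-c) hh (by linarith) (by linarith)).2 (h1.trans he)
  linarith

lemma inf_cont {N : ℕ} [NeZero N] (x : Fin N → ℝ) : Continuous fun w => ⨅ i, (x i - w) ^ 2 := by
  simp_rw [← Finset.inf'_univ_eq_ciInf]
  apply Continuous.finset_inf'_apply
  intro i _
  fun_prop

lemma inf_le' {N : ℕ} (x : Fin N → ℝ) (w : ℝ) (i : Fin N) : ⨅ i, (x i - w) ^ 2 ≤ (x i - w) ^ 2 :=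
  ciInf_le (Set.finite_range _).bddBelow i

noncomputable def gQ {N : ℕ} (h : ℝ) (x : Fin N → ℝ) (w : ℝ) : ℝ :=
  (⨅ i, (x i - w) ^ 2) - h ^ 2 + ∑ i, psiQ h (w - x i)

lemma gQ_cont {N : ℕ} [NeZero N] (h : ℝ) (x : Fin N → ℝ) : Continuous (gQ h x) := by
  unfold gQ
  have := inf_cont x
  have h2 := psiQ_cont h
  fun_prop

lemma gQ_nonneg {N : ℕ} [NeZero N] (h : ℝ) (x : Fin N → ℝ) (w : ℝ) : 0 ≤ gQ h x w := by
  obtain ⟨k, hk⟩ := exists_eq_ciInf_of_finite (f := fun i => (x i - w) ^ 2)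
  unfold gQ
  rw [← hk]
  have h1 := Finset.single_le_sum (f := fun i => psiQ h (w - x i))
    (fun i _ => psiQ_nonneg h _) (Finset.mem_univ k)
  have h2 := psiQ_ge h (w - x k)
  nlinarith

lemma gQ_ge {N : ℕ} [NeZero N] (h : ℝ) (x : Fin N → ℝ) (w : ℝ) (i j : Fin N) (hij : i ≠ j) :
    min (psiQ h (w - x i)) (psiQ h (w - x j)) ≤ gQ h x w := by
  obtain ⟨k, hk⟩ := exists_eq_ciInf_of_finite (f := fun i => (x i - w) ^ 2)
  have key : ∀ l, l ≠ k → psiQ h (w - x l) ≤ gQ h x w := by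
    intro l hl
    unfold gQ
    rw [← hk, ← Finset.add_sum_erase _ _ (Finset.mem_univ k)]
    have h1 := Finset.single_le_sum (f := fun i => psiQ h (w - x i))
      (s := Finset.univ.erase k) (fun i _ => psiQ_nonneg h _) (by simpa using hl : l ∈ _)
    have h2 := psiQ_ge h (w - x k)
    nlinarith
  by_cases hi : i = k
  · exact (min_le_right _ _).trans (key j (fun hj => hij (hi.trans hj.symm)))
  · exact (min_le_left _ _).trans (key i hi)

lemma gQ_int {N : ℕ} [NeZero N] (h a b : ℝ) (x : Fin N → ℝ) :
    ∫ w in a..b, gQ h x w = (∫ w in a..b, ⨅ i, (x i - w) ^ 2) - (b - a) * h ^ 2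
      + ∑ i, ∫ u in (a - x i)..(b - x i), psiQ h u := by
  unfold gQ
  have h1 := inf_cont x
  have h2 := psiQ_cont h
  rw [intervalIntegral.integral_add, intervalIntegral.integral_sub,
    intervalIntegral.integral_finsetSum]
  · simp
  · intro i _
    exact Continuous.intervalIntegrable (by fun_prop) _ _
  all_goals exact Continuous.intervalIntegrable (by fun_prop) _ _

lemma lowerQ {N : ℕ} [NeZero N] (h a b : ℝ) (hh : 0 < h) (hL : b - a = 2 * N * h)
    (x : Fin N → ℝ) (hx : ∀ i, x i ∈ Set.Icc a b) :
    2 * N * h ^ 3 / 3 ≤ ∫ w in a..b, ⨅ i, (x i - w) ^ 2 := by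
  have hab : a ≤ b := (hx 0).1.trans (hx 0).2
  have h1 : 0 ≤ ∫ w in a..b, gQ h x w :=
    intervalIntegral.integral_nonneg hab fun u _ => gQ_nonneg h x u
  rw [gQ_int] at h1
  have h2 : ∑ i, ∫ u in (a - x i)..(b - x i), psiQ h u ≤ ∑ i : Fin N, 4 * h ^ 3 / 3 :=
    Finset.sum_le_sum fun i _ =>
      (psiQ_bd h _ _ hh (by linarith [(hx i).1]) (by linarith [(hx i).2])).1
  simp only [Finset.sum_const, Finset.card_univ, Fintype.card_fin, nsmul_eq_mul] at h2
  rw [hL] at h1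
  nlinarith

lemma eqQ {N : ℕ} [NeZero N] (h a b : ℝ) (hh : 0 < h) (hL : b - a = 2 * N * h)
    (x : Fin N → ℝ) (hx : ∀ i, x i ∈ Set.Icc a b)
    (hle : ∫ w in a..b, ⨅ i, (x i - w) ^ 2 ≤ 2 * N * h ^ 3 / 3) :
    (∀ i, a + h ≤ x i ∧ x i ≤ b - h) ∧ ∀ i j, i ≠ j → x i ≤ x j → x i + 2 * h ≤ x j := by
  have hN : (0 : ℝ) < N := by exact_mod_cast Nat.pos_of_ne_zero (NeZero.ne N)
  have hab : a < b := by have : 0 < 2 * N * h := by positivity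
                         linarith
  have h1 : 0 ≤ ∫ w in a..b, gQ h x w :=
    intervalIntegral.integral_nonneg hab.le fun u _ => gQ_nonneg h x u
  have hG := gQ_int h a b x
  have hS : ∀ i ∈ Finset.univ, ∫ u in (a - x i)..(b - x i), psiQ h u ≤ 4 * h ^ 3 / 3 := fun i _ =>
      (psiQ_bd h _ _ hh (by linarith [(hx i).1]) (by linarith [(hx i).2])).1
  have h2 := Finset.sum_le_sum hS
  have h3 := Finset.sum_eq_sum_iff_of_le hS
  simp only [Finset.sum_const, Finset.card_univ, Fintype.card_fin, nsmul_eq_mul] at h2 h3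
  rw [hL] at hG
  have h4 := h3.1 (by nlinarith)
  have hG0 : ∫ w in a..b, gQ h x w ≤ 0 := by nlinarith
  constructor
  · intro i
    have h5 := h4 i (Finset.mem_univ i)
    have h6 := (psiQ_bd h (a - x i) (b - x i) hh
      (by linarith [(hx i).1]) (by linarith [(hx i).2])).2 h5
    have h7 := psiQ_bd_right h (a - x i) (b - x i) hh
      (by linarith [(hx i).1]) (by linarith [(hx i).2]) h5
    constructor <;> linarith
  · intro i j hij hle'
    by_contra hcon
    push Not at hcon
    have hpos : 0 < gQ h x ((x i + x j) / 2) := by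
      refine lt_of_lt_of_le ?_ (gQ_ge h x _ i j hij)
      apply lt_min
      · refine lt_of_lt_of_le ?_ (psiQ_ge _ _)
        nlinarith
      · refine lt_of_lt_of_le ?_ (psiQ_ge _ _)
        nlinarith
    have := intervalIntegral.integral_pos hab (gQ_cont h x).continuousOn
      (fun u _ => gQ_nonneg h x u)
      ⟨(x i + x j) / 2, ⟨by linarith [(hx i).1, (hx j).1], by linarith [(hx i).2, (hx j).2]⟩, hpos⟩
    linarith

lemma upperQ {N : ℕ} [NeZero N] (h a b : ℝ) (hh : 0 < h) (hL : b - a = 2 * N * h)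
    (x : Fin N → ℝ) (hx : ∀ k : Fin N, x k = a + (2 * (k : ℕ) + 1) * h) :
    ∫ w in a..b, ⨅ i, (x i - w) ^ 2 ≤ 2 * N * h ^ 3 / 3 := by
  have hc := inf_cont x
  have h1 := intervalIntegral.sum_integral_adjacent_intervals (μ := volume)
    (f := fun w => ⨅ i, (x i - w) ^ 2) (a := fun k : ℕ => a + 2 * k * h) (n := N)
    (fun k _ => hc.intervalIntegrable _ _)
  have e0 : a + 2 * ((0 : ℕ) : ℝ) * h = a := by simp
  have e1 : a + 2 * (N : ℝ) * h = b := by linarith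
  simp only [e0, e1] at h1
  rw [← h1]
  have h2 : ∀ k ∈ Finset.range N,
      ∫ w in (a + 2 * (k : ℝ) * h)..(a + 2 * ((k + 1 : ℕ) : ℝ) * h), (⨅ i, (x i - w) ^ 2)
        ≤ 2 * h ^ 3 / 3 := by
    intro k hk
    have hk' := Finset.mem_range.1 hk
    have hxk := hx ⟨k, hk'⟩
    simp only at hxk
    have : ∫ w in (a + 2 * (k : ℝ) * h)..(a + 2 * ((k + 1 : ℕ) : ℝ) * h), (⨅ i, (x i - w) ^ 2)
        ≤ ∫ w in (a + 2 * (k : ℝ) * h)..(a + 2 * ((k + 1 : ℕ) : ℝ) * h), (x ⟨k, hk'⟩ - w) ^ 2 := by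
      apply intervalIntegral.integral_mono_on
      · push_cast; nlinarith
      · exact hc.intervalIntegrable _ _
      · exact Continuous.intervalIntegrable (by fun_prop) _ _
      · intro w _
        exact inf_le' x w _
    refine this.trans (le_of_eq ?_)
    rw [intervalIntegral.integral_comp_sub_left (fun u => u ^ 2), integral_pow, hxk]
    push_cast
    ring
  refine (Finset.sum_le_sum h2).trans (le_of_eq ?_)
  simp
  ring

lemma sqQErr_unif {N : ℕ} (a b : ℝ) (hab : a < b) (x : Fin N → ℝ) :
    sqQErr (unifIcc a b) x = (b - a)⁻¹ * ∫ w in a..b, ⨅ i, (x i - w) ^ 2 := by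
  unfold sqQErr unifIcc
  rw [integral_smul_measure, intervalIntegral.integral_of_le hab.le, integral_Icc_eq_integral_Ioc,
    ENNReal.toReal_inv, ENNReal.toReal_ofReal (by linarith), smul_eq_mul]

lemma clos_sub (a b : ℝ) (N : ℕ) (x : Fin N → ℝ) (hx : x ∈ closure (FNplus a b N)) :
    Monotone x ∧ ∀ i, x i ∈ Set.Icc a b := by
  have hcl : IsClosed {x : Fin N → ℝ | Monotone x ∧ ∀ i, x i ∈ Set.Icc a b} := by
    have : {x : Fin N → ℝ | Monotone x ∧ ∀ i, x i ∈ Set.Icc a b} =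
      (⋂ i, ⋂ j, ⋂ (_ : i ≤ j), {x : Fin N → ℝ | x i ≤ x j}) ∩ ⋂ i, {x | x i ∈ Set.Icc a b} := by
      ext y
      simp [Monotone]
    rw [this]
    apply IsClosed.inter
    · exact isClosed_iInter fun i => isClosed_iInter fun j => isClosed_iInter fun _ =>
        isClosed_le (continuous_apply i) (continuous_apply j)
    · exact isClosed_iInter fun i => isClosed_Icc.preimage (continuous_apply i)
  exact closure_minimal (fun y (hy : y ∈ FNplus a b N) =>
    (⟨hy.1.monotone, fun i => ⟨(hy.2 i).1.le, (hy.2 i).2.le⟩⟩ :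
      Monotone y ∧ ∀ i, y i ∈ Set.Icc a b)) hcl hx

/-- for the uniform distribution on `[a,b]`, the grid
`x*_k = a + (2k−1)(b−a)/(2N)`, `k = 1,…,N`, is the unique minimizer of the squared
`L₂`-quantization-error function over the closure of `F_N^+`. -/
theorem unique_optimal_grid_uniform (a b : ℝ) (hab : a < b) (N : ℕ) (hN : 1 ≤ N)
    (xstar : Fin N → ℝ)
    (hxstar : ∀ k : Fin N, xstar k = a + (2 * (k : ℕ) + 1) * (b - a) / (2 * N)) :
    (xstar ∈ closure (FNplus a b N) ∧
      ∀ ys ∈ closure (FNplus a b N), sqQErr (unifIcc a b) xstar ≤ sqQErr (unifIcc a b) ys) ∧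
    ∀ ys ∈ closure (FNplus a b N),
      (∀ zs ∈ closure (FNplus a b N), sqQErr (unifIcc a b) ys ≤ sqQErr (unifIcc a b) zs) →
        ys = xstar := by
  haveI : NeZero N := ⟨by omega⟩
  have hN0 : (0 : ℝ) < N := by exact_mod_cast hN
  obtain ⟨h, hh⟩ : ∃ h, h = (b - a) / (2 * N) := ⟨_, rfl⟩
  have hpos : 0 < h := by rw [hh]; apply div_pos <;> linarith
  have hL : b - a = 2 * N * h := by rw [hh]; field_simp
  have hx : ∀ k : Fin N, xstar k = a + (2 * (k : ℕ) + 1) * h := by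
    intro k; rw [hxstar, hh]; ring
  have hmem : xstar ∈ closure (FNplus a b N) := by
    apply subset_closure
    refine ⟨fun i j hij => ?_, fun i => ⟨?_, ?_⟩⟩
    · rw [hx, hx]
      have : ((i : ℕ) : ℝ) < (j : ℕ) := by exact_mod_cast hij
      nlinarith
    · rw [hx]
      have : 0 < (2 * ((i : ℕ) : ℝ) + 1) * h := by positivity
      linarith
    · rw [hx]
      have : ((i : ℕ) : ℝ) + 1 ≤ N := by exact_mod_cast i.2
      nlinarith
  have hinv : 0 < (b - a)⁻¹ := inv_pos.2 (by linarith)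
  have hup := upperQ h a b hpos hL xstar hx
  refine ⟨⟨hmem, fun ys hys => ?_⟩, fun ys hys hmin => ?_⟩
  · rw [sqQErr_unif a b hab, sqQErr_unif a b hab]
    exact mul_le_mul_of_nonneg_left
      (hup.trans (lowerQ h a b hpos hL ys (clos_sub a b N ys hys).2)) hinv.le
  · have h1 := hmin xstar hmem
    rw [sqQErr_unif a b hab, sqQErr_unif a b hab] at h1
    obtain ⟨hmono, hI⟩ := clos_sub a b N ys hys
    obtain ⟨hbd, hsp⟩ := eqQ h a b hpos hL ys hI ((le_of_mul_le_mul_left h1 hinv).trans hup)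
    have hlow : ∀ n (hn : n < N), a + (2 * (n : ℝ) + 1) * h ≤ ys ⟨n, hn⟩ := by
      intro n
      induction n with
      | zero => intro hn; have := (hbd ⟨0, hn⟩).1; push_cast; linarith
      | succ n ih =>
        intro hn
        have h2 := ih (by omega)
        have h3 := hsp ⟨n, by omega⟩ ⟨n + 1, hn⟩ (by simp) (hmono (by simp))
        push_cast
        linarith
    have hhigh : ∀ m n (hn : n < N), n + m + 1 = N → ys ⟨n, hn⟩ ≤ b - (2 * (m : ℝ) + 1) * h := by
      intro m
      induction m with
      | zero => intro n hn _; have := (hbd ⟨n, hn⟩).2; push_cast; linarith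
      | succ m ih =>
        intro n hn he
        have h2 := ih (n + 1) (by omega) (by omega)
        have h3 := hsp ⟨n, hn⟩ ⟨n + 1, by omega⟩ (by simp) (hmono (by simp))
        push_cast
        linarith
    funext k
    have h2 := hlow k k.2
    have h3 := hhigh (N - 1 - k) k k.2 (by omega)
    have h4 : (((N - 1 - (k : ℕ) : ℕ)) : ℝ) = N - 1 - (k : ℕ) := by
      have : (k : ℕ) + (N - 1 - (k : ℕ)) + 1 = N := by omega
      have : (((k : ℕ) + (N - 1 - (k : ℕ)) + 1 : ℕ) : ℝ) = N := by exact_mod_cast this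
      push_cast at this ⊢
      linarith
    rw [h4] at h3
    rw [hx]
    apply le_antisymm
    · nlinarith
    · exact h2
end

section
/- Fix α ∈ (0,1), p ≥ 1 and a ∈ ℝ. Let ε be a real random variable with E[|ε|^p] < ∞, and let m₁ : ℝ^d → ℝ and m₂ : ℝ^d → (0,∞) be Lipschitz with constants [m₁]_Lip and [m₂]_Lip. Then the function G_a : ℝ^d → ℝ defined by G_a(x) = E[ρ_α(m₁(x) + m₂(x)ε − a)] is Lipschitz with Lipschitz constant max(α, 1−α)·[m]_Lip, where [m]_Lip = [m₁]_Lip + [m₂]_Lip·(E[|ε|^p])^{1/p}: for all u, v ∈ ℝ^d, |G_a(u) − G_a(v)| ≤ max(α, 1−α)·[m]_Lip·|u − v|. -/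
open MeasureTheory ProbabilityTheory Filter

/-- The check (pinball) function `ρ_α(z) = z(α − 1_{z<0})`. -/
noncomputable def checkFn (α z : ℝ) : ℝ := z * (α - if z < 0 then 1 else 0)

/-- `G_a(x) = E[ρ_α(m₁(x)+m₂(x)ε−a)]`. -/
noncomputable def Gfun {d : ℕ} {Ω : Type*} [MeasurableSpace Ω] (P : Measure Ω) (ε : Ω → ℝ)
    (m₁ m₂ : EuclideanSpace ℝ (Fin d) → ℝ) (α a : ℝ) (x : EuclideanSpace ℝ (Fin d)) : ℝ :=
  ∫ ω, checkFn α (m₁ x + m₂ x * ε ω - a) ∂P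

theorem checkFn_lip {α : ℝ} (h0 : 0 < α) (h1 : α < 1) (x y : ℝ) :
    |checkFn α x - checkFn α y| ≤ max α (1 - α) * |x - y| := by
  have key : ∀ z, checkFn α z = max (α * z) ((α - 1) * z) := by
    intro z
    unfold checkFn
    split_ifs with h
    · rw [max_eq_right (by linarith)]; ring
    · rw [max_eq_left (by linarith)]; ring
  rw [key, key]
  refine (abs_max_sub_max_le_max _ _ _ _).trans ?_
  rw [← mul_sub, ← mul_sub, abs_mul, abs_mul, abs_of_pos h0, abs_of_neg (by linarith : α - 1 < 0)]
  refine max_le ?_ ?_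
  · exact mul_le_mul_of_nonneg_right (le_max_left _ _) (abs_nonneg _)
  · refine mul_le_mul_of_nonneg_right ?_ (abs_nonneg _)
    rw [neg_sub]; exact le_max_right _ _

/-- if `ε ∈ L^p`, `m₁` and `m₂` are Lipschitz with constants `K₁`, `K₂` and
`m₂ > 0`, then `G_a` is Lipschitz with constant
`max(α,1−α)·(K₁ + K₂·(E[|ε|^p])^{1/p})`. -/
theorem Gfun_lipschitz {d : ℕ} (α p : ℝ) (hα : α ∈ Set.Ioo (0:ℝ) 1) (hp : 1 ≤ p) (a : ℝ)
    {Ω : Type*} [MeasurableSpace Ω] (P : Measure Ω) [IsProbabilityMeasure P]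
    (ε : Ω → ℝ) (hεm : Measurable ε) (hεmom : Integrable (fun ω => |ε ω| ^ p) P)
    (m₁ m₂ : EuclideanSpace ℝ (Fin d) → ℝ) (K₁ K₂ : NNReal)
    (h₁ : LipschitzWith K₁ m₁) (h₂ : LipschitzWith K₂ m₂) (h₂pos : ∀ x, 0 < m₂ x) :
    ∀ u v : EuclideanSpace ℝ (Fin d),
      |Gfun P ε m₁ m₂ α a u - Gfun P ε m₁ m₂ α a v| ≤
        max α (1 - α) * ((K₁ : ℝ) + (K₂ : ℝ) * (∫ ω, |ε ω| ^ p ∂P) ^ (1 / p)) * ‖u - v‖ := by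
  intro u v
  have hp0 : 0 < p := by linarith
  obtain ⟨hα0, hα1⟩ := hα
  have hM0 : 0 ≤ max α (1 - α) := le_max_of_le_left hα0.le
  have hI : Integrable (fun ω => |ε ω|) P := by
    refine Integrable.mono' ((integrable_const (1:ℝ)).add hεmom)
      hεm.abs.aestronglyMeasurable (Eventually.of_forall fun ω => ?_)
    simp only [Real.norm_eq_abs, abs_abs, Pi.add_apply]
    have h0 := Real.rpow_nonneg (abs_nonneg (ε ω)) p
    rcases le_total |ε ω| 1 with h | h
    · linarith
    · have := Real.self_le_rpow_of_one_le h hp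
      linarith
  have hE : Integrable ε P := (integrable_norm_iff hεm.aestronglyMeasurable).1 hI
  have hJ : ∫ ω, |ε ω| ∂P ≤ (∫ ω, |ε ω| ^ p ∂P) ^ (1 / p) := by
    have hc := (convexOn_rpow hp).map_integral_le (μ := P) (f := fun ω => |ε ω|)
      (continuousOn_id.rpow_const fun x _ => Or.inr hp0.le) isClosed_Ici
      (Eventually.of_forall fun ω => abs_nonneg (ε ω)) hI hεmom
    have hn : 0 ≤ ∫ ω, |ε ω| ∂P := integral_nonneg fun ω => abs_nonneg _
    calc ∫ ω, |ε ω| ∂P = ((∫ ω, |ε ω| ∂P) ^ p) ^ (1 / p) := by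
          rw [one_div, Real.rpow_rpow_inv hn hp0.ne']
      _ ≤ _ := Real.rpow_le_rpow (Real.rpow_nonneg hn p) hc (by positivity)
  have hmeas : Measurable (checkFn α) := by
    unfold checkFn
    exact measurable_id.mul (measurable_const.sub
      (Measurable.ite measurableSet_Iio measurable_const measurable_const))
  have hint : ∀ x, Integrable (fun ω => checkFn α (m₁ x + m₂ x * ε ω - a)) P := by
    intro x
    have h : Integrable (fun ω => m₁ x + m₂ x * ε ω - a) P :=
      ((integrable_const _).add (hE.const_mul _)).sub (integrable_const _)
    refine Integrable.mono' (h.abs.const_mul (max α (1 - α)))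
      (hmeas.comp (by fun_prop)).aestronglyMeasurable (Eventually.of_forall fun ω => ?_)
    have := checkFn_lip hα0 hα1 (m₁ x + m₂ x * ε ω - a) 0
    simpa [checkFn] using this
  have hd1 : |m₁ u - m₁ v| ≤ K₁ * ‖u - v‖ := by
    simpa [Real.dist_eq, dist_eq_norm] using h₁.dist_le_mul u v
  have hd2 : |m₂ u - m₂ v| ≤ K₂ * ‖u - v‖ := by
    simpa [Real.dist_eq, dist_eq_norm] using h₂.dist_le_mul u v
  unfold Gfun
  rw [← integral_sub (hint u) (hint v)]
  calc _ ≤ ∫ ω, |checkFn α (m₁ u + m₂ u * ε ω - a) - checkFn α (m₁ v + m₂ v * ε ω - a)| ∂P :=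
        abs_integral_le_integral_abs
    _ ≤ ∫ ω, max α (1 - α) * (K₁ * ‖u - v‖ + K₂ * ‖u - v‖ * |ε ω|) ∂P := by
        refine integral_mono ((hint u).sub (hint v)).abs
          (((integrable_const _).add (hI.const_mul _)).const_mul _) fun ω => ?_
        refine (checkFn_lip hα0 hα1 _ _).trans (mul_le_mul_of_nonneg_left ?_ hM0)
        calc _ = |(m₁ u - m₁ v) + (m₂ u - m₂ v) * ε ω| := by congr 1; ring
          _ ≤ |m₁ u - m₁ v| + |m₂ u - m₂ v| * |ε ω| := by
            rw [← abs_mul]; exact abs_add_le _ _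
          _ ≤ _ := by gcongr
    _ = max α (1 - α) * (K₁ * ‖u - v‖ + K₂ * ‖u - v‖ * ∫ ω, |ε ω| ∂P) := by
        rw [integral_const_mul, integral_add (integrable_const _) (hI.const_mul _)]
        have h3 : ∫ ω, K₂ * ‖u - v‖ * |ε ω| ∂P = K₂ * ‖u - v‖ * ∫ ω, |ε ω| ∂P :=
          integral_const_mul _ _
        rw [h3]
        simp
    _ ≤ max α (1 - α) * (K₁ * ‖u - v‖ + K₂ * ‖u - v‖ * (∫ ω, |ε ω| ^ p ∂P) ^ (1 / p)) := by
        gcongr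
    _ = _ := by ring
end
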